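/- A nontrivial recurrent homeomorphism of the real projective plane ℝP² either has a unique fixed point or is an involution. -/

import Mathlib

open Filter Topology Metric

/-- `f` is recurrent with respect to the metric `m`: some sequence of iterates
`f^[n k]` with `n k → ∞` converges uniformly to the identity. -/
def RecurrentWith {X : Type*} (m : MetricSpace X) (f : X → X) : Prop :=
  ∃ n : ℕ → ℕ, Filter.Tendsto n Filter.atTop Filter.atTop ∧
    ∀ ε > 0, ∀ᶠ k in Filter.atTop, ∀ x, @dist X m.toDist (f^[n k] x) x < ε

/-- `f` is a recurrent map of the metric space `X`. -/
def IsRecurrent {X : Type*} [m : MetricSpace X] (f : X → X) : Prop :=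
  RecurrentWith m f

/-- The 2-sphere. -/
abbrev Sphere2 : Set (EuclideanSpace ℝ (Fin 3)) := Metric.sphere 0 1

/-- The real projective plane: the quotient of the 2-sphere by the antipodal map. -/
abbrev ProjPlane := Quot (fun x y : Sphere2 => (y : EuclideanSpace ℝ (Fin 3)) = -(x : EuclideanSpace ℝ (Fin 3)))


local notation "τi" => (2 * (Real.pi : ℂ) * Complex.I)


/-- `f` has a continuous logarithm on `S`. -/
def HasLog {X : Type*} [TopologicalSpace X] (f : X → ℂ) (S : Set X) : Prop :=
  ∃ l : X → ℂ, ContinuousOn l S ∧ ∀ x ∈ S, Complex.exp (l x) = f x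

theorem star_lift {E' X E : Type*} [TopologicalSpace E'] [TopologicalSpace X] {p : E' → X}
    (cov : IsCoveringMap p) [AddCommGroup E] [Module ℝ E] [TopologicalSpace E]
    [IsTopologicalAddGroup E] [ContinuousSMul ℝ E] {S : Set E} {x0 : E}
    (hS : StarConvex ℝ x0 S) (hx0 : x0 ∈ S) (f : C(S, X)) (e0 : E') (he : p e0 = f ⟨x0, hx0⟩) :
    ∃ F : C(S, E'), (∀ x, p (F x) = f x) ∧ F ⟨x0, hx0⟩ = e0 := by
  have hmem : ∀ (t : unitInterval) (z : S), x0 + (t:ℝ) • ((z:E) - x0) ∈ S := by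
    intro t z
    exact hS.add_smul_sub_mem z.2 t.2.1 t.2.2
  let H : C(unitInterval × S, X) := ⟨fun q => f ⟨x0 + (q.1:ℝ) • ((q.2:E) - x0), hmem q.1 q.2⟩, by
    fun_prop⟩
  have H0 : ∀ a, H (0, a) = p ((ContinuousMap.const S e0) a) := by
    intro a
    simp [H, he]
  let K := cov.liftHomotopy H (ContinuousMap.const S e0) H0
  have hK : ∀ q, p (K q) = H q := fun q => congr_fun (cov.liftHomotopy_lifts H _ H0) q
  refine ⟨⟨fun z => K (1, z), by fun_prop⟩, fun x => ?_, ?_⟩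
  · simp [hK, H]
  · -- the lifted constant path is constant
    have h1 : ∀ t : unitInterval, K (t, ⟨x0, hx0⟩) = K (0, ⟨x0, hx0⟩) := by
      intro t
      apply cov.const_of_comp (g := fun t => K (t, ⟨x0, hx0⟩)) (by fun_prop)
      intro a b
      simp [hK, H]
    have := cov.liftHomotopy_zero H (ContinuousMap.const S e0) H0 ⟨x0, hx0⟩
    show K (1, _) = e0
    rw [h1 1]
    exact this

theorem star_log {E : Type*} [AddCommGroup E] [Module ℝ E] [TopologicalSpace E]
    [IsTopologicalAddGroup E] [ContinuousSMul ℝ E] {S : Set E} {x0 : E}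
    (hS : StarConvex ℝ x0 S) {f : E → ℂ} (hf : ContinuousOn f S) (h0 : ∀ x ∈ S, f x ≠ 0) :
    HasLog f S := by
  classical
  rcases S.eq_empty_or_nonempty with rfl | hne
  · exact ⟨0, continuousOn_empty _, by simp⟩
  have hx0 : x0 ∈ S := hS.mem hne
  let F : C(S, {z : ℂ // z ≠ 0}) := ⟨fun x => ⟨f x, h0 x x.2⟩, by
    have := continuousOn_iff_continuous_domRestrict.1 hf
    exact Continuous.subtype_mk this _⟩
  obtain ⟨G, hG, -⟩ := star_lift Complex.isCoveringMap_exp hS hx0 F (Complex.log (f x0))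
    (Subtype.ext (Complex.exp_log (h0 x0 hx0)))
  refine ⟨fun x => if h : x ∈ S then G ⟨x, h⟩ else 0, ?_, ?_⟩
  · rw [continuousOn_iff_continuous_domRestrict]
    convert G.continuous using 1
    ext x
    simp
  · intro x hx
    have := congrArg Subtype.val (hG ⟨x, hx⟩)
    simp only [hx, dif_pos]
    exact this

theorem log_univ {E : Type*} [AddCommGroup E] [Module ℝ E] [TopologicalSpace E]
    [IsTopologicalAddGroup E] [ContinuousSMul ℝ E] {f : E → ℂ} (hf : Continuous f)
    (h0 : ∀ x, f x ≠ 0) : ∃ l : E → ℂ, Continuous l ∧ ∀ x, Complex.exp (l x) = f x := by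
  obtain ⟨l, h1, h2⟩ := star_log (S := Set.univ) (x0 := (0:E)) (fun y _ a b _ _ _ => trivial)
    hf.continuousOn (fun x _ => h0 x)
  exact ⟨l, continuousOn_univ.1 h1, fun x => h2 x trivial⟩


theorem int_const {X : Type*} [TopologicalSpace X] {S : Set X} (hS : IsPreconnected S)
    {h : X → ℂ} (hc : ContinuousOn h S) (hi : ∀ x ∈ S, ∃ n : ℤ, h x = n * τi)
    {x y : X} (hx : x ∈ S) (hy : y ∈ S) : h x = h y := by
  have : IsDiscrete (AddSubgroup.zmultiples τi : Set ℂ) :=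
    ⟨NormedSpace.discreteTopology_zmultiples _⟩
  refine hS.constant_of_mapsTo (T := (AddSubgroup.zmultiples τi : Set ℂ)) this hc ?_ hx hy
  intro x hx
  obtain ⟨n, hn⟩ := hi x hx
  rw [hn]
  exact ⟨n, by simp⟩

theorem log_unique {X : Type*} [TopologicalSpace X] {S : Set X} (hS : IsPreconnected S)
    {l m : X → ℂ} (hl : ContinuousOn l S) (hm : ContinuousOn m S)
    (he : ∀ x ∈ S, Complex.exp (l x) = Complex.exp (m x))
    {x y : X} (hx : x ∈ S) (hy : y ∈ S) : l x - m x = l y - m y := by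
  refine int_const hS (h := fun x => l x - m x) (hl.sub hm) ?_ hx hy
  intro x hx
  obtain ⟨n, hn⟩ := Complex.exp_eq_exp_iff_exists_int.1 (he x hx)
  exact ⟨n, by rw [hn]; ring⟩

theorem int_small {n : ℤ} {z : ℂ} (h : z = n * τi) (hz : ‖z‖ < 6) : n = 0 ∧ z = 0 := by
  have hn : n = 0 := by
    by_contra hne
    rw [h] at hz
    have h1 : (1:ℝ) ≤ |(n:ℝ)| := by exact_mod_cast Int.one_le_abs hne
    have h3 := Real.pi_gt_three
    have : ‖(n:ℂ) * τi‖ = |(n:ℝ)| * (2 * Real.pi) := by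
      simp [abs_of_pos Real.pi_pos]
    rw [this] at hz
    nlinarith
  exact ⟨hn, by rw [h, hn]; simp⟩

/-- Change of the logarithm of `f` along `[a,b]`. -/
noncomputable def dlog (f : ℝ → ℂ) (a b : ℝ) : ℂ :=
  open Classical in
  if h : HasLog f (Set.Icc a b) then h.choose b - h.choose a else 0

theorem dlog_eq {f l : ℝ → ℂ} {a b : ℝ} (hab : a ≤ b) (hl : ContinuousOn l (Set.Icc a b))
    (he : ∀ x ∈ Set.Icc a b, Complex.exp (l x) = f x) : dlog f a b = l b - l a := by
  have h : HasLog f (Set.Icc a b) := ⟨l, hl, he⟩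
  rw [dlog, dif_pos h]
  have := log_unique (S := Set.Icc a b) isPreconnected_Icc h.choose_spec.1 hl
    (fun x hx => by rw [h.choose_spec.2 x hx, he x hx]) (x := b) (y := a)
    (Set.right_mem_Icc.2 hab) (Set.left_mem_Icc.2 hab)
  linear_combination this

theorem hasLog_Icc {f : ℝ → ℂ} {a b : ℝ} (hf : ContinuousOn f (Set.Icc a b))
    (h0 : ∀ x ∈ Set.Icc a b, f x ≠ 0) : HasLog f (Set.Icc a b) := by
  rcases le_or_gt a b with hab | hab
  · exact star_log ((convex_Icc a b).starConvex (Set.left_mem_Icc.2 hab)) hf h0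
  · exact ⟨0, continuousOn_const, by simp [Set.Icc_eq_empty (not_le.2 hab)]⟩

theorem dlog_mul {f g : ℝ → ℂ} {a b : ℝ} (hab : a ≤ b) (hf : ContinuousOn f (Set.Icc a b))
    (h0 : ∀ x ∈ Set.Icc a b, f x ≠ 0) (hg : ContinuousOn g (Set.Icc a b))
    (g0 : ∀ x ∈ Set.Icc a b, g x ≠ 0) :
    dlog (fun t => f t * g t) a b = dlog f a b + dlog g a b := by
  obtain ⟨l, hl, hl'⟩ := hasLog_Icc hf h0
  obtain ⟨m, hm, hm'⟩ := hasLog_Icc hg g0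
  rw [dlog_eq hab hl hl', dlog_eq hab hm hm', dlog_eq hab (hl.add hm)]
  · simp; ring
  · intro x hx
    simp [Complex.exp_add, hl' x hx, hm' x hx]

theorem dlog_congr {f g : ℝ → ℂ} {a b : ℝ} (hab : a ≤ b) (h : ∀ x ∈ Set.Icc a b, f x = g x) :
    dlog f a b = dlog g a b := by
  by_cases hg : HasLog g (Set.Icc a b)
  · obtain ⟨m, hm, hm'⟩ := hg
    rw [dlog_eq hab hm hm', dlog_eq hab hm (fun x hx => by rw [hm' x hx, h x hx])]
  · have : ¬ HasLog f (Set.Icc a b) := fun ⟨m, hm, hm'⟩ =>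
      hg ⟨m, hm, fun x hx => by rw [hm' x hx, h x hx]⟩
    simp [dlog, hg, this]

theorem dlog_int {f : ℝ → ℂ} {a b : ℝ} (hab : a ≤ b) (hf : ContinuousOn f (Set.Icc a b))
    (h0 : ∀ x ∈ Set.Icc a b, f x ≠ 0) (hl : f a = f b) : ∃ n : ℤ, dlog f a b = n * τi := by
  obtain ⟨l, hl1, hl2⟩ := hasLog_Icc hf h0
  rw [dlog_eq hab hl1 hl2]
  have : Complex.exp (l b) = Complex.exp (l a) := by
    rw [hl2 a (Set.left_mem_Icc.2 hab), hl2 b (Set.right_mem_Icc.2 hab), hl]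
  obtain ⟨n, hn⟩ := Complex.exp_eq_exp_iff_exists_int.1 this
  exact ⟨n, by rw [hn]; ring⟩

theorem mem_slit_of_near {z : ℂ} (h : ‖z - 1‖ < 1) : z ∈ Complex.slitPlane := by
  left
  have h1 := Complex.abs_re_le_norm (z - 1)
  simp at h1
  have := abs_lt.1 (lt_of_le_of_lt h1 h)
  linarith [this.1]

/-- Perturbation: if `f/h` stays close to `1`, a loop has the same winding. -/
theorem dlog_near {f h : ℝ → ℂ} {a b : ℝ} (hab : a ≤ b) (hf : ContinuousOn f (Set.Icc a b))
    (hh : ContinuousOn h (Set.Icc a b)) (h0 : ∀ x ∈ Set.Icc a b, h x ≠ 0)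
    (hn : ∀ x ∈ Set.Icc a b, ‖f x - h x‖ < ‖h x‖) (lf : f a = f b) (lh : h a = h b) :
    dlog f a b = dlog h a b := by
  have hs : ∀ x ∈ Set.Icc a b, f x / h x ∈ Complex.slitPlane := by
    intro x hx
    apply mem_slit_of_near
    have h1 : 0 < ‖h x‖ := norm_pos_iff.2 (h0 x hx)
    have : f x / h x - 1 = (f x - h x) / h x := by field_simp [h0 x hx]
    rw [this, norm_div, div_lt_one h1]
    exact hn x hx
  have hq : ContinuousOn (fun t => f t / h t) (Set.Icc a b) := hf.div hh h0
  have e1 : dlog (fun t => f t / h t) a b = 0 := by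
    rw [dlog_eq hab (l := fun t => Complex.log (f t / h t)) (hq.clog hs)]
    · simp [lf, lh]
    · intro x hx
      exact Complex.exp_log (Complex.slitPlane_ne_zero (hs x hx))
  have e2 := dlog_mul hab hq (fun x hx => Complex.slitPlane_ne_zero (hs x hx)) hh h0
  rw [e1, zero_add] at e2
  rw [← e2]
  apply dlog_congr hab
  intro x hx
  have := h0 x hx
  field_simp


theorem circle_no_log (q : ℂ) {R : ℝ} (hR : 0 < R) {k : ℕ} (hk : k ≠ 0) :
    ¬ HasLog (fun z => (z - q) ^ k) (sphere q R) := by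
  rintro ⟨l, hl, hl'⟩
  have hmem : ∀ t : ℝ, q + R * Complex.exp (t * Complex.I) ∈ sphere q R := by
    intro t
    simp [Complex.norm_exp_ofReal_mul_I, abs_of_pos hR]
  have h1 : Continuous fun t : ℝ => l (q + R * Complex.exp (t * Complex.I)) :=
    hl.comp_continuous (by fun_prop) hmem
  have h2 := log_unique (S := Set.univ) isPreconnected_univ h1.continuousOn
    (m := fun t : ℝ => (k * (Complex.log R + t * Complex.I) : ℂ)) (by fun_prop) (by
      intro t _
      rw [hl' _ (hmem t), Complex.exp_nat_mul, Complex.exp_add, Complex.exp_log (by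
        exact_mod_cast hR.ne')]
      simp) (x := 0) (y := 2 * Real.pi) trivial trivial
  have h3 : Complex.exp (2 * Real.pi * Complex.I) = 1 := Complex.exp_two_pi_mul_I
  simp [h3] at h2
  ring_nf at h2
  simp [hk] at h2

theorem log_open_conn {U : Set ℂ} (hU : IsOpen U) (hc : IsConnected U) {f : ℂ → ℂ}
    (hf : ContinuousOn f U) (h0 : ∀ x ∈ U, f x ≠ 0)
    (hl : ∀ γ : ℝ → ℂ, Continuous γ → (∀ t, γ t ∈ U) → γ 0 = γ 2 →
      dlog (fun t => f (γ t)) 0 2 = 0) : HasLog f U := by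
  classical
  have : PathConnectedSpace U := isPathConnected_iff_pathConnectedSpace.1
    (hU.isConnected_iff_isPathConnected.1 hc)
  have := hU.locallyPathConnectedSpace
  obtain ⟨x0, hx0⟩ := hc.nonempty
  let F : C(U, {z : ℂ // z ≠ 0}) := ⟨fun x => ⟨f x, h0 x x.2⟩, by
    have := continuousOn_iff_continuous_domRestrict.1 hf
    exact Continuous.subtype_mk this _⟩
  have cov := Complex.isCoveringMap_exp
  have hF : ∀ x, (F x : ℂ) = f x := fun x => rfl
  obtain ⟨G, ⟨-, hG⟩, -⟩ := cov.isLocalHomeomorph.existsUnique_continuousMap_lifts F ⟨x0, hx0⟩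
    (Complex.log (f x0)) (Subtype.ext (Complex.exp_log (h0 x0 hx0)))
    (by
      intro γ hγ
      obtain ⟨Γ, h1, h2⟩ := cov.exists_path_lifts (F.comp γ) (Complex.log (f x0)) (by
        rw [ContinuousMap.comp_apply, hγ]
        exact (Subtype.ext (Complex.exp_log (h0 x0 hx0))).symm)
      exact ⟨Γ, h2, h1⟩)
    (by
      intro γ γ' Γ Γ' g0 g0' G0 G0' hΓ hΓ' h1
      have e1 : ∀ s, Complex.exp (Γ s) = f (γ s) := fun s => congrArg Subtype.val (congr_fun hΓ s)
      have e2 : ∀ s, Complex.exp (Γ' s) = f (γ' s) :=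
        fun s => congrArg Subtype.val (congr_fun hΓ' s)
      let pr : ℝ → unitInterval := Set.projIcc 0 1 zero_le_one
      have prc : Continuous pr := continuous_projIcc
      have pr1 : pr 1 = 1 := Set.projIcc_right _
      have pr0 : pr 0 = 0 := Set.projIcc_left _
      let δ : ℝ → ℂ := fun t => if t ≤ 1 then (γ (pr t) : ℂ) else γ' (pr (2 - t))
      let m : ℝ → ℂ := fun t => if t ≤ 1 then Γ (pr t) else Γ' (pr (2 - t)) + (Γ 1 - Γ' 1)
      have hδ : Continuous δ := by
        refine Continuous.if_le (by fun_prop) (by fun_prop) continuous_id continuous_const ?_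
        rintro x rfl
        norm_num [pr1, h1]
      have hm : Continuous m := by
        refine Continuous.if_le (by fun_prop) (by fun_prop) continuous_id continuous_const ?_
        rintro x rfl
        norm_num [pr1]
      have hd := hl δ hδ (by
        intro t
        simp only [δ]
        split_ifs
        · exact (γ _).2
        · exact (γ' _).2) (by
        simp [δ, pr0, g0, g0'])
      rw [dlog_eq (l := m) (by norm_num) hm.continuousOn] at hd
      · simp [m, pr0, G0, G0'] at hd
        linear_combination hd
      · intro t _
        simp only [m, δ]
        split_ifs
        · exact e1 _
        · rw [Complex.exp_add, Complex.exp_sub, e1, e2, e2, h1, div_self, mul_one]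
          exact h0 _ (γ' 1).2)
  refine ⟨fun x => if h : x ∈ U then G ⟨x, h⟩ else 0, ?_, ?_⟩
  · rw [continuousOn_iff_continuous_domRestrict]
    convert G.continuous using 1
    ext x
    simp
  · intro x hx
    simp only [hx, dif_pos]
    exact congrArg Subtype.val (congr_fun hG ⟨x, hx⟩)

theorem log_open {U : Set ℂ} (hU : IsOpen U) {f : ℂ → ℂ}
    (hf : ContinuousOn f U) (h0 : ∀ x ∈ U, f x ≠ 0)
    (hl : ∀ γ : ℝ → ℂ, Continuous γ → (∀ t, γ t ∈ U) → γ 0 = γ 2 →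
      dlog (fun t => f (γ t)) 0 2 = 0) : HasLog f U := by
  have key : ∀ S : Set ℂ, ∃ l : ℂ → ℂ, (∃ x ∈ U, S = connectedComponentIn U x) →
      ContinuousOn l S ∧ ∀ x ∈ S, Complex.exp (l x) = f x := by
    intro S
    by_cases hS : ∃ x ∈ U, S = connectedComponentIn U x
    · obtain ⟨x, hx, rfl⟩ := hS
      have hsub := connectedComponentIn_subset U x
      obtain ⟨l, h1⟩ := log_open_conn (hU.connectedComponentIn (x := x))
        (isConnected_connectedComponentIn_iff.2 hx)
        (hf.mono hsub) (fun z hz => h0 z (hsub hz))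
        (fun γ h1 h2 h3 => hl γ h1 (fun t => hsub (h2 t)) h3)
      exact ⟨l, fun _ => h1⟩
    · exact ⟨0, fun h => (hS h).elim⟩
  choose L hL using key
  refine ⟨fun z => L (connectedComponentIn U z) z, ?_, ?_⟩
  · intro x hx
    have ho := hU.connectedComponentIn (x := x)
    have hm := mem_connectedComponentIn hx
    have h1 := (hL _ ⟨x, hx, rfl⟩).1.continuousAt (ho.mem_nhds hm)
    refine (h1.congr ?_).continuousWithinAt
    filter_upwards [ho.mem_nhds hm] with z hz
    rw [connectedComponentIn_eq hz]
  · intro x hx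
    exact (hL _ ⟨x, hx, rfl⟩).2 x (mem_connectedComponentIn hx)

/-- winding number (times `2πi`) -/
noncomputable def wn (γ : ℝ → ℂ) (a b : ℝ) (u : ℂ) : ℂ := dlog (fun t => γ t - u) a b

theorem dlog_const {a b : ℝ} (hab : a ≤ b) {u : ℂ} (hu : u ≠ 0) : dlog (fun _ => u) a b = 0 := by
  rw [dlog_eq hab (l := fun _ => Complex.log u) continuousOn_const]
  · simp
  · intro x _; exact Complex.exp_log hu

theorem wn_int {γ : ℝ → ℂ} {a b : ℝ} (hab : a ≤ b) (hγ : ContinuousOn γ (Set.Icc a b))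
    (hl : γ a = γ b) {u : ℂ} (hu : ∀ t ∈ Set.Icc a b, γ t ≠ u) : ∃ n : ℤ, wn γ a b u = n * τi :=
  dlog_int hab (hγ.sub continuousOn_const) (fun t ht => sub_ne_zero.2 (hu t ht)) (by simp [hl])

theorem wn_locconst {γ : ℝ → ℂ} {a b : ℝ} (hab : a ≤ b) (hγ : ContinuousOn γ (Set.Icc a b))
    (hl : γ a = γ b) {u : ℂ} (hu : ∀ t ∈ Set.Icc a b, γ t ≠ u) :
    ∀ᶠ u' in 𝓝 u, wn γ a b u' = wn γ a b u := by
  have hK : IsCompact (γ '' Set.Icc a b) := isCompact_Icc.image_of_continuousOn hγ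
  have : u ∈ (γ '' Set.Icc a b)ᶜ := by rintro ⟨t, ht, h⟩; exact hu t ht h
  obtain ⟨r, hr, hb⟩ := Metric.isOpen_iff.1 hK.isClosed.isOpen_compl u this
  filter_upwards [ball_mem_nhds u hr] with u' hu'
  refine dlog_near hab (hγ.sub continuousOn_const) (hγ.sub continuousOn_const)
    (fun t ht => sub_ne_zero.2 (hu t ht)) ?_ (by simp [hl]) (by simp [hl])
  intro t ht
  have h1 : γ t ∉ ball u r := fun h => hb h ⟨t, ht, rfl⟩
  rw [mem_ball, not_lt, dist_eq_norm] at h1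
  rw [mem_ball, dist_eq_norm] at hu'
  calc _ = ‖u' - u‖ := by rw [← norm_neg]; congr 1; ring
    _ < _ := lt_of_lt_of_le hu' h1

theorem wn_far {γ : ℝ → ℂ} {a b : ℝ} (hab : a ≤ b) (hγ : ContinuousOn γ (Set.Icc a b))
    (hl : γ a = γ b) : ∃ R : ℝ, 0 < R ∧ ∀ u : ℂ, R < ‖u‖ → wn γ a b u = 0 := by
  have hK : IsCompact (γ '' Set.Icc a b) := isCompact_Icc.image_of_continuousOn hγ
  obtain ⟨R, hR⟩ := hK.isBounded.exists_norm_le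
  refine ⟨max R 1, by positivity, fun u hu => ?_⟩
  have hu0 : u ≠ 0 := by
    rintro rfl
    have := le_max_right R 1
    simp at hu
    linarith
  rw [← dlog_const hab (neg_ne_zero.2 hu0)]
  refine dlog_near hab (hγ.sub continuousOn_const) continuousOn_const
    (fun t ht => neg_ne_zero.2 hu0) ?_ (by simp [hl]) rfl
  intro t ht
  have := hR _ ⟨t, ht, rfl⟩
  have h2 := le_max_left R 1
  simp
  linarith

theorem wn_conn {γ : ℝ → ℂ} {a b : ℝ} (hab : a ≤ b) (hγ : ContinuousOn γ (Set.Icc a b))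
    (hl : γ a = γ b) {A : Set ℂ} (hA : IsPreconnected A)
    (hu : ∀ t ∈ Set.Icc a b, γ t ∉ A) {u v : ℂ} (hu' : u ∈ A) (hv' : v ∈ A) :
    wn γ a b u = wn γ a b v := by
  have hn : ∀ u ∈ A, ∀ t ∈ Set.Icc a b, γ t ≠ u := by
    rintro u h1 t h2 rfl
    exact hu t h2 h1
  refine int_const hA (h := wn γ a b) (fun u h => ?_) (fun u h => wn_int hab hγ hl (hn u h)) hu' hv'
  refine ContinuousAt.continuousWithinAt ?_
  exact (continuousAt_const (y := wn γ a b u)).congr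
    ((wn_locconst hab hγ hl (hn u h)).mono fun _ h => h.symm)

/-- In a Hausdorff one-point compactification chart, `‖τ x‖ → ∞` at the point at infinity. -/
theorem chart_far {X : Type*} [TopologicalSpace X] [T2Space X] {e : X}
    (τ : {x : X // x ≠ e} ≃ₜ ℂ) (R : ℝ) :
    ∀ᶠ x in 𝓝 e, ∀ h : x ≠ e, R < ‖τ ⟨x, h⟩‖ := by
  have hK : IsCompact ((fun z => (τ.symm z : X)) '' closedBall (0:ℂ) R) :=
    (isCompact_closedBall _ _).image (by fun_prop)
  have : e ∈ ((fun z => (τ.symm z : X)) '' closedBall (0:ℂ) R)ᶜ := by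
    rintro ⟨z, -, h⟩
    exact (τ.symm z).2 h
  filter_upwards [hK.isClosed.isOpen_compl.mem_nhds this] with x hx h
  by_contra hc
  exact hx ⟨τ ⟨x, h⟩, by simpa using hc, by simp⟩

theorem wn_conn_inf {X : Type*} [TopologicalSpace X] [T2Space X] {e : X}
    (τ : {x : X // x ≠ e} ≃ₜ ℂ)
    {γ : ℝ → ℂ} {a b : ℝ} (hab : a ≤ b) (hγ : ContinuousOn γ (Set.Icc a b))
    (hl : γ a = γ b) {A : Set X} (hA : IsPreconnected A) (he : e ∈ A)
    (hu : ∀ t ∈ Set.Icc a b, ((τ.symm (γ t) : X)) ∉ A) {u : ℂ} (hu' : (τ.symm u : X) ∈ A) :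
    wn γ a b u = 0 := by
  classical
  have hn : ∀ u : ℂ, (τ.symm u : X) ∈ A → ∀ t ∈ Set.Icc a b, γ t ≠ u := by
    rintro u h1 t h2 rfl
    exact hu t h2 h1
  let N : X → ℂ := fun x => if h : x ≠ e then wn γ a b (τ ⟨x, h⟩) else 0
  have h0 : N e = 0 := by simp [N]
  have h1 : ∀ u : ℂ, N (τ.symm u) = wn γ a b u := by
    intro u
    have := (τ.symm u).2
    simp [N, this]
  have hx : ∀ x, x ≠ e → ∃ u : ℂ, (τ.symm u : X) = x := fun x h => ⟨τ ⟨x, h⟩, by simp⟩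
  rw [← h1, ← h0]
  refine int_const hA (h := N) ?_ ?_ hu' he
  · intro x hxA
    refine ContinuousAt.continuousWithinAt ?_
    by_cases hxe : x = e
    · subst hxe
      obtain ⟨R, hR, hR'⟩ := wn_far hab hγ hl
      refine (continuousAt_const (y := (0:ℂ))).congr ?_
      filter_upwards [chart_far τ R] with y hy
      by_cases h : y = x
      · simp [N, h]
      · simp [N, h, hR' _ (hy h)]
    · refine (continuousAt_const (y := N x)).congr ?_
      have h2 : ∀ᶠ y : {x : X // x ≠ e} in 𝓝 ⟨x, hxe⟩, wn γ a b (τ y) = wn γ a b (τ ⟨x, hxe⟩) :=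
        τ.continuous.continuousAt.eventually
          (wn_locconst hab hγ hl (hn _ (by simpa using hxA)))
      have h3 : ∀ᶠ y in 𝓝 x, y ≠ e := isOpen_ne.mem_nhds hxe
      rw [nhds_subtype_eq_comap, eventually_comap] at h2
      filter_upwards [h2, h3] with y hy hy'
      have := hy ⟨y, hy'⟩ rfl
      simp [N, hxe, hy', this]
  · intro x hxA
    by_cases hxe : x = e
    · exact ⟨0, by simp [N, hxe]⟩
    · obtain ⟨u, rfl⟩ := hx x hxe
      rw [h1]
      exact wn_int hab hγ hl (hn u hxA)


theorem HasLog.mono {X : Type*} [TopologicalSpace X] {f : X → ℂ} {S T : Set X}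
    (h : HasLog f S) (hT : T ⊆ S) : HasLog f T := by
  obtain ⟨l, h1, h2⟩ := h
  exact ⟨l, h1.mono hT, fun x hx => h2 x (hT hx)⟩

theorem HasLog.congr {X : Type*} [TopologicalSpace X] {f g : X → ℂ} {S : Set X}
    (h : HasLog f S) (hT : ∀ x ∈ S, g x = f x) : HasLog g S := by
  obtain ⟨l, h1, h2⟩ := h
  exact ⟨l, h1, fun x hx => by rw [h2 x hx, hT x hx]⟩

theorem HasLog.mul {X : Type*} [TopologicalSpace X] {f g : X → ℂ} {S : Set X}
    (hf : HasLog f S) (hg : HasLog g S) : HasLog (fun x => f x * g x) S := by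
  obtain ⟨l, h1, h2⟩ := hf
  obtain ⟨m, h3, h4⟩ := hg
  exact ⟨fun x => l x + m x, h1.add h3, fun x hx => by rw [Complex.exp_add, h2 x hx, h4 x hx]⟩

theorem HasLog.div {X : Type*} [TopologicalSpace X] {f g : X → ℂ} {S : Set X}
    (hf : HasLog f S) (hg : HasLog g S) : HasLog (fun x => f x / g x) S := by
  obtain ⟨l, h1, h2⟩ := hf
  obtain ⟨m, h3, h4⟩ := hg
  exact ⟨fun x => l x - m x, h1.sub h3, fun x hx => by rw [Complex.exp_sub, h2 x hx, h4 x hx]⟩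

theorem HasLog.zpow {X : Type*} [TopologicalSpace X] {f : X → ℂ} {S : Set X}
    (hf : HasLog f S) (k : ℤ) : HasLog (fun x => f x ^ k) S := by
  obtain ⟨l, h1, h2⟩ := hf
  exact ⟨fun x => k * l x, continuousOn_const.mul h1, fun x hx => by
    rw [Complex.exp_int_mul, h2 x hx]⟩

theorem HasLog.const {X : Type*} [TopologicalSpace X] {S : Set X} {c : ℂ} (hc : c ≠ 0) :
    HasLog (fun _ : X => c) S :=
  ⟨fun _ => Complex.log c, continuousOn_const, fun _ _ => Complex.exp_log hc⟩

theorem HasLog.ne {X : Type*} [TopologicalSpace X] {f : X → ℂ} {S : Set X}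
    (hf : HasLog f S) {x : X} (hx : x ∈ S) : f x ≠ 0 := by
  obtain ⟨l, h1, h2⟩ := hf
  rw [← h2 x hx]
  exact Complex.exp_ne_zero _

inductive RF (Y : Set ℂ) : (ℂ → ℂ) → Prop
  | one : RF Y (fun _ => 1)
  | mul (r : ℂ → ℂ) (p : ℂ) (k : ℤ) : p ∉ Y → RF Y r → RF Y (fun z => r z * (z - p) ^ k)

inductive StepF (T : Set ℝ) : (ℝ → ℤ) → Prop
  | zero : StepF T (fun _ => 0)
  | add (D : ℝ → ℤ) (q : ℝ) (k : ℤ) : q ∉ T → StepF T D → StepF T (fun y => D y + if y < q then k else 0)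

theorem RF.ne {Y : Set ℂ} {r : ℂ → ℂ} (h : RF Y r) : ∀ z ∈ Y, r z ≠ 0 := by
  induction h with
  | one => intro z _; exact one_ne_zero
  | mul r p k hp _ ih =>
    intro z hz
    refine mul_ne_zero (ih z hz) (zpow_ne_zero _ (sub_ne_zero.2 ?_))
    rintro rfl
    exact hp hz

theorem RF.times {Y : Set ℂ} {r s : ℂ → ℂ} (h : RF Y r) (hs : RF Y s) :
    RF Y (fun z => r z * s z) := by
  induction hs with
  | one => simpa using h
  | mul s p k hp _ ih =>
    have := RF.mul _ p k hp ih
    simpa [mul_assoc] using this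

theorem slit_of_re_nonneg {z : ℂ} (h : 0 ≤ z.re) (h0 : z ≠ 0) : z ∈ Complex.slitPlane := by
  rcases h.lt_or_eq with h | h
  · exact Or.inl h
  · right
    intro h2
    exact h0 (Complex.ext h.symm h2)

/-- log of `z - p` on a half plane to the right of `p`. -/
theorem logR {S : Set ℂ} {p : ℂ} (h : ∀ z ∈ S, p.re ≤ z.re) (hp : p ∉ S) :
    ContinuousOn (fun z => Complex.log (z - p)) S ∧
      ∀ z ∈ S, Complex.exp (Complex.log (z - p)) = z - p := by
  have hne : ∀ z ∈ S, z - p ≠ 0 := by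
    intro z hz h0
    rw [sub_eq_zero] at h0
    exact hp (h0 ▸ hz)
  constructor
  · refine ContinuousOn.clog (by fun_prop) fun z hz => slit_of_re_nonneg ?_ (hne z hz)
    simpa using h z hz
  · exact fun z hz => Complex.exp_log (hne z hz)

theorem logL {S : Set ℂ} {p : ℂ} (h : ∀ z ∈ S, z.re ≤ p.re) (hp : p ∉ S) :
    ContinuousOn (fun z => Complex.log (p - z) + Real.pi * Complex.I) S ∧
      ∀ z ∈ S, Complex.exp (Complex.log (p - z) + Real.pi * Complex.I) = z - p := by
  have hne : ∀ z ∈ S, p - z ≠ 0 := by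
    intro z hz h0
    rw [sub_eq_zero] at h0
    exact hp (h0 ▸ hz)
  constructor
  · refine ContinuousOn.add (ContinuousOn.clog (by fun_prop) fun z hz =>
      slit_of_re_nonneg ?_ (hne z hz)) continuousOn_const
    simpa using h z hz
  · intro z hz
    rw [Complex.exp_add, Complex.exp_log (hne z hz), Complex.exp_pi_mul_I]
    ring

theorem RF.left {Y : Set ℂ} {m : ℝ} {r : ℂ → ℂ} (h : RF (Y ∩ {z | z.re ≤ m}) r) :
    ∃ r', RF Y r' ∧ HasLog (fun z => r z / r' z) (Y ∩ {z | z.re ≤ m}) ∧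
      HasLog r' (Y ∩ {z | m ≤ z.re}) := by
  induction h with
  | one => exact ⟨_, RF.one, by simpa using HasLog.const one_ne_zero, HasLog.const one_ne_zero⟩
  | mul r p k hp hr ih =>
    obtain ⟨r', h1, h2, h3⟩ := ih
    by_cases hpm : p.re ≤ m
    · have hpY : p ∉ Y := fun h => hp ⟨h, hpm⟩
      refine ⟨_, RF.mul _ p k hpY h1, h2.congr ?_, h3.mul (HasLog.zpow ⟨_, logR ?_ ?_⟩ k)⟩
      · intro z hz
        have : z - p ≠ 0 := by
          rw [sub_ne_zero]; rintro rfl; exact hpY hz.1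
        have h4 := zpow_ne_zero k this
        rw [mul_div_mul_right _ _ h4]
      · intro z hz; exact hpm.trans hz.2
      · exact fun h => hpY h.1
    · refine ⟨r', h1, (h2.mul (HasLog.zpow ⟨_, logL (p := p) ?_ hp⟩ k)).congr ?_, h3⟩
      · intro z hz; exact hz.2.trans (not_le.1 hpm).le
      · intro z hz; ring

theorem RF.right {Y : Set ℂ} {m : ℝ} {r : ℂ → ℂ} (h : RF (Y ∩ {z | m ≤ z.re}) r) :
    ∃ r', RF Y r' ∧ HasLog (fun z => r z / r' z) (Y ∩ {z | m ≤ z.re}) ∧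
      HasLog r' (Y ∩ {z | z.re ≤ m}) := by
  induction h with
  | one => exact ⟨_, RF.one, by simpa using HasLog.const one_ne_zero, HasLog.const one_ne_zero⟩
  | mul r p k hp hr ih =>
    obtain ⟨r', h1, h2, h3⟩ := ih
    by_cases hpm : m ≤ p.re
    · have hpY : p ∉ Y := fun h => hp ⟨h, hpm⟩
      refine ⟨_, RF.mul _ p k hpY h1, h2.congr ?_, h3.mul (HasLog.zpow ⟨_, logL ?_ ?_⟩ k)⟩
      · intro z hz
        have : z - p ≠ 0 := by
          rw [sub_ne_zero]; rintro rfl; exact hpY hz.1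
        have h4 := zpow_ne_zero k this
        rw [mul_div_mul_right _ _ h4]
      · intro z hz; exact hz.2.trans hpm
      · exact fun h => hpY h.1
    · refine ⟨r', h1, (h2.mul (HasLog.zpow ⟨_, logR (p := p) ?_ hp⟩ k)).congr ?_, h3⟩
      · intro z hz; exact (not_le.1 hpm).le.trans hz.2
      · intro z hz; ring

theorem log_jump {y q : ℝ} (h : y ≠ q) :
    Complex.log ((q - y : ℝ) * Complex.I) + Real.pi * Complex.I
      - Complex.log ((y - q : ℝ) * Complex.I) = if y < q then τi else 0 := by
  rcases lt_or_gt_of_ne h with h | h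
  · rw [if_pos h, Complex.log_ofReal_mul (by linarith) Complex.I_ne_zero]
    have : (y - q : ℝ) * Complex.I = (q - y : ℝ) * (-Complex.I) := by push_cast; ring
    rw [this, Complex.log_ofReal_mul (by linarith) (by simp), Complex.log_I, Complex.log_neg_I]
    ring
  · rw [if_neg (by linarith), Complex.log_ofReal_mul (x := Complex.I) (r := y - q) (by linarith)
      Complex.I_ne_zero]
    have : (q - y : ℝ) * Complex.I = (y - q : ℝ) * (-Complex.I) := by push_cast; ring
    rw [this, Complex.log_ofReal_mul (by linarith) (by simp), Complex.log_I, Complex.log_neg_I]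
    ring

theorem StepF.rf {Y : Set ℂ} {m : ℝ} {D : ℝ → ℤ}
    (h : StepF {y | (⟨m, y⟩ : ℂ) ∈ Y} D) :
    ∃ r, RF Y r ∧ ∃ a b : ℂ → ℂ, ContinuousOn a (Y ∩ {z | z.re ≤ m}) ∧
      ContinuousOn b (Y ∩ {z | m ≤ z.re}) ∧ (∀ z ∈ Y ∩ {z | z.re ≤ m}, Complex.exp (a z) = r z) ∧
      (∀ z ∈ Y ∩ {z | m ≤ z.re}, Complex.exp (b z) = r z) ∧
      ∀ z ∈ Y, z.re = m → a z - b z = D z.im * τi := by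
  induction h with
  | zero =>
    exact ⟨_, RF.one, 0, 0, continuousOn_const, continuousOn_const, by simp, by simp, by simp⟩
  | add D q k hq hD ih =>
    obtain ⟨r, h1, a, b, ha, hb, ha', hb', hab⟩ := ih
    have hq' : (⟨m, q⟩ : ℂ) ∉ Y := hq
    obtain ⟨c1, c2⟩ := logL (S := Y ∩ {z | z.re ≤ m}) (p := ⟨m, q⟩) (fun z hz => hz.2)
      (fun h => hq' h.1)
    obtain ⟨d1, d2⟩ := logR (S := Y ∩ {z | m ≤ z.re}) (p := ⟨m, q⟩) (fun z hz => hz.2)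
      (fun h => hq' h.1)
    refine ⟨_, RF.mul r ⟨m, q⟩ k hq' h1, _, _, ha.add (continuousOn_const (c := (k:ℂ)) |>.mul c1),
      hb.add (continuousOn_const (c := (k:ℂ)) |>.mul d1), ?_, ?_, ?_⟩
    · intro z hz
      simp only [Pi.add_apply, Pi.mul_apply]
      rw [Complex.exp_add, Complex.exp_int_mul, ha' z hz, c2 z hz]
    · intro z hz
      simp only [Pi.add_apply, Pi.mul_apply]
      rw [Complex.exp_add, Complex.exp_int_mul, hb' z hz, d2 z hz]
    · intro z hz hm
      have hne : z.im ≠ q := by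
        rintro rfl
        apply hq'
        convert hz
        exact hm.symm
      have e1 : (⟨m, q⟩ : ℂ) - z = ((q - z.im : ℝ) : ℂ) * Complex.I := by
        apply Complex.ext <;> simp [hm]
      have e2 : z - (⟨m, q⟩ : ℂ) = ((z.im - q : ℝ) : ℂ) * Complex.I := by
        apply Complex.ext <;> simp [hm]
      have h3 := hab z hz hm
      have h4 := log_jump hne
      simp only [Pi.add_apply, Pi.mul_apply]
      rw [e1, e2, Int.cast_add]
      split_ifs with h5
      · rw [if_pos h5] at h4
        linear_combination h3 + (k:ℂ) * h4
      · rw [if_neg h5] at h4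
        rw [Int.cast_zero]
        linear_combination h3 + (k:ℂ) * h4

theorem interval_ind {P : ℝ → Prop} {a : ℝ} (base : P a)
    (step : ∀ x ≥ a, ∃ ε > 0, ∀ s, x - ε < s → s ≤ x → a ≤ s → P s →
      ∀ t, x ≤ t → t ≤ x + ε → P t) : ∀ t ≥ a, P t := by
  by_contra! hc
  obtain ⟨t0, ht0, hP0⟩ := hc
  let B := {t | a ≤ t ∧ ¬ P t}
  have hne : B.Nonempty := ⟨t0, ht0, hP0⟩
  have hbdd : BddBelow B := ⟨a, fun t ht => ht.1⟩
  have hax : a ≤ sInf B := le_csInf hne fun t ht => ht.1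
  obtain ⟨ε, hε, h⟩ := step (sInf B) hax
  have hlt : ∀ s, a ≤ s → s < sInf B → P s := by
    intro s h1 h2
    by_contra h3
    exact absurd (csInf_le hbdd ⟨h1, h3⟩) (not_le.2 h2)
  have key : ∃ s, sInf B - ε < s ∧ s ≤ sInf B ∧ a ≤ s ∧ P s := by
    rcases hax.eq_or_lt with h1 | h1
    · exact ⟨a, by linarith, by linarith, le_rfl, base⟩
    · refine ⟨max a (sInf B - ε / 2), ?_, ?_, le_max_left _ _, hlt _ (le_max_left _ _) ?_⟩
      · exact lt_of_lt_of_le (by linarith) (le_max_right _ _)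
      · exact max_le h1.le (by linarith)
      · exact max_lt h1 (by linarith)
  obtain ⟨s, h1, h2, h3, h4⟩ := key
  have h5 := h s h1 h2 h3 h4
  have : sInf B + ε ≤ sInf B := by
    apply le_csInf hne
    intro t ht
    by_contra h6
    exact ht.2 (h5 t (csInf_le hbdd ht) (by linarith))
  linarith

theorem StepF.trunc {T : Set ℝ} {D : ℝ → ℤ} (h : StepF T D) (s : ℝ) :
    ∃ D' C, StepF T D' ∧ (∀ y ≤ s, D y = D' y + C) ∧ ∀ y ≥ s, D' y = 0 := by
  induction h with
  | zero => exact ⟨_, 0, StepF.zero, by simp, by simp⟩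
  | add D q k hq hD ih =>
    obtain ⟨D', C, h1, h2, h3⟩ := ih
    by_cases hqs : q ≤ s
    · refine ⟨_, C, StepF.add D' q k hq h1, ?_, ?_⟩
      · intro y hy; simp only; rw [h2 y hy]; ring
      · intro y hy; rw [h3 y hy, if_neg (by linarith)]; simp
    · refine ⟨D', C + k, h1, ?_, h3⟩
      intro y hy
      simp only
      rw [h2 y hy, if_pos (by linarith)]; ring

theorem StepF.exists {T : Set ℝ} (hT : IsCompact T) {d : ℝ → ℂ} (hd : ContinuousOn d T)
    (hi : ∀ y ∈ T, ∃ n : ℤ, d y = n * τi) : ∃ D, StepF T D ∧ ∀ y ∈ T, d y = D y * τi := by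
  obtain ⟨B, hB⟩ := hT.isBounded.exists_norm_le
  have hB1 : ∀ y ∈ T, y ≤ B := fun y hy => (le_abs_self y).trans (hB y hy)
  have hB2 : ∀ y ∈ T, -B ≤ y := fun y hy => (abs_le.1 (hB y hy)).1
  have hBn : B + 1 ∉ T := fun h => by have := hB1 _ h; linarith
  let P : ℝ → Prop := fun s => ∃ D, StepF T D ∧ ∀ y ∈ T, y ≤ s → d y = D y * τi
  have key : ∀ t ≥ -B - 1, P t := by
    apply interval_ind
    · exact ⟨_, StepF.zero, fun y hy h => by have := hB2 y hy; linarith⟩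
    · intro x hx
      by_cases hxT : x ∈ T
      · obtain ⟨k, hk⟩ := hi x hxT
        obtain ⟨ε, hε, h⟩ := Metric.continuousOn_iff.1 hd x hxT 6 (by norm_num)
        have hconst : ∀ y ∈ T, |y - x| < ε → d y = k * τi := by
          intro y hy hyx
          obtain ⟨n, hn⟩ := hi y hy
          have h1 := h y hy hyx
          rw [dist_eq_norm] at h1
          have := (int_small (n := n - k) (z := d y - d x) (by rw [hn, hk]; push_cast; ring) h1).2
          rw [← hk]
          linear_combination this
        refine ⟨ε / 2, by linarith, ?_⟩
        intro s h1 h2 _ ⟨D, hD, hD'⟩ t h3 h4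
        obtain ⟨D', C, e1, e2, e3⟩ := hD.trunc s
        have big := StepF.add D' (B + 1) k hBn e1
        by_cases hsT : s ∈ T
        · have : (C : ℂ) * τi = k * τi := by
            have h5 := hconst s hsT (abs_lt.2 ⟨by linarith, by linarith⟩)
            rw [hD' s hsT le_rfl, e2 s le_rfl, e3 s le_rfl] at h5
            simpa using h5
          refine ⟨_, big, fun y hy hyt => ?_⟩
          have hyB := hB1 y hy
          rw [if_pos (by linarith)]
          rcases le_total y s with h6 | h6
          · rw [hD' y hy h6, e2 y h6]
            push_cast
            linear_combination this
          · rw [hconst y hy (abs_lt.2 ⟨by linarith, by linarith⟩), e3 y h6]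
            simp
        · refine ⟨_, StepF.add _ s (C - k) hsT big, fun y hy hyt => ?_⟩
          have hyB := hB1 y hy
          rw [if_pos (by linarith)]
          rcases lt_or_ge y s with h6 | h6
          · rw [hD' y hy h6.le, e2 y h6.le, if_pos h6]
            push_cast
            ring
          · rw [hconst y hy (abs_lt.2 ⟨by linarith, by linarith⟩), e3 y h6, if_neg (by linarith)]
            simp
      · obtain ⟨ε, hε, h⟩ := Metric.isOpen_iff.1 hT.isClosed.isOpen_compl x hxT
        refine ⟨ε / 2, by linarith, ?_⟩
        intro s h1 h2 _ ⟨D, hD, hD'⟩ t h3 h4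
        refine ⟨D, hD, fun y hy hyt => hD' y hy ?_⟩
        by_contra hc
        refine h (a := y) ?_ hy
        rw [mem_ball, Real.dist_eq, abs_lt]
        constructor <;> linarith
  obtain ⟨D, h1, h2⟩ := key (max B (-B - 1)) (le_max_right _ _)
  exact ⟨D, h1, fun y hy => h2 y hy ((hB1 y hy).trans (le_max_left _ _))⟩


/-- `v` is a rational function times an exponential on `Y`. -/
def GoodE (v : ℂ → ℂ) (Y : Set ℂ) : Prop := ∃ r, RF Y r ∧ HasLog (fun z => v z / r z) Y

theorem RF.mono {Y Z : Set ℂ} (h : Z ⊆ Y) {r : ℂ → ℂ} (hr : RF Y r) : RF Z r := by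
  induction hr with
  | one => exact RF.one
  | mul r p k hp _ ih => exact RF.mul r p k (fun hz => hp (h hz)) ih

theorem GoodE.mono {v : ℂ → ℂ} {Y Z : Set ℂ} (h : GoodE v Y) (hZ : Z ⊆ Y) : GoodE v Z := by
  obtain ⟨r, h1, h2⟩ := h
  exact ⟨r, h1.mono hZ, h2.mono hZ⟩

theorem GoodE.glue {v : ℂ → ℂ} {Y : Set ℂ} (hY : IsCompact Y) (m : ℝ)
    (hL : GoodE v (Y ∩ {z | z.re ≤ m})) (hR : GoodE v (Y ∩ {z | m ≤ z.re})) : GoodE v Y := by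
  classical
  obtain ⟨r1, a1, b1⟩ := hL
  obtain ⟨r2, a2, b2⟩ := hR
  obtain ⟨s1, c1, d1, e1⟩ := a1.left
  obtain ⟨s2, c2, d2, e2⟩ := a2.right
  have hL : HasLog (fun z => v z / (s1 z * s2 z)) (Y ∩ {z | z.re ≤ m}) := by
    refine ((b1.mul d1).div e2).congr fun z hz => ?_
    have := a1.ne z hz
    have := c1.ne z hz.1
    have := c2.ne z hz.1
    field_simp
  have hR : HasLog (fun z => v z / (s1 z * s2 z)) (Y ∩ {z | m ≤ z.re}) := by
    refine ((b2.mul d2).div e1).congr fun z hz => ?_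
    have := a2.ne z hz
    have := c1.ne z hz.1
    have := c2.ne z hz.1
    field_simp
  obtain ⟨h1, h1c, h1e⟩ := hL
  obtain ⟨h2, h2c, h2e⟩ := hR
  let ι : ℝ → ℂ := fun y => ⟨m, y⟩
  have hι : Continuous ι := by
    have : ι = fun y : ℝ => (m : ℂ) + y * Complex.I := by
      ext y; apply Complex.ext <;> simp [ι]
    rw [this]; fun_prop
  have hι' : IsClosedEmbedding ι := by
    have : Isometry ι := by
      intro x y
      simp [ι, edist_dist, Complex.dist_of_re_eq]
    exact this.isClosedEmbedding
  have hT : IsCompact {y | ι y ∈ Y} := hι'.isCompact_preimage hY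
  obtain ⟨D, hD, hD'⟩ := StepF.exists hT (d := fun y => h1 (ι y) - h2 (ι y))
    ((h1c.comp hι.continuousOn (fun y hy => ⟨hy, by simp [ι]⟩)).sub
      (h2c.comp hι.continuousOn (fun y hy => ⟨hy, by simp [ι]⟩)))
    (by
      intro y hy
      have : Complex.exp (h1 (ι y)) = Complex.exp (h2 (ι y)) := by
        rw [h1e _ ⟨hy, by simp [ι]⟩, h2e _ ⟨hy, by simp [ι]⟩]
      obtain ⟨n, hn⟩ := Complex.exp_eq_exp_iff_exists_int.1 this
      exact ⟨n, by rw [hn]; ring⟩)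
  obtain ⟨r, hr, a, b, ha, hb, ha', hb', hab⟩ := hD.rf
  refine ⟨_, (c1.times c2).times hr, fun z => if z.re ≤ m then h1 z - a z else h2 z - b z, ?_, ?_⟩
  · have hcl1 : IsClosed {z : ℂ | z.re ≤ m} := isClosed_le Complex.continuous_re continuous_const
    have hcl2 : IsClosed {z : ℂ | m ≤ z.re} := isClosed_le continuous_const Complex.continuous_re
    have key : ContinuousOn (fun z => if z.re ≤ m then h1 z - a z else h2 z - b z)
        ((Y ∩ {z | z.re ≤ m}) ∪ (Y ∩ {z | m ≤ z.re})) := by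
      refine ContinuousOn.union_of_isClosed ?_ ?_ (hY.isClosed.inter hcl1) (hY.isClosed.inter hcl2)
      · refine (h1c.sub ha).congr fun z hz => ?_
        simp [show z.re ≤ m from hz.2]
      · refine (h2c.sub hb).congr fun z hz => ?_
        by_cases hzm : z.re ≤ m
        · have hz' : z.re = m := le_antisymm hzm hz.2
          have e3 := hab z hz.1 hz'
          have hze : ι z.im = z := by apply Complex.ext <;> simp [ι, hz']
          have e4 := hD' z.im (by simp only [Set.mem_ofPred_eq]; rw [hze]; exact hz.1)
          simp only [hze] at e4
          simp only [hzm, if_true, Pi.sub_apply]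
          linear_combination e4 - e3
        · simp [hzm]
    convert key using 1
    rw [← Set.inter_union_distrib_left]
    ext z
    simp [le_total]
  · intro z hz
    have n1 := c1.ne z hz
    have n2 := c2.ne z hz
    have n3 := hr.ne z hz
    simp only
    split_ifs with h
    · rw [Complex.exp_sub, h1e z ⟨hz, h⟩, ha' z ⟨hz, h⟩]
      field_simp
    · have h : m ≤ z.re := (not_le.1 h).le
      rw [Complex.exp_sub, h2e z ⟨hz, h⟩, hb' z ⟨hz, h⟩]
      field_simp

theorem GoodE.rot {v : ℂ → ℂ} {Y : Set ℂ} {c : ℂ} (hc : c ≠ 0)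
    (h : GoodE (fun w => v (c⁻¹ * w)) ((fun w => c⁻¹ * w) ⁻¹' Y)) : GoodE v Y := by
  obtain ⟨r, hr, h1⟩ := h
  have key : ∃ r', RF Y r' ∧ ∃ d, d ≠ 0 ∧ ∀ z, r (c * z) = d * r' z := by
    clear h1
    induction hr with
    | one => exact ⟨_, RF.one, 1, one_ne_zero, by simp⟩
    | mul r p k hp _ ih =>
      obtain ⟨r', h1, d, h2, h3⟩ := ih
      refine ⟨_, RF.mul r' (c⁻¹ * p) k hp h1, d * c ^ k, mul_ne_zero h2 (zpow_ne_zero _ hc), ?_⟩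
      intro z
      have : c * z - p = c * (z - c⁻¹ * p) := by field_simp
      simp only
      rw [h3, this, mul_zpow]
      ring
  obtain ⟨r', h2, d, hd, h3⟩ := key
  refine ⟨r', h2, ?_⟩
  obtain ⟨l, hl, hl'⟩ := h1
  have : HasLog (fun z => v z / (d * r' z)) Y := by
    refine ⟨fun z => l (c * z), hl.comp (by fun_prop) ?_, ?_⟩
    · intro z hz
      simpa [hc] using hz
    · intro z hz
      rw [hl' (c * z) (by simpa [hc] using hz)]
      simp only
      rw [h3]
      simp [hc]
  refine (this.mul (HasLog.const hd)).congr fun z hz => ?_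
  have := h2.ne z hz
  field_simp

theorem GoodE.glue_im {v : ℂ → ℂ} {Y : Set ℂ} (hY : IsCompact Y) (m : ℝ)
    (hL : GoodE v (Y ∩ {z | z.im ≤ m})) (hR : GoodE v (Y ∩ {z | m ≤ z.im})) : GoodE v Y := by
  have hI : (-Complex.I) ≠ 0 := by simp
  apply GoodE.rot hI
  have aux : ∀ Z : Set ℂ, GoodE v Z → GoodE (fun w => v ((-Complex.I)⁻¹ * w))
      ((fun w => (-Complex.I)⁻¹ * w) ⁻¹' Z) := by
    intro Z hZ
    apply GoodE.rot (inv_ne_zero hI)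
    convert hZ using 1
    · ext w; congr 1; field_simp
    · ext w; simp only [Set.mem_preimage]; rw [inv_inv]
      congr! 1
      field_simp
  apply GoodE.glue (m := m)
  · have := (Homeomorph.mulLeft₀ _ (inv_ne_zero hI)).isClosedEmbedding.isCompact_preimage hY
    exact this
  · refine (aux _ hL).mono ?_
    rintro w ⟨h1, h2⟩
    refine ⟨h1, ?_⟩
    simpa using h2
  · refine (aux _ hR).mono ?_
    rintro w ⟨h1, h2⟩
    refine ⟨h1, ?_⟩
    simpa using h2

theorem GoodE.of_log {v : ℂ → ℂ} {Y : Set ℂ} (h : HasLog v Y) : GoodE v Y :=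
  ⟨_, RF.one, by simpa using h⟩

theorem eilenberg {v : ℂ → ℂ} {Y : Set ℂ} (hY : IsCompact Y) (hv : ContinuousOn v Y)
    (h0 : ∀ z ∈ Y, v z ≠ 0) : GoodE v Y := by
  obtain ⟨B, hB⟩ := hY.isBounded.exists_norm_le
  have hre : ∀ z ∈ Y, |z.re| ≤ B := fun z hz => (Complex.abs_re_le_norm z).trans (hB z hz)
  have him : ∀ z ∈ Y, |z.im| ≤ B := fun z hz => (Complex.abs_im_le_norm z).trans (hB z hz)
  have emp : ∀ Z : Set ℂ, Z ⊆ ∅ → GoodE v Z := fun Z hZ =>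
    GoodE.of_log ⟨0, continuousOn_const, fun z hz => (hZ hz).elim⟩
  have cl1 : ∀ m, IsClosed {z : ℂ | z.re ≤ m} :=
    fun m => isClosed_le Complex.continuous_re continuous_const
  have cl2 : ∀ m, IsClosed {z : ℂ | m ≤ z.re} :=
    fun m => isClosed_le continuous_const Complex.continuous_re
  have cl3 : ∀ m, IsClosed {z : ℂ | z.im ≤ m} :=
    fun m => isClosed_le Complex.continuous_im continuous_const
  -- local
  have loc : ∀ x y : ℝ, ∃ ε > 0, GoodE v (Y ∩ {z | |z.re - x| ≤ ε ∧ |z.im - y| ≤ ε}) := by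
    intro x y
    have hnear : ∀ (z : ℂ) (ε : ℝ), |z.re - x| ≤ ε ∧ |z.im - y| ≤ ε →
        dist z (⟨x, y⟩ : ℂ) ≤ 2 * ε := by
      rintro z ε ⟨h1, h2⟩
      rw [dist_eq_norm]
      have := Complex.norm_le_abs_re_add_abs_im (z - ⟨x, y⟩)
      simp at this
      linarith
    by_cases hxy : (⟨x, y⟩ : ℂ) ∈ Y
    · obtain ⟨δ, hδ, h⟩ := Metric.continuousOn_iff.1 hv _ hxy ‖v ⟨x, y⟩‖
        (norm_pos_iff.2 (h0 _ hxy))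
      refine ⟨δ / 3, by positivity, GoodE.of_log ?_⟩
      have hs : ∀ z ∈ Y ∩ {z : ℂ | |z.re - x| ≤ δ / 3 ∧ |z.im - y| ≤ δ / 3},
          v z / v ⟨x, y⟩ ∈ Complex.slitPlane := by
        rintro z ⟨h1, h2⟩
        apply mem_slit_of_near
        have h3 := h z h1 (by have := hnear z _ h2; linarith)
        rw [dist_eq_norm] at h3
        have h4 := h0 _ hxy
        have h5 : v z / v ⟨x, y⟩ - 1 = (v z - v ⟨x, y⟩) / v ⟨x, y⟩ := by field_simp
        rw [h5, norm_div, div_lt_one (norm_pos_iff.2 h4)]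
        exact h3
      have : HasLog (fun z => v z / v ⟨x, y⟩)
          (Y ∩ {z : ℂ | |z.re - x| ≤ δ / 3 ∧ |z.im - y| ≤ δ / 3}) :=
        ⟨fun z => Complex.log (v z / v ⟨x, y⟩),
          ((hv.mono Set.inter_subset_left).div_const _).clog hs,
          fun z hz => Complex.exp_log (Complex.slitPlane_ne_zero (hs z hz))⟩
      refine (this.mul (HasLog.const (h0 _ hxy))).congr fun z hz => ?_
      have := h0 _ hxy
      field_simp
    · obtain ⟨δ, hδ, h⟩ := Metric.isOpen_iff.1 hY.isClosed.isOpen_compl _ hxy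
      refine ⟨δ / 3, by positivity, emp _ ?_⟩
      rintro z ⟨h1, h2⟩
      have := hnear z _ h2
      exact h (a := z) (by rw [mem_ball]; linarith) h1
  -- strips
  have strip : ∀ x : ℝ, ∃ ε > 0, GoodE v (Y ∩ {z | |z.re - x| ≤ ε}) := by
    intro x
    have key : ∀ t ≥ -B - 1, ∃ ε > 0, GoodE v (Y ∩ {z | |z.re - x| ≤ ε ∧ z.im ≤ t}) := by
      apply interval_ind
      · refine ⟨1, one_pos, emp _ ?_⟩
        rintro z ⟨h1, h2, h3⟩
        have := (abs_le.1 (him z h1)).1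
        linarith
      · intro y _
        obtain ⟨ε, hε, hg⟩ := loc x y
        refine ⟨ε, hε, ?_⟩
        intro s h1 h2 _ ⟨ε', hε', hg'⟩ t h3 h4
        refine ⟨min ε ε', by positivity, ?_⟩
        have hcl : IsClosed {z : ℂ | |z.re - x| ≤ min ε ε' ∧ z.im ≤ t} :=
          (isClosed_le (f := fun z : ℂ => |z.re - x|) (by fun_prop) continuous_const).inter
            (cl3 t)
        apply GoodE.glue_im (hY.inter_right hcl) s
        · refine hg'.mono ?_
          rintro z ⟨⟨h5, h6, h7⟩, h8⟩
          exact ⟨h5, h6.trans (min_le_right _ _), h8⟩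
        · refine hg.mono ?_
          rintro z ⟨⟨h5, h6, h7⟩, h8⟩
          have h8 : s ≤ z.im := h8
          exact ⟨h5, h6.trans (min_le_left _ _), abs_le.2 ⟨by linarith, by linarith⟩⟩
    obtain ⟨ε, hε, h⟩ := key (max B (-B - 1)) (le_max_right _ _)
    refine ⟨ε, hε, h.mono ?_⟩
    rintro z ⟨h1, h2⟩
    exact ⟨h1, h2, (abs_le.1 (him z h1)).2.trans (le_max_left _ _)⟩
  have key : ∀ t ≥ -B - 1, GoodE v (Y ∩ {z | z.re ≤ t}) := by
    apply interval_ind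
    · refine emp _ ?_
      rintro z ⟨h1, h2⟩
      have h2 : z.re ≤ _ := h2
      have := (abs_le.1 (hre z h1)).1
      linarith
    · intro x _
      obtain ⟨ε, hε, hg⟩ := strip x
      refine ⟨ε, hε, ?_⟩
      intro s h1 h2 _ hg' t h3 h4
      apply GoodE.glue (hY.inter_right (cl1 t)) s
      · refine hg'.mono ?_
        rintro z ⟨⟨h5, h7⟩, h8⟩
        exact ⟨h5, h8⟩
      · refine hg.mono ?_
        rintro z ⟨⟨h5, h7⟩, h8⟩
        have h8 : s ≤ z.re := h8
        have h7 : z.re ≤ t := h7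
        have h9 : |z.re - x| ≤ ε := abs_le.2 ⟨by linarith, by linarith⟩
        exact ⟨h5, h9⟩
  refine (key (max B (-B - 1)) (le_max_right _ _)).mono ?_
  intro z hz
  exact ⟨hz, (abs_le.1 (hre z hz)).2.trans (le_max_left _ _)⟩

theorem winding_idx {v : ℂ → ℂ} (hv : Continuous v) {γ : ℝ → ℂ} {a b : ℝ} (hab : a ≤ b)
    (hγ : ContinuousOn γ (Set.Icc a b)) (hl : γ a = γ b) (h0 : ∀ t ∈ Set.Icc a b, v (γ t) ≠ 0)
    (hz : ∀ u, v u = 0 → wn γ a b u = 0) : dlog (fun t => v (γ t)) a b = 0 := by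
  let Y : Set ℂ := γ '' Set.Icc a b ∪ {u | wn γ a b u ≠ 0}
  have hK : IsCompact (γ '' Set.Icc a b) := isCompact_Icc.image_of_continuousOn hγ
  have hYc : IsCompact Y := by
    apply Metric.isCompact_of_isClosed_isBounded
    · rw [← isOpen_compl_iff, isOpen_iff_mem_nhds]
      intro u hu
      have hu1 : ∀ t ∈ Set.Icc a b, γ t ≠ u := fun t ht h => hu (Or.inl ⟨t, ht, h⟩)
      have hu2 : wn γ a b u = 0 := by
        by_contra h; exact hu (Or.inr h)
      have hu3 : u ∈ (γ '' Set.Icc a b)ᶜ := fun h => hu (Or.inl h)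
      filter_upwards [wn_locconst hab hγ hl hu1, hK.isClosed.isOpen_compl.mem_nhds hu3] with w h1 h2
      rintro (h3 | h3)
      · exact h2 h3
      · exact h3 (h1.trans hu2)
    · refine hK.isBounded.union ?_
      obtain ⟨R, hR, h⟩ := wn_far hab hγ hl
      refine isBounded_iff_forall_norm_le.2 ⟨R, fun u hu => ?_⟩
      by_contra hc
      exact hu (h u (not_le.1 hc))
  obtain ⟨r, hr, l, hl1, hl2⟩ := eilenberg hYc hv.continuousOn (by
    rintro u (⟨t, ht, rfl⟩ | h) h1
    · exact h0 t ht h1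
    · exact h (hz u h1))
  have hmem : ∀ t ∈ Set.Icc a b, γ t ∈ Y := fun t ht => Or.inl ⟨t, ht, rfl⟩
  have key : ContinuousOn (fun t => r (γ t)) (Set.Icc a b) ∧ dlog (fun t => r (γ t)) a b = 0 := by
    clear hl1 hl2
    induction hr with
    | one => exact ⟨continuousOn_const, dlog_const hab one_ne_zero⟩
    | mul r p k hp hr ih =>
      have hne : ∀ t ∈ Set.Icc a b, γ t - p ≠ 0 := fun t ht h => hp (by
        rw [sub_eq_zero] at h; exact h ▸ hmem t ht)
      have hw : wn γ a b p = 0 := by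
        by_contra h; exact hp (Or.inr h)
      obtain ⟨m, hm, hm'⟩ := hasLog_Icc (f := fun t => γ t - p) (hγ.sub continuousOn_const) hne
      have hc : ContinuousOn (fun t => (γ t - p) ^ k) (Set.Icc a b) :=
        (hγ.sub continuousOn_const).zpow₀ k fun t ht => Or.inl (hne t ht)
      refine ⟨ih.1.mul hc, ?_⟩
      have := dlog_mul hab ih.1 (fun t ht => hr.ne _ (hmem t ht)) hc
        (fun t ht => zpow_ne_zero _ (hne t ht))
      rw [this, ih.2, dlog_eq hab (l := fun t => k * m t) (continuousOn_const.mul hm)]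
      · rw [wn, dlog_eq hab hm hm'] at hw
        rw [zero_add, ← mul_sub, hw, mul_zero]
      · intro t ht
        rw [Complex.exp_int_mul, hm' t ht]
  have h1 : ContinuousOn (fun t => l (γ t)) (Set.Icc a b) := hl1.comp hγ hmem
  have h2 := dlog_mul hab (f := fun t => Complex.exp (l (γ t))) (h1.cexp)
    (fun t _ => Complex.exp_ne_zero _) key.1 (fun t ht => hr.ne _ (hmem t ht))
  rw [key.2, dlog_eq hab h1 (fun _ _ => rfl)] at h2
  rw [hl] at h2
  rw [sub_self, add_zero] at h2
  rw [← h2]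
  apply dlog_congr hab
  intro t ht
  have := hr.ne _ (hmem t ht)
  rw [hl2 _ (hmem t ht)]
  field_simp


/-- configuration space parametrization -/
noncomputable def cfg (p : ℂ × ℂ) : ℂ × ℂ := (p.1, p.1 + Complex.exp p.2)

theorem cfg_cont : Continuous cfg := by unfold cfg; fun_prop

theorem cfg_ne (p : ℂ × ℂ) : (cfg p).1 ≠ (cfg p).2 := by simp [cfg, Complex.exp_ne_zero]

theorem cfg_surj {x y : ℂ} (h : x ≠ y) : ∃ p, cfg p = (x, y) :=
  ⟨(x, Complex.log (y - x)), by
    simp [cfg, Complex.exp_log (sub_ne_zero.2 h.symm)]⟩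

structure IsAngle (g : ℂ → ℂ) (W : ℂ × ℂ → ℂ) : Prop where
  cont : ContinuousOn W {p | p.1 ≠ p.2}
  exp_eq : ∀ x y, x ≠ y → Complex.exp (W (x, y)) = (g y - g x) / (y - x)

theorem IsAngle.symm {g : ℂ → ℂ} {W : ℂ × ℂ → ℂ} (h : IsAngle g W) {x y : ℂ} (hxy : x ≠ y) :
    W (x, y) = W (y, x) := by
  have hc : Continuous fun p => W (cfg p) := h.cont.comp_continuous cfg_cont cfg_ne
  have hc' : Continuous fun p => W (cfg p).swap :=
    h.cont.comp_continuous (continuous_swap.comp cfg_cont) fun p => (cfg_ne p).symm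
  have he : ∀ x y, x ≠ y → Complex.exp (W (x, y)) = Complex.exp (W (y, x)) := by
    intro x y hxy
    rw [h.exp_eq x y hxy, h.exp_eq y x hxy.symm, ← neg_sub (g y), ← neg_sub y x, neg_div_neg_eq]
  obtain ⟨p, hp⟩ := cfg_surj hxy
  obtain ⟨q, hq⟩ := cfg_surj hxy.symm
  have := log_unique (S := Set.univ) isPreconnected_univ hc.continuousOn hc'.continuousOn
    (fun x _ => he _ _ (cfg_ne x)) (x := p) (y := q) trivial trivial
  simp only [hp, hq, Prod.swap_prod_mk] at this
  have h2 : 2 * (W (x, y) - W (y, x)) = 0 := by linear_combination this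
  simpa [sub_eq_zero] using h2

def IsE (k : ℂ → ℂ) (E : ℂ × ℂ → ℂ) : Prop :=
  Continuous E ∧ ∀ p, Complex.exp (E p) = k (p.1 + Complex.exp p.2) - k p.1

theorem exists_E (k : ℂ ≃ₜ ℂ) : ∃ E, IsE k E ∧ ∃ D : ℤ, ∀ x ζ, E (x, ζ + τi) = E (x, ζ) + D * τi := by
  obtain ⟨E, h1, h2⟩ := log_univ (f := fun p : ℂ × ℂ => k (p.1 + Complex.exp p.2) - k p.1)
    (by fun_prop) (by
      intro p
      rw [sub_ne_zero]
      intro h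
      have := k.injective h
      simp [Complex.exp_ne_zero] at this)
  refine ⟨E, ⟨h1, h2⟩, ?_⟩
  have he : ∀ x ζ, Complex.exp (E (x, ζ + τi)) = Complex.exp (E (x, ζ)) := by
    intro x ζ
    rw [h2, h2, Complex.exp_add, Complex.exp_two_pi_mul_I, mul_one]
  obtain ⟨D, hD⟩ := Complex.exp_eq_exp_iff_exists_int.1 (he 0 0)
  refine ⟨D, fun x ζ => ?_⟩
  have := log_unique (S := Set.univ) isPreconnected_univ
    (l := fun p : ℂ × ℂ => E (p.1, p.2 + τi)) (m := E) (by fun_prop) h1.continuousOn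
    (fun p _ => he p.1 p.2) (x := (x, ζ)) (y := (0, 0)) trivial trivial
  simp only at this
  rw [hD] at this
  linear_combination this

theorem E_int {E : ℂ × ℂ → ℂ} {D : ℤ} (h : ∀ x ζ, E (x, ζ + τi) = E (x, ζ) + D * τi) (n : ℤ) (x ζ : ℂ) :
    E (x, ζ + n * τi) = E (x, ζ) + n * (D * τi) := by
  have hp : Function.Periodic (fun ζ => E (x, ζ) - D * ζ) τi := by
    intro ζ
    simp only
    rw [h]; ring
  have := (hp.int_mul n) ζ
  linear_combination this

theorem exists_angle (k : ℂ ≃ₜ ℂ) : ∃ W, IsAngle (fun z => k (k z)) W := by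
  obtain ⟨E1, ⟨c1, e1⟩, D1, d1⟩ := exists_E k
  obtain ⟨E2, ⟨c2, e2⟩, D2, d2⟩ := exists_E k.symm
  -- degree is ±1
  have hD : D1 * D2 = 1 := by
    have he : ∀ x ζ, Complex.exp (E1 (k.symm x, E2 (x, ζ))) = Complex.exp ζ := by
      intro x ζ
      rw [e1, e2]
      simp
    have := log_unique (S := Set.univ) isPreconnected_univ
      (l := fun ζ : ℂ => E1 (k.symm 0, E2 (0, ζ))) (m := fun ζ => ζ) (by fun_prop) (by fun_prop)
      (fun p _ => he 0 p) (x := 0) (y := 0 + τi) trivial trivial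
    rw [d2, E_int d1] at this
    have h2 : ((D1 * D2 : ℤ) : ℂ) * τi = (1 : ℤ) * τi := by push_cast; linear_combination -this
    have h3 : τi ≠ 0 := Complex.two_pi_I_ne_zero
    exact_mod_cast mul_right_cancel₀ h3 h2
  have hD1 : D1 * D1 = 1 := by
    rcases Int.eq_one_or_neg_one_of_mul_eq_one hD with h | h <;> simp [h]
  let E : ℂ × ℂ → ℂ := fun p => E1 (k p.1, E1 p)
  have hEc : Continuous E := by fun_prop
  have hE : ∀ x ζ, Complex.exp (E (x, ζ)) = k (k (x + Complex.exp ζ)) - k (k x) := by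
    intro x ζ
    simp only [E]
    rw [e1, e1]
    simp
  have hEp : ∀ x ζ, E (x, ζ + τi) = E (x, ζ) + (1:ℤ) * τi := by
    intro x ζ
    simp only [E]
    rw [d1, E_int d1, ← hD1]
    push_cast
    ring
  have hF : ∀ x ζ ζ', Complex.exp ζ = Complex.exp ζ' → E (x, ζ) - ζ = E (x, ζ') - ζ' := by
    intro x ζ ζ' h
    obtain ⟨n, rfl⟩ := Complex.exp_eq_exp_iff_exists_int.1 h
    rw [E_int hEp]
    push_cast
    ring
  refine ⟨fun p => E (p.1, Complex.log (p.2 - p.1)) - Complex.log (p.2 - p.1), ?_, ?_⟩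
  · rintro ⟨x, y⟩ hxy
    refine ContinuousAt.continuousWithinAt ?_
    have hw : y - x ≠ 0 := sub_ne_zero.2 (Ne.symm hxy)
    have hcl : ContinuousAt (fun p : ℂ × ℂ => Complex.log ((p.2 - p.1) / (y - x))
        + Complex.log (y - x)) (x, y) := by
      refine ContinuousAt.add (ContinuousAt.clog (by fun_prop) ?_) continuousAt_const
      simp [div_self hw]
    have h1 : ContinuousAt (fun p : ℂ × ℂ => E (p.1, Complex.log ((p.2 - p.1) / (y - x))
        + Complex.log (y - x)) - (Complex.log ((p.2 - p.1) / (y - x))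
        + Complex.log (y - x))) (x, y) :=
      (hEc.continuousAt.comp (continuousAt_fst.prodMk hcl)).sub hcl
    refine h1.congr ?_
    have ho : IsOpen {p : ℂ × ℂ | p.1 ≠ p.2} := isOpen_ne_fun continuous_fst continuous_snd
    filter_upwards [ho.mem_nhds hxy] with p hp
    apply hF
    have hp' : p.2 - p.1 ≠ 0 := sub_ne_zero.2 (Ne.symm hp)
    rw [Complex.exp_add, Complex.exp_log hw, Complex.exp_log (div_ne_zero hp' hw),
      Complex.exp_log hp']
    field_simp
  · intro x y hxy
    have hw : y - x ≠ 0 := sub_ne_zero.2 (Ne.symm hxy)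
    simp only
    rw [Complex.exp_sub, hE, Complex.exp_log hw]
    simp

/-- recurrence on compact sets along the sequence `n`. -/
def RecC (g : ℂ → ℂ) (n : ℕ → ℕ) : Prop :=
  Tendsto n atTop atTop ∧ ∀ K : Set ℂ, IsCompact K → ∀ ε > 0, ∀ᶠ j in atTop, ∀ x ∈ K,
    ‖g^[n j] x - x‖ < ε

/-- Birkhoff sums of the angle. -/
noncomputable def aSum (g : ℂ → ℂ) (W : ℂ × ℂ → ℂ) (n : ℕ) (x y : ℂ) : ℂ :=
  ∑ i ∈ Finset.range n, W (g^[i] x, g^[i] y)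

theorem aSum_exp {g : ℂ → ℂ} {W : ℂ × ℂ → ℂ} (h : IsAngle g W) (hg : Function.Injective g)
    (n : ℕ) {x y : ℂ} (hxy : x ≠ y) :
    Complex.exp (aSum g W n x y) = (g^[n] y - g^[n] x) / (y - x) := by
  have hw : y - x ≠ 0 := sub_ne_zero.2 (Ne.symm hxy)
  induction n with
  | zero => simp [aSum, div_self hw]
  | succ n ih =>
    have hn : g^[n] x ≠ g^[n] y := fun h => hxy (hg.iterate n h)
    have hn' : g^[n] y - g^[n] x ≠ 0 := sub_ne_zero.2 (Ne.symm hn)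
    rw [aSum, Finset.sum_range_succ, Complex.exp_add, ← aSum, ih, h.exp_eq _ _ hn,
      Function.iterate_succ_apply', Function.iterate_succ_apply']
    field_simp

theorem aSum_rec {g : ℂ → ℂ} {W : ℂ × ℂ → ℂ} (h : IsAngle g W) (hg : Function.Injective g)
    (hgc : Continuous g) {n : ℕ → ℕ} (hr : RecC g n) {x y x' y' : ℂ} (hxy : x ≠ y)
    (hxy' : x' ≠ y') :
    Tendsto (fun j => aSum g W (n j) x y - aSum g W (n j) x' y') atTop (𝓝 0) := by
  obtain ⟨p, hp⟩ := cfg_surj hxy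
  obtain ⟨q, hq⟩ := cfg_surj hxy'
  let P : ℝ → ℂ × ℂ := fun t => cfg (p + t • (q - p))
  have hP : Continuous P := cfg_cont.comp (by fun_prop)
  have hPn : ∀ t, (P t).1 ≠ (P t).2 := fun t => cfg_ne _
  have P0 : P 0 = (x, y) := by simp [P, hp]
  have P1 : P 1 = (x', y') := by simp [P, hq]
  have hS : ∀ m, Continuous fun t => aSum g W m (P t).1 (P t).2 := by
    intro m
    refine continuous_finsetSum _ fun i _ => ?_
    have hi : Continuous (g^[i]) := hgc.iterate i
    refine h.cont.comp_continuous (by fun_prop) fun t ht => hPn t (hg.iterate i ht)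
  -- lower bound
  obtain ⟨t0, -, ht0⟩ := (isCompact_Icc (a := (0:ℝ)) (b := 1)).exists_isMinOn ⟨0, by simp⟩
    (f := fun t => ‖(P t).2 - (P t).1‖) (by fun_prop)
  have hμ : 0 < ‖(P t0).2 - (P t0).1‖ := norm_pos_iff.2 (sub_ne_zero.2 (hPn t0).symm)
  set μ := ‖(P t0).2 - (P t0).1‖ with hμd
  rw [Metric.tendsto_nhds]
  intro ε hε
  let δ := min (ε / 4) (1 / 2)
  have hδ : 0 < δ := by positivity
  let K : Set ℂ := (fun t => (P t).1) '' Set.Icc (0:ℝ) 1 ∪ (fun t => (P t).2) '' Set.Icc (0:ℝ) 1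
  have hK : IsCompact K :=
    (isCompact_Icc.image (by fun_prop)).union (isCompact_Icc.image (by fun_prop))
  filter_upwards [hr.2 K hK (δ * μ / 2) (by positivity)] with j hj
  have hnear : ∀ t ∈ Set.Icc (0:ℝ) 1, ‖Complex.exp (aSum g W (n j) (P t).1 (P t).2) - 1‖ < δ := by
    intro t ht
    rw [aSum_exp h hg _ (hPn t)]
    have hw : (P t).2 - (P t).1 ≠ 0 := sub_ne_zero.2 (hPn t).symm
    have hm : μ ≤ ‖(P t).2 - (P t).1‖ := ht0 ht
    have e1 := hj _ (Or.inl ⟨t, ht, rfl⟩)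
    have e2 := hj _ (Or.inr ⟨t, ht, rfl⟩)
    have e3 : (g^[n j] (P t).2 - g^[n j] (P t).1) / ((P t).2 - (P t).1) - 1 =
      ((g^[n j] (P t).2 - (P t).2) - (g^[n j] (P t).1 - (P t).1)) / ((P t).2 - (P t).1) := by
      field_simp; ring
    rw [e3, norm_div, div_lt_iff₀ (norm_pos_iff.2 hw)]
    have e4 := norm_sub_le (g^[n j] (P t).2 - (P t).2) (g^[n j] (P t).1 - (P t).1)
    simp only at e1 e2
    nlinarith
  have hδ1 : δ ≤ 1 / 2 := min_le_right _ _
  have hδ2 : δ ≤ ε / 4 := min_le_left _ _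
  have hu := log_unique (S := Set.Icc (0:ℝ) 1) isPreconnected_Icc (hS (n j)).continuousOn
    (m := fun t => Complex.log (Complex.exp (aSum g W (n j) (P t).1 (P t).2)))
    (((hS (n j)).continuousOn.cexp).clog fun t ht => mem_slit_of_near (by
      have := hnear t ht; linarith))
    (fun t _ => (Complex.exp_log (Complex.exp_ne_zero _)).symm) (x := 0) (y := 1) (by simp) (by simp)
  have hlog : ∀ t ∈ Set.Icc (0:ℝ) 1,
      ‖Complex.log (Complex.exp (aSum g W (n j) (P t).1 (P t).2))‖ < ε / 2 := by
    intro t ht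
    have h1 := hnear t ht
    have h2 := Complex.norm_log_one_add_half_le_self
      (z := Complex.exp (aSum g W (n j) (P t).1 (P t).2) - 1) (by linarith)
    rw [add_sub_cancel] at h2
    linarith
  have a0 := hlog 0 (by simp)
  have a1 := hlog 1 (by simp)
  simp only [P0, P1] at hu a0 a1
  have : aSum g W (n j) x y - aSum g W (n j) x' y' =
    Complex.log (Complex.exp (aSum g W (n j) x y)) -
      Complex.log (Complex.exp (aSum g W (n j) x' y')) := by linear_combination hu
  rw [dist_zero_right, this]
  exact (norm_sub_le _ _).trans_lt (by linarith)


/-- jump indicator -/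
noncomputable def jmp (w : ℂ) : ℤ := if w.im < 0 then 1 else 0

theorem log_jmp_cont {w : ℂ} (hw : w ∉ Complex.slitPlane) (h0 : w ≠ 0) :
    ContinuousAt (fun z => Complex.log z + jmp z * τi) w := by
  have hre : w.re < 0 := by
    rw [Complex.mem_slitPlane_iff] at hw
    push Not at hw
    refine lt_of_le_of_ne hw.1 fun h => h0 (Complex.ext h hw.2)
  have h1 : ContinuousAt (fun z : ℂ => ((Real.log ‖z‖ : ℝ) : ℂ) +
      ((Real.arcsin ((-z).im / ‖z‖) + Real.pi : ℝ) : ℂ) * Complex.I) w := by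
    have hn : ‖w‖ ≠ 0 := norm_ne_zero_iff.2 h0
    have a1 : ContinuousAt (fun z : ℂ => Real.log ‖z‖) w := continuousAt_id.norm.log hn
    have a2 : ContinuousAt (fun z : ℂ => Real.arcsin ((-z).im / ‖z‖) + Real.pi) w := by
      refine ContinuousAt.add (Real.continuous_arcsin.continuousAt.comp
        (ContinuousAt.div ?_ continuousAt_id.norm hn)) continuousAt_const
      exact (Complex.continuous_im.comp continuous_neg).continuousAt
    exact (Complex.continuous_ofReal.continuousAt.comp a1).add
      ((Complex.continuous_ofReal.continuousAt.comp a2).mul continuousAt_const)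
  refine h1.congr ?_
  have : ∀ᶠ z : ℂ in 𝓝 w, z.re < 0 :=
    Complex.continuous_re.continuousAt.eventually (gt_mem_nhds hre)
  filter_upwards [this] with z hz
  unfold jmp Complex.log
  split_ifs with h
  · rw [Complex.arg_of_re_neg_of_im_neg hz h]; push_cast; ring
  · rw [Complex.arg_of_re_neg_of_im_nonneg hz (not_lt.1 h)]; push_cast; ring

theorem int_evt {X : Type*} [TopologicalSpace X] {ψ : X → ℤ} {z : X}
    (h : ContinuousAt (fun w => (ψ w : ℂ) * τi) z) : ∀ᶠ w in 𝓝 z, ψ w = ψ z := by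
  have := Metric.tendsto_nhds.1 h 1 one_pos
  filter_upwards [this] with w hw
  rw [dist_eq_norm] at hw
  have := (int_small (n := ψ w - ψ z) (z := (ψ w : ℂ) * τi - ψ z * τi) (by push_cast; ring)
    (by linarith)).1
  linarith

theorem crosscut {g : ℂ ≃ₜ ℂ} {Θ lam : Set ℂ} {m ω : ℂ → ℂ} {n : ℕ → ℕ}
    (hr : RecC g n) (hΘ : IsOpen Θ) (hgΘ' : ∀ z, g z ∈ Θ ↔ z ∈ Θ)
    (hm : ContinuousOn m Θ) (h0 : ∀ z ∈ Θ, m z ≠ 0)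
    (hls : lam ⊆ Θ) (hl : ∀ z ∈ Θ, z ∈ lam ↔ m z ∉ Complex.slitPlane)
    (hlc : IsPreconnected lam) {z0 : ℂ} (hz0 : z0 ∈ lam)
    (hpos : ∃ᶠ z in 𝓝 z0, 0 < (m z).im) (hneg : ∃ᶠ z in 𝓝 z0, (m z).im < 0)
    (hfree : ∀ z ∈ lam, g z ∉ lam)
    (hω : ContinuousOn ω Θ) (hωe : ∀ z ∈ Θ, Complex.exp (ω z) = m (g z) / m z)
    (hωs : ∀ z ∈ Θ, Tendsto (fun j => ∑ i ∈ Finset.range (n j), ω (g^[i] z)) atTop (𝓝 0))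
    (hN : ¬ HasLog m Θ) : False := by
  have hgΘ : ∀ z, z ∈ Θ → g z ∈ Θ := fun z => (hgΘ' z).2
  have mC : ∀ z ∈ Θ, ContinuousAt m z := fun z hz => hm.continuousAt (hΘ.mem_nhds hz)
  have ωC : ∀ z ∈ Θ, ContinuousAt ω z := fun z hz => hω.continuousAt (hΘ.mem_nhds hz)
  have gC : ∀ z, ContinuousAt g z := fun z => g.continuous.continuousAt
  -- definition of φ
  have hφ : ∀ z, ∃ k : ℤ, z ∈ Θ → Complex.log (m z) + ω z - Complex.log (m (g z)) = k * τi := by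
    intro z
    by_cases hz : z ∈ Θ
    · have : Complex.exp (Complex.log (m z) + ω z - Complex.log (m (g z))) = 1 := by
        rw [Complex.exp_sub, Complex.exp_add, Complex.exp_log (h0 z hz),
          Complex.exp_log (h0 _ (hgΘ z hz)), hωe z hz]
        have := h0 z hz
        have := h0 _ (hgΘ z hz)
        field_simp
      obtain ⟨k, hk⟩ := Complex.exp_eq_one_iff.1 this
      exact ⟨k, fun _ => hk⟩
    · exact ⟨0, fun h => absurd h hz⟩
  choose φ hφ using hφ
  have Lc : ∀ z ∈ Θ, z ∉ lam → ContinuousAt (fun w => Complex.log (m w)) z := by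
    intro z hz hzl
    refine (mC z hz).clog ?_
    by_contra h
    exact hzl ((hl z hz).2 h)
  have Lj : ∀ z ∈ lam, ContinuousAt (fun w => Complex.log (m w) + jmp (m w) * τi) z := by
    intro z hz
    exact ContinuousAt.comp (f := m) (g := fun z => Complex.log z + jmp z * τi)
      (log_jmp_cont ((hl z (hls hz)).1 hz) (h0 z (hls hz))) (mC z (hls hz))
  have J0 : ∀ z ∈ lam, jmp (m z) = 0 := by
    intro z hz
    have := (hl z (hls hz)).1 hz
    rw [Complex.mem_slitPlane_iff] at this
    push Not at this
    simp [jmp, this.2]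
  have evΘ : ∀ z ∈ Θ, ∀ᶠ w in 𝓝 z, w ∈ Θ := fun z hz => hΘ.mem_nhds hz
  have fa : ∀ z ∈ Θ, z ∉ lam → g z ∉ lam → ∀ᶠ w in 𝓝 z, φ w = φ z := by
    intro z hz h1 h2
    apply int_evt
    have : ContinuousAt (fun w => Complex.log (m w) + ω w - Complex.log (m (g w))) z :=
      ((Lc z hz h1).add (ωC z hz)).sub
        (ContinuousAt.comp (f := g) (g := fun w => Complex.log (m w)) (Lc _ (hgΘ z hz) h2) (gC z))
    refine this.congr ?_
    filter_upwards [evΘ z hz] with w hw using hφ w hw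
  have fb : ∀ z ∈ lam, ∀ᶠ w in 𝓝 z, φ w + jmp (m w) = φ z := by
    intro z hz
    have hzT := hls hz
    have : ∀ᶠ w in 𝓝 z, φ w + jmp (m w) = φ z + jmp (m z) := by
      apply int_evt (ψ := fun w => φ w + jmp (m w))
      have : ContinuousAt (fun w => Complex.log (m w) + jmp (m w) * τi + ω w
          - Complex.log (m (g w))) z :=
        ((Lj z hz).add (ωC z hzT)).sub
          (ContinuousAt.comp (f := g) (g := fun w => Complex.log (m w))
            (Lc _ (hgΘ z hzT) (hfree z hz)) (gC z))
      refine this.congr ?_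
      filter_upwards [evΘ z hzT] with w hw
      have := hφ w hw
      push_cast
      linear_combination this
    rw [J0 z hz] at this
    simpa using this
  have hfree' : ∀ z, g z ∈ lam → z ∉ lam := fun z h h' => hfree z h' h
  have fc : ∀ z ∈ Θ, g z ∈ lam → ∀ᶠ w in 𝓝 z, φ w - jmp (m (g w)) = φ z := by
    intro z hz hgz
    have : ∀ᶠ w in 𝓝 z, φ w - jmp (m (g w)) = φ z - jmp (m (g z)) := by
      apply int_evt (ψ := fun w => φ w - jmp (m (g w)))
      have : ContinuousAt (fun w => Complex.log (m w) + ω w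
          - (Complex.log (m (g w)) + jmp (m (g w)) * τi)) z :=
        ((Lc z hz (hfree' z hgz)).add (ωC z hz)).sub
          (ContinuousAt.comp (f := g) (g := fun w => Complex.log (m w) + jmp (m w) * τi)
            (Lj _ hgz) (gC z))
      refine this.congr ?_
      filter_upwards [evΘ z hz] with w hw
      have := hφ w hw
      push_cast
      linear_combination this
    rw [J0 _ hgz] at this
    simpa using this
  have jv : ∀ w, jmp w = 0 ∨ jmp w = 1 := by
    intro w; unfold jmp; split_ifs <;> simp
  -- constancy
  have const : ∀ (φ : ℂ → ℤ) (S : Set ℂ), IsPreconnected S → (∀ z ∈ S, ∀ᶠ w in 𝓝[S] z, φ w = φ z) →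
      ∀ x ∈ S, ∀ y ∈ S, φ x = φ y := by
    intro φ S hS h x hx y hy
    have := int_const (h := fun z => (φ z : ℂ) * τi) hS (by
      intro z hz
      refine ContinuousWithinAt.congr_of_eventuallyEq (f := fun _ => (φ z : ℂ) * τi)
        continuousWithinAt_const ?_ rfl
      filter_upwards [h z hz] with w hw
      rw [hw]) (fun z _ => ⟨φ z, rfl⟩) hx hy
    have h2 : ((φ x : ℤ) : ℂ) = φ y := mul_right_cancel₀ Complex.two_pi_I_ne_zero this
    exact_mod_cast h2
  have constl : ∀ x ∈ lam, φ x = φ z0 := by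
    intro x hx
    refine const φ lam hlc ?_ x hx z0 hz0
    intro z hz
    filter_upwards [mem_nhdsWithin_of_mem_nhds (fb z hz), self_mem_nhdsWithin] with w hw hwl
    rw [J0 w hwl] at hw
    simpa using hw
  set v := φ z0 with hv
  let Ω := connectedComponentIn Θ z0
  have hΩo : IsOpen Ω := hΘ.connectedComponentIn
  have hΩΘ : Ω ⊆ Θ := connectedComponentIn_subset _ _
  have hΩc : IsPreconnected Ω := isPreconnected_connectedComponentIn
  have hz0Ω : z0 ∈ Ω := mem_connectedComponentIn (hls hz0)
  have hsub : ∀ S : Set ℂ, IsPreconnected S → S ⊆ Θ → (∃ z ∈ S, z ∈ Ω) → S ⊆ Ω := by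
    rintro S hS hSΘ ⟨z, hzS, hzΩ⟩
    have h1 := hS.subset_connectedComponentIn hzS hSΘ
    rwa [← connectedComponentIn_eq hzΩ] at h1
  have hlΩ : lam ⊆ Ω := hsub lam hlc hls ⟨z0, hz0, hz0Ω⟩
  have hΩcl : ∀ z ∈ Θ, z ∉ Ω → ∀ᶠ w in 𝓝 z, w ∉ Ω := by
    intro z hz hzΩ
    have : connectedComponentIn Θ z ∈ 𝓝 z :=
      (hΘ.connectedComponentIn).mem_nhds (mem_connectedComponentIn hz)
    filter_upwards [this] with w hw hwΩ
    apply hzΩ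
    exact hsub _ isPreconnected_connectedComponentIn (connectedComponentIn_subset _ _)
      ⟨w, hw, hwΩ⟩ (mem_connectedComponentIn hz)
  -- existence of z1
  have hz1 : ∃ z1 ∈ Ω, g z1 ∈ lam ∧ φ z1 = v - 1 := by
    by_contra hcon
    push Not at hcon
    apply hN
    classical
    refine ⟨fun z => Complex.log (m z) + (if z ∈ Ω ∧ φ z ≤ v - 1 then (1:ℂ) else 0) * τi, ?_, ?_⟩
    · intro z hz
      refine ContinuousAt.continuousWithinAt ?_
      have key : z ∉ lam → (∀ᶠ w in 𝓝 z, (w ∈ Ω ∧ φ w ≤ v - 1 ↔ z ∈ Ω ∧ φ z ≤ v - 1)) →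
          ContinuousAt (fun z => Complex.log (m z) +
            (if z ∈ Ω ∧ φ z ≤ v - 1 then (1:ℂ) else 0) * τi) z := by
        intro hzl h
        have : ContinuousAt (fun w => Complex.log (m w) +
            (if z ∈ Ω ∧ φ z ≤ v - 1 then (1:ℂ) else 0) * τi) z :=
          (Lc z hz hzl).add continuousAt_const
        refine this.congr ?_
        filter_upwards [h] with w hw
        simp only [hw]
      by_cases hzΩ : z ∈ Ω
      · by_cases hzl : z ∈ lam
        · refine (Lj z hzl).congr ?_
          filter_upwards [fb z hzl, hΩo.mem_nhds hzΩ] with w hw hwΩ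
          rw [constl z hzl] at hw
          rcases jv (m w) with h | h
          · have : ¬ (φ w ≤ v - 1) := by omega
            simp [h, this]
          · have : (φ w ≤ v - 1) := by omega
            simp [h, this, hwΩ]
        · by_cases hgl : g z ∈ lam
          · apply key hzl
            have hne := hcon z hzΩ hgl
            filter_upwards [fc z hz hgl, hΩo.mem_nhds hzΩ] with w hw hwΩ
            rcases jv (m (g w)) with h | h <;> simp only [hwΩ, hzΩ, true_and] <;> omega
          · apply key hzl
            filter_upwards [fa z hz hzl hgl, hΩo.mem_nhds hzΩ] with w hw hwΩ
            simp [hw, hwΩ, hzΩ]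
      · apply key (fun h => hzΩ (hlΩ h))
        filter_upwards [hΩcl z hz hzΩ] with w hw
        simp [hw, hzΩ]
    · intro z hz
      simp only
      rw [Complex.exp_add, Complex.exp_log (h0 z hz)]
      split_ifs <;> simp
  obtain ⟨z1, hz1Ω, hz1l, hz1v⟩ := hz1
  have hgΩ : ∀ z ∈ Ω, g z ∈ Ω := by
    have : g '' Ω ⊆ Ω := by
      refine hsub _ (hΩc.image g g.continuous.continuousOn) ?_ ⟨g z1, ⟨z1, hz1Ω, rfl⟩, hlΩ hz1l⟩
      rintro _ ⟨z, hz, rfl⟩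
      exact hgΘ z (hΩΘ hz)
    exact fun z hz => this ⟨z, hz, rfl⟩
  have hgl : IsPreconnected (g ⁻¹' lam) := by
    rw [← g.image_symm]
    exact hlc.image _ g.symm.continuous.continuousOn
  have constl' : ∀ x, g x ∈ lam → φ x = v - 1 := by
    intro x hx
    rw [← hz1v]
    refine const φ _ hgl ?_ x hx z1 hz1l
    intro z hz
    have hzΘ : z ∈ Θ := (hgΘ' z).1 (hls hz)
    filter_upwards [mem_nhdsWithin_of_mem_nhds (fc z hzΘ hz), self_mem_nhdsWithin] with w hw hwl
    rw [J0 _ hwl] at hw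
    simpa using hw
  have hval : ∀ z ∈ Ω, φ z = v ∨ φ z = v - 1 := by
    classical
    intro z hz
    have := const (fun z => if φ z = v ∨ φ z = v - 1 then 0 else 1) Ω hΩc (by
      intro z hz
      refine mem_nhdsWithin_of_mem_nhds ?_
      by_cases hzl : z ∈ lam
      · filter_upwards [fb z hzl] with w hw
        have := constl z hzl
        rcases jv (m w) with h | h
        · have h1 : φ w = v := by omega
          simp [h1, this]
        · have h1 : φ w = v - 1 := by omega
          simp [h1, this]
      · by_cases hgl : g z ∈ lam
        · filter_upwards [fc z (hΩΘ hz) hgl] with w hw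
          have := constl' z hgl
          rcases jv (m (g w)) with h | h
          · have h1 : φ w = v - 1 := by omega
            simp [h1, this]
          · have h1 : φ w = v := by omega
            simp [h1, this]
        · filter_upwards [fa z (hΩΘ hz) hzl hgl] with w hw
          simp [hw]) z hz z0 hz0Ω
    by_contra hcon
    simp [hcon, ← hv] at this
  -- Birkhoff sums vanish
  have hgi : ∀ i, ∀ z ∈ Ω, g^[i] z ∈ Ω := by
    intro i
    induction i with
    | zero => intro z hz; simpa using hz
    | succ i ih =>
      intro z hz
      rw [Function.iterate_succ_apply']
      exact hgΩ _ (ih z hz)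
  have hsum : ∀ z ∈ Ω, ∀ N, (∑ i ∈ Finset.range N, (φ (g^[i] z) : ℂ)) * τi =
      Complex.log (m z) + ∑ i ∈ Finset.range N, ω (g^[i] z) - Complex.log (m (g^[N] z)) := by
    intro z hz N
    induction N with
    | zero => simp
    | succ N ih =>
      rw [Finset.sum_range_succ, Finset.sum_range_succ, add_mul, ih,
        ← hφ _ (hΩΘ (hgi N z hz)), Function.iterate_succ_apply']
      ring
  have hbal : ∀ z ∈ Ω, z ∉ lam → ∃ N > 0, ∑ i ∈ Finset.range N, φ (g^[i] z) = 0 := by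
    intro z hz hzl
    have hgz : Tendsto (fun j => g^[n j] z) atTop (𝓝 z) := by
      rw [Metric.tendsto_nhds]
      intro ε hε
      filter_upwards [hr.2 {z} isCompact_singleton ε hε] with j hj
      rw [dist_eq_norm]
      exact hj z rfl
    have h1 : Tendsto (fun j => Complex.log (m z) + ∑ i ∈ Finset.range (n j), ω (g^[i] z)
        - Complex.log (m (g^[n j] z))) atTop (𝓝 (Complex.log (m z) + 0 - Complex.log (m z))) :=
      (tendsto_const_nhds.add (hωs z (hΩΘ hz))).sub ((Lc z (hΩΘ hz) hzl).tendsto.comp hgz)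
    rw [add_zero, sub_self] at h1
    obtain ⟨j, hj, hn⟩ := ((Metric.tendsto_nhds.1 h1 1 one_pos).and (hr.1.eventually_gt_atTop 0)).exists
    refine ⟨n j, hn, ?_⟩
    rw [← hsum z hz, dist_zero_right] at hj
    exact (int_small (n := ∑ i ∈ Finset.range (n j), φ (g^[i] z)) (by push_cast; rfl)
      (by linarith)).1
  have imnl : ∀ z ∈ lam, (m z).im = 0 := by
    intro z hz
    have := (hl z (hls hz)).1 hz
    rw [Complex.mem_slitPlane_iff] at this
    push Not at this
    exact this.2
  obtain ⟨zp, hzp, hzp2, hzpΩ⟩ := (hpos.and_eventually ((fb z0 hz0).and (hΩo.mem_nhds hz0Ω))).exists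
  obtain ⟨zn, hzn, hzn2, hznΩ⟩ := (hneg.and_eventually ((fb z0 hz0).and (hΩo.mem_nhds hz0Ω))).exists
  have jp : φ zp = v := by
    simp only [jmp, not_lt.2 hzp.le, if_false] at hzp2
    omega
  have jn : φ zn = v - 1 := by
    simp only [jmp, hzn, if_true] at hzn2
    omega
  obtain ⟨N, hN0, hNs⟩ := hbal zp hzpΩ fun h => by have := imnl _ h; linarith
  obtain ⟨M, hM0, hMs⟩ := hbal zn hznΩ fun h => by have := imnl _ h; linarith
  obtain ⟨N, rfl⟩ : ∃ k, N = k + 1 := ⟨N - 1, by omega⟩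
  obtain ⟨M, rfl⟩ : ∃ k, M = k + 1 := ⟨M - 1, by omega⟩
  rw [Finset.sum_range_succ'] at hNs hMs
  simp only [Function.iterate_zero, id_eq, jp, jn] at hNs hMs
  by_cases hv1 : 1 ≤ v
  · have : 0 ≤ ∑ i ∈ Finset.range N, φ (g^[i+1] zp) := Finset.sum_nonneg fun i _ => by
      have := hval _ (hgi (i+1) zp hzpΩ)
      omega
    omega
  · have : ∑ i ∈ Finset.range M, φ (g^[i+1] zn) ≤ 0 := Finset.sum_nonpos fun i _ => by
      have := hval _ (hgi (i+1) zn hznΩ)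
      omega
    omega


theorem mob_slit {p q z : ℂ} (hpq : p ≠ q) (hp : z ≠ p) (hq : z ≠ q) :
    z ∈ openSegment ℝ p q ↔ (z - p) / (z - q) ∉ Complex.slitPlane := by
  have hp' := sub_ne_zero.2 hp
  have hq' := sub_ne_zero.2 hq
  have hpq' := sub_ne_zero.2 hpq.symm
  constructor
  · rintro ⟨a, b, ha, hb, hab, rfl⟩
    have h1 : (a • p + b • q - p) / (a • p + b • q - q) = ((-(b / a) : ℝ) : ℂ) := by
      have ha' : (a : ℂ) ≠ 0 := by exact_mod_cast ha.ne'
      have hab' : (a : ℂ) = 1 - b := by rw [← Complex.ofReal_one, ← hab]; push_cast; ring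
      rw [div_eq_iff hq']
      push_cast
      simp only [Complex.real_smul]
      field_simp
      rw [hab']
      ring
    rw [h1, Complex.mem_slitPlane_iff]
    push Not
    simp only [Complex.ofReal_re, Complex.ofReal_im, and_true]
    have := div_pos hb ha
    linarith
  · intro h
    rw [Complex.mem_slitPlane_iff] at h
    push Not at h
    set s := ((z - p) / (z - q)).re with hs
    have hs' : (z - p) / (z - q) = (s : ℂ) := Complex.ext (by simp [hs]) (by simp [h.2])
    have hs0 : s ≠ 0 := by
      intro h0
      rw [h0] at hs'
      simp [hp', hq'] at hs'
    have hs1 : s < 0 := lt_of_le_of_ne h.1 hs0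
    have h1 : (1 - s) ≠ 0 := by linarith
    have h1c : (1 - (s:ℂ)) ≠ 0 := by exact_mod_cast h1
    refine ⟨1 / (1 - s), -s / (1 - s), by apply div_pos <;> linarith, by apply div_pos <;> linarith,
      by field_simp; ring, ?_⟩
    rw [div_eq_iff hq'] at hs'
    simp only [Complex.real_smul]
    push_cast
    field_simp
    linear_combination -hs'

theorem mob_im {p q : ℂ} (hpq : p ≠ q) (a t : ℝ) (ht : t ≠ 0) :
    (((p + (a + t * Complex.I) * (q - p)) - p) / ((p + (a + t * Complex.I) * (q - p)) - q)).im
      = - t / ((a - 1) ^ 2 + t ^ 2) := by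
  have hpq' := sub_ne_zero.2 hpq.symm
  have h1 : ((p + (a + t * Complex.I) * (q - p)) - p) / ((p + (a + t * Complex.I) * (q - p)) - q)
     = (a + t * Complex.I) / ((a - 1) + t * Complex.I) := by
    have : (p + (a + t * Complex.I) * (q - p)) - q = ((a - 1) + t * Complex.I) * (q - p) := by ring
    rw [this, add_sub_cancel_left, mul_div_mul_right _ _ hpq']
  rw [h1, Complex.div_im]
  simp [Complex.normSq_apply]
  have : (a - 1) ^ 2 + t ^ 2 ≠ 0 := by positivity
  have : (a - 1) * (a - 1) + t * t ≠ 0 := by ring_nf; ring_nf at this; exact this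
  field_simp
  ring

theorem crosscut2 {g : ℂ ≃ₜ ℂ} {Θ : Set ℂ} {p q : ℂ} {ω : ℂ → ℂ} {n : ℕ → ℕ}
    (hr : RecC g n) (hΘ : IsOpen Θ) (hgΘ' : ∀ z, g z ∈ Θ ↔ z ∈ Θ) (hpq : p ≠ q)
    (hp : p ∉ Θ) (hq : q ∉ Θ)
    (hls : openSegment ℝ p q ⊆ Θ)
    (hfree : ∀ z ∈ openSegment ℝ p q, g z ∉ openSegment ℝ p q)
    (hω : ContinuousOn ω Θ)
    (hωe : ∀ z ∈ Θ, Complex.exp (ω z) = ((g z - p) / (g z - q)) / ((z - p) / (z - q)))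
    (hωs : ∀ z ∈ Θ, Tendsto (fun j => ∑ i ∈ Finset.range (n j), ω (g^[i] z)) atTop (𝓝 0))
    (hN : ¬ HasLog (fun z => (z - p) / (z - q)) Θ) : False := by
  have hpz : ∀ z ∈ Θ, z - p ≠ 0 := fun z hz h => hp (by rwa [← sub_eq_zero.1 h])
  have hqz : ∀ z ∈ Θ, z - q ≠ 0 := fun z hz h => hq (by rwa [← sub_eq_zero.1 h])
  have hmid : p + ((1/2 : ℝ) : ℂ) * (q - p) ∈ openSegment ℝ p q :=
    ⟨1/2, 1/2, by norm_num, by norm_num, by norm_num, by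
      simp only [Complex.real_smul]; push_cast; ring⟩
  have htend : ∀ s : ℝ, Tendsto (fun t : ℝ => p + (((1/2:ℝ) : ℂ) + (s * t : ℝ) * Complex.I) * (q - p))
      (𝓝[>] 0) (𝓝 (p + ((1/2 : ℝ) : ℂ) * (q - p))) := by
    intro s
    have : Continuous (fun t : ℝ => p + (((1/2:ℝ) : ℂ) + (s * t : ℝ) * Complex.I) * (q - p)) := by
      fun_prop
    have h2 := this.tendsto 0
    simp only [mul_zero, Complex.ofReal_zero, zero_mul, add_zero] at h2
    exact h2.mono_left nhdsWithin_le_nhds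
  refine crosscut hr hΘ hgΘ' (m := fun z => (z - p) / (z - q)) (lam := openSegment ℝ p q)
    (ContinuousOn.div (by fun_prop) (by fun_prop) hqz) (fun z hz => div_ne_zero (hpz z hz) (hqz z hz))
    hls (fun z hz => mob_slit hpq (sub_ne_zero.1 (hpz z hz)) (sub_ne_zero.1 (hqz z hz)))
    (convex_openSegment _ _).isPreconnected hmid ?_ ?_ hfree hω hωe hωs hN
  · refine (htend (-1)).frequently (Eventually.frequently ?_)
    filter_upwards [self_mem_nhdsWithin] with t ht
    have ht : 0 < t := ht
    rw [mob_im hpq _ _ (by simp [ht.ne'])]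
    simp only [neg_mul, one_mul, neg_neg]
    positivity
  · refine (htend 1).frequently (Eventually.frequently ?_)
    filter_upwards [self_mem_nhdsWithin] with t ht
    have ht : 0 < t := ht
    rw [mob_im hpq _ _ (by simp [ht.ne'])]
    rw [neg_div, neg_lt_zero]
    simp only [one_mul]
    positivity

/-- crosscut between two fixed points. -/
theorem star_fixed {g : ℂ ≃ₜ ℂ} {W : ℂ × ℂ → ℂ} (hW : IsAngle g W) {p q : ℂ} {n : ℕ → ℕ}
    (hr : RecC g n) (hpq : p ≠ q) (hp : g p = p) (hq : g q = q)
    (hfree : ∀ z ∈ openSegment ℝ p q, g z ∉ openSegment ℝ p q) : False := by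
  have hpi : ∀ i, g^[i] p = p := fun i => Function.iterate_fixed hp i
  have hqi : ∀ i, g^[i] q = q := fun i => Function.iterate_fixed hq i
  refine crosscut2 (Θ := {p, q}ᶜ) (ω := fun z => W (p, z) - W (q, z)) hr ?_ ?_ hpq (by simp) (by simp)
    ?_ hfree ?_ ?_ ?_ ?_
  · exact (Set.toFinite _).isClosed.isOpen_compl
  · intro z
    have h1 : g z = p ↔ z = p := ⟨fun h => g.injective (h.trans hp.symm), fun h => h ▸ hp⟩
    have h2 : g z = q ↔ z = q := ⟨fun h => g.injective (h.trans hq.symm), fun h => h ▸ hq⟩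
    simp [h1, h2]
  · intro z hz hz'
    rcases hz' with h | h
    · rw [h] at hz
      exact hpq (left_mem_openSegment_iff.1 hz)
    · have h : z = q := h
      rw [h] at hz
      exact hpq (right_mem_openSegment_iff.1 hz)
  · refine ContinuousOn.sub ?_ ?_
    · refine hW.cont.comp (by fun_prop) ?_
      intro z hz h
      exact hz (Or.inl h.symm)
    · refine hW.cont.comp (by fun_prop) ?_
      intro z hz h
      exact hz (Or.inr h.symm)
  · intro z hz
    have h1 : z ≠ p := fun h => hz (Or.inl h)
    have h2 : z ≠ q := fun h => hz (Or.inr h)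
    rw [Complex.exp_sub, hW.exp_eq _ _ h1.symm, hW.exp_eq _ _ h2.symm, hp, hq]
    rw [div_div_div_eq, div_div_div_eq]
    congr 1
    ring
  · intro z hz
    have h1 : z ≠ p := fun h => hz (Or.inl h)
    have h2 : z ≠ q := fun h => hz (Or.inr h)
    have := aSum_rec hW g.injective g.continuous hr h1.symm h2.symm
    simp only [aSum, hpi, hqi, ← Finset.sum_sub_distrib] at this
    exact this
  · intro hN
    have hd : 0 < dist p q := dist_pos.2 hpq
    refine circle_no_log p (R := dist p q / 2) (by positivity) (k := 1) one_ne_zero ?_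
    have h1 : sphere p (dist p q / 2) ⊆ ({p, q}ᶜ : Set ℂ) := by
      intro z hz hz'
      have hz : dist z p = dist p q / 2 := hz
      rcases hz' with h | h
      · rw [h, dist_self] at hz; linarith
      · rw [show z = q from h, dist_comm] at hz; linarith
    have h2 : HasLog (fun z : ℂ => z - q) (closedBall p (dist p q / 2)) := by
      refine star_log (x0 := p) ((convex_closedBall _ _).starConvex (by simp; positivity)) 
        (by fun_prop) ?_
      intro z hz h
      have hz : dist z p ≤ dist p q / 2 := hz
      rw [sub_eq_zero.1 h, dist_comm] at hz
      linarith
    refine ((hN.mono h1).mul (h2.mono sphere_subset_closedBall)).congr ?_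
    intro z hz
    have : z - q ≠ 0 := fun h => h1 hz (Or.inr (sub_eq_zero.1 h))
    field_simp


theorem no_log_sep {A1 A2 : Set ℂ} (h1 : IsClosed A1) (h2 : IsCompact A2) (hd : Disjoint A1 A2)
    {q : ℂ} (hq : q ∈ A2) : ¬ HasLog (fun z => z - q) (A1 ∪ A2)ᶜ := by
  classical
  rintro ⟨κ, hκ, hκe⟩
  obtain ⟨R, hR⟩ := h2.isBounded.subset_ball q
  have hR0 : 0 < R := by
    have := hR hq
    simpa using this
  let C : Set ℂ := A1 ∪ {z | R ≤ dist z q}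
  have hC : IsClosed C := h1.union (isClosed_le continuous_const (by fun_prop))
  have hd2 : Disjoint A2 C := by
    rw [Set.disjoint_left]
    rintro z hz (h | h)
    · exact Set.disjoint_left.1 hd h hz
    · have h : R ≤ dist z q := h
      have := hR hz
      rw [mem_ball] at this
      linarith
  obtain ⟨u, hu0, hu1, -⟩ := exists_continuous_zero_one_of_isClosed h2.isClosed hC hd2
  let χ : ℂ → ℝ := fun z => max 0 (min 1 (2 - 3 * u z))
  have hχ : Continuous χ := by fun_prop
  have χ1 : ∀ z, u z < 1 / 3 → χ z = 1 := by
    intro z hz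
    simp only [χ]
    rw [min_eq_left (by linarith)]; simp
  have χ0 : ∀ z, 2 / 3 < u z → χ z = 0 := by
    intro z hz
    simp only [χ]
    rw [max_eq_left]
    exact (min_le_right _ _).trans (by linarith)
  let M : ℂ → ℂ := fun z => if z ∈ A2 then 1 else if z ∈ A1 then z - q
    else (z - q) * Complex.exp (-(χ z * κ z))
  have M1 : ∀ z, u z < 1 / 3 → M z = 1 := by
    intro z hz
    simp only [M]
    split_ifs with a b
    · rfl
    · have := hu1 (Or.inl b); simp at this; linarith
    · rw [χ1 z hz, Complex.exp_neg, Complex.ofReal_one, one_mul, hκe z (by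
        rintro (h | h); exacts [b h, a h])]
      refine mul_inv_cancel₀ (sub_ne_zero.2 ?_)
      rintro rfl
      exact a hq
  have M0 : ∀ z, 2 / 3 < u z → M z = z - q := by
    intro z hz
    simp only [M]
    split_ifs with a b
    · have := hu0 a; simp at this; linarith
    · rfl
    · rw [χ0 z hz]; simp
  have hΘo : IsOpen (A1 ∪ A2)ᶜ := (h1.union h2.isClosed).isOpen_compl
  have hMc : Continuous M := by
    rw [continuous_iff_continuousAt]
    intro z
    by_cases a : z ∈ A2
    · refine (continuousAt_const (y := (1:ℂ))).congr ?_
      have : ∀ᶠ w in 𝓝 z, u w < 1 / 3 := by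
        refine u.continuous.continuousAt.eventually (gt_mem_nhds ?_)
        have := hu0 a; simp at this; rw [this]; norm_num
      filter_upwards [this] with w hw using (M1 w hw).symm
    · by_cases b : z ∈ A1
      · refine (continuousAt_id.sub (continuousAt_const (y := q))).congr ?_
        have : ∀ᶠ w in 𝓝 z, 2 / 3 < u w := by
          refine u.continuous.continuousAt.eventually (lt_mem_nhds ?_)
          have := hu1 (Or.inl b); simp at this; rw [this]; norm_num
        filter_upwards [this] with w hw using (M0 w hw).symm
      · have hz : z ∈ (A1 ∪ A2)ᶜ := by rintro (h | h); exacts [b h, a h]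
        have hk : ContinuousAt κ z := hκ.continuousAt (hΘo.mem_nhds hz)
        have : ContinuousAt (fun z => (z - q) * Complex.exp (-(χ z * κ z))) z := by fun_prop
        refine this.congr ?_
        filter_upwards [hΘo.mem_nhds hz] with w hw
        have h1 : w ∉ A1 := fun h => hw (Or.inl h)
        have h2 : w ∉ A2 := fun h => hw (Or.inr h)
        simp [M, h1, h2]
  have hM0 : ∀ z, M z ≠ 0 := by
    intro z
    simp only [M]
    split_ifs with a b
    · simp
    · rw [sub_ne_zero]; rintro rfl; exact a hq
    · refine mul_ne_zero (sub_ne_zero.2 ?_) (Complex.exp_ne_zero _)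
      rintro rfl
      exact a hq
  obtain ⟨l, hl, hle⟩ := log_univ hMc hM0
  refine circle_no_log q hR0 (k := 1) one_ne_zero ⟨l, hl.continuousOn, ?_⟩
  intro z hz
  simp only [pow_one]
  rw [hle, M0]
  have hz : dist z q = R := hz
  have := hu1 (Or.inr (hz.ge : R ≤ dist z q) : z ∈ C)
  simp at this
  rw [this]; norm_num

theorem log_far {X : Type*} [TopologicalSpace X] [T2Space X] {e : X}
    (τ : {x : X // x ≠ e} ≃ₜ ℂ) {A : Set X} (hA : IsPreconnected A) (he : e ∈ A) {A1 : Set ℂ}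
    (hA1 : IsClosed A1) (hAA : ∀ z, z ∈ A1 ↔ (τ.symm z : X) ∈ A) {p : ℂ} (hp : p ∈ A1) :
    HasLog (fun z => z - p) A1ᶜ := by
  refine log_open hA1.isOpen_compl (by fun_prop) ?_ ?_
  · intro z hz h
    exact hz (by rwa [sub_eq_zero.1 h])
  · intro γ hγ hγA hloop
    exact wn_conn_inf τ (a := 0) (b := 2) (by norm_num) hγ.continuousOn hloop hA he
      (fun t _ h => hγA t ((hAA _).2 h)) ((hAA p).1 hp)

theorem log_near {A2 : Set ℂ} (hA : IsPreconnected A2) (hA2 : IsClosed A2) {q b : ℂ}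
    (hq : q ∈ A2) (hb : b ∈ A2) : HasLog (fun z => (z - q) / (z - b)) A2ᶜ := by
  have hqz : ∀ z ∈ A2ᶜ, z - q ≠ 0 := fun z hz h => hz (by rwa [sub_eq_zero.1 h])
  have hbz : ∀ z ∈ A2ᶜ, z - b ≠ 0 := fun z hz h => hz (by rwa [sub_eq_zero.1 h])
  refine log_open hA2.isOpen_compl (ContinuousOn.div (by fun_prop) (by fun_prop) hbz)
    (fun z hz => div_ne_zero (hqz z hz) (hbz z hz)) ?_
  intro γ hγ hγA hloop
  have h02 : (0:ℝ) ≤ 2 := by norm_num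
  have h1 := wn_conn h02 hγ.continuousOn hloop hA (fun t _ => hγA t) hq hb
  have h2 := dlog_mul h02 (f := fun t => (γ t - q) / (γ t - b)) (g := fun t => γ t - b)
    (ContinuousOn.div (by fun_prop) (by fun_prop) fun t _ => hbz _ (hγA t))
    (fun t _ => div_ne_zero (hqz _ (hγA t)) (hbz _ (hγA t))) (by fun_prop) (fun t _ => hbz _ (hγA t))
  have h3 : (fun t => (γ t - q) / (γ t - b) * (γ t - b)) = fun t => γ t - q := by
    funext t
    have := hbz _ (hγA t)
    field_simp
  rw [h3] at h2
  unfold wn at h1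
  rw [h1] at h2
  simpa using h2

/-- crosscut between an invariant continuum containing infinity and a disjoint invariant continuum
containing a fixed point -/
theorem star_cont {X : Type*} [TopologicalSpace X] [T2Space X] {e : X}
    (τ : {x : X // x ≠ e} ≃ₜ ℂ) {g : ℂ ≃ₜ ℂ} {W : ℂ × ℂ → ℂ} (hW : IsAngle g W) {n : ℕ → ℕ}
    (hr : RecC g n) {A : Set X} (hA : IsPreconnected A) (he : e ∈ A) {A1 A2 : Set ℂ}
    (hA1 : IsClosed A1) (hAA : ∀ z, z ∈ A1 ↔ (τ.symm z : X) ∈ A)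
    (hA2 : IsCompact A2) (hA2c : IsPreconnected A2) (hd : Disjoint A1 A2)
    (hg1 : ∀ z, g z ∈ A1 ↔ z ∈ A1) (hg2 : ∀ z, g z ∈ A2 ↔ z ∈ A2)
    {b c : ℂ} (hb : b ∈ A2) (hgb : g b = b) (hgc : g c = c) (hbc : b ≠ c)
    {p q : ℂ} (hp : p ∈ A1) (hq : q ∈ A2)
    (hls : openSegment ℝ p q ⊆ (A1 ∪ A2)ᶜ)
    (hfree : ∀ z ∈ openSegment ℝ p q, g z ∉ openSegment ℝ p q) : False := by
  have hpq : p ≠ q := fun h => Set.disjoint_left.1 hd hp (h ▸ hq)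
  obtain ⟨e1, he1, he1e⟩ := log_far τ hA he hA1 hAA hp
  obtain ⟨e2, he2, he2e⟩ := log_near hA2c hA2.isClosed hq hb
  have hbi : ∀ i, g^[i] b = b := fun i => Function.iterate_fixed hgb i
  have hci : ∀ i, g^[i] c = c := fun i => Function.iterate_fixed hgc i
  have hΘ1 : ∀ z ∈ (A1 ∪ A2)ᶜ, z ∈ A1ᶜ := fun z hz h => hz (Or.inl h)
  have hΘ2 : ∀ z ∈ (A1 ∪ A2)ᶜ, z ∈ A2ᶜ := fun z hz h => hz (Or.inr h)
  have hgΘ : ∀ z, g z ∈ (A1 ∪ A2)ᶜ ↔ z ∈ (A1 ∪ A2)ᶜ := by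
    intro z
    simp only [Set.mem_compl_iff, Set.mem_union, hg1, hg2]
  have hΘo : IsOpen (A1 ∪ A2)ᶜ := (hA1.union hA2.isClosed).isOpen_compl
  have hzp : ∀ z ∈ (A1 ∪ A2)ᶜ, z - p ≠ 0 := fun z hz h => hz (Or.inl (by rwa [sub_eq_zero.1 h]))
  have hzq : ∀ z ∈ (A1 ∪ A2)ᶜ, z - q ≠ 0 := fun z hz h => hz (Or.inr (by rwa [sub_eq_zero.1 h]))
  have hzb : ∀ z ∈ (A1 ∪ A2)ᶜ, z - b ≠ 0 := fun z hz h => hz (Or.inr (by rwa [sub_eq_zero.1 h]))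
  have c1 : ContinuousOn e1 (A1 ∪ A2)ᶜ := he1.mono hΘ1
  have c2 : ContinuousOn e2 (A1 ∪ A2)ᶜ := he2.mono hΘ2
  have gm : Set.MapsTo g (A1 ∪ A2)ᶜ (A1 ∪ A2)ᶜ := fun z hz => (hgΘ z).2 hz
  refine crosscut2 (Θ := (A1 ∪ A2)ᶜ)
    (ω := fun z => e1 (g z) - e1 z - (e2 (g z) - e2 z) - (W (b, z) - W (b, c)))
    hr hΘo hgΘ hpq (fun h => h (Or.inl hp)) (fun h => h (Or.inr hq)) hls hfree ?_ ?_ ?_ ?_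
  · have w1 : ContinuousOn (fun z => W (b, z)) (A1 ∪ A2)ᶜ := by
      refine hW.cont.comp (by fun_prop) ?_
      intro z hz h
      have h : b = z := h
      exact hzb z hz (by rw [h, sub_self])
    have g1 : ContinuousOn (fun z => e1 (g z)) (A1 ∪ A2)ᶜ := c1.comp g.continuous.continuousOn gm
    have g2 : ContinuousOn (fun z => e2 (g z)) (A1 ∪ A2)ᶜ := c2.comp g.continuous.continuousOn gm
    exact ((g1.sub c1).sub (g2.sub c2)).sub (w1.sub continuousOn_const)
  · intro z hz
    have hgz := gm hz
    have n1 := hzp z hz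
    have n2 := hzq z hz
    have n3 := hzb z hz
    have n4 := hzp _ hgz
    have n5 := hzq _ hgz
    have n6 := hzb _ hgz
    have n7 : c - b ≠ 0 := sub_ne_zero.2 hbc.symm
    simp only [Complex.exp_sub]
    rw [he1e _ (hΘ1 _ hgz), he1e _ (hΘ1 _ hz), he2e _ (hΘ2 _ hgz), he2e _ (hΘ2 _ hz),
      hW.exp_eq _ _ (sub_ne_zero.1 n3).symm, hW.exp_eq _ _ hbc, hgb, hgc]
    field_simp
  · intro z hz
    have hgz : Tendsto (fun j => g^[n j] z) atTop (𝓝 z) := by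
      rw [Metric.tendsto_nhds]
      intro ε hε
      filter_upwards [hr.2 {z} isCompact_singleton ε hε] with j hj
      rw [dist_eq_norm]
      exact hj z rfl
    have a1 : Tendsto (fun j => e1 (g^[n j] z)) atTop (𝓝 (e1 z)) :=
      (c1.continuousAt (hΘo.mem_nhds hz)).tendsto.comp hgz
    have a2 : Tendsto (fun j => e2 (g^[n j] z)) atTop (𝓝 (e2 z)) :=
      (c2.continuousAt (hΘo.mem_nhds hz)).tendsto.comp hgz
    have a3 := aSum_rec hW g.injective g.continuous hr (sub_ne_zero.1 (hzb z hz)).symm hbc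
    simp only [aSum, hbi, hci] at a3
    have := ((a1.sub_const (e1 z)).sub (a2.sub_const (e2 z))).sub a3
    simp only [sub_self] at this
    refine this.congr ?_
    intro j
    rw [Finset.sum_sub_distrib, Finset.sum_sub_distrib, Finset.sum_sub_distrib (fun i => W _)]
    have t1 := Finset.sum_range_sub (fun i => e1 (g^[i] z)) (n j)
    have t2 := Finset.sum_range_sub (fun i => e2 (g^[i] z)) (n j)
    simp only [Function.iterate_succ_apply', Function.iterate_zero, id_eq] at t1 t2
    rw [t1, t2]
  · intro hN
    refine no_log_sep hA1 hA2 hd hq ?_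
    have h1 : HasLog (fun z => z - p) (A1 ∪ A2)ᶜ := ⟨e1, c1, fun z hz => he1e z (hΘ1 z hz)⟩
    refine (h1.div hN).congr ?_
    intro z hz
    have := hzp z hz
    have := hzq z hz
    field_simp


theorem conn_dir {X : Type*} [TopologicalSpace X] [CompactSpace X] [T2Space X] {ι : Type*}
    [Nonempty ι] {C : ι → Set X} (hd : Directed (fun s t => t ⊆ s) C)
    (hc : ∀ i, IsClosed (C i)) (hp : ∀ i, IsPreconnected (C i)) : IsPreconnected (⋂ i, C i) := by
  have hI : IsClosed (⋂ i, C i) := isClosed_iInter hc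
  rw [isPreconnected_iff_subset_of_fully_disjoint_closed hI]
  intro u v hu hv huv hd'
  obtain ⟨U, V, hU, hV, huU, hvV, hUV⟩ := normal_separation hu hv hd'
  obtain ⟨i, hi⟩ := exists_subset_nhds_of_isCompact' hd (fun i => (hc i).isCompact) hc
    (U := U ∪ V) (fun x hx => (hU.union hV).mem_nhds (by
      rcases huv hx with h | h
      exacts [Or.inl (huU h), Or.inr (hvV h)]))
  rcases (hp i).subset_or_subset hU hV hUV hi with h | h
  · left
    intro x hx
    refine (huv hx).resolve_right fun hxv => ?_
    exact Set.disjoint_left.1 hUV (h (Set.mem_iInter.1 hx i)) (hvV hxv)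
  · right
    intro x hx
    refine (huv hx).resolve_left fun hxv => ?_
    exact Set.disjoint_left.1 hUV (huU hxv) (h (Set.mem_iInter.1 hx i))

theorem closed_ccIn {X : Type*} [TopologicalSpace X] {K : Set X} {a : X} (hK : IsClosed K)
    (ha : a ∈ K) : IsClosed (connectedComponentIn K a) := by
  refine isClosed_of_closure_subset ?_
  exact (isPreconnected_connectedComponentIn.closure).subset_connectedComponentIn
    (subset_closure (mem_connectedComponentIn ha))
    (closure_minimal (connectedComponentIn_subset _ _) hK)

theorem bump {X : Type*} [TopologicalSpace X] [CompactSpace X] [T2Space X] {Q P U : Set X}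
    (hQ : IsPreconnected Q) (hP : IsClosed P) (hPQ : P ⊆ Q) (hU : IsOpen U) (hUP : Q ∩ U ⊆ P)
    (hQU : ¬ Q ⊆ U) {a : X} (ha : a ∈ P) : ¬ connectedComponentIn P a ⊆ U := by
  intro hsub
  have : CompactSpace P := isCompact_iff_compactSpace.1 hP.isCompact
  rw [connectedComponentIn_eq_image ha, connectedComponent_eq_iInter_isClopen] at hsub
  have hU' : IsOpen ((↑) ⁻¹' U : Set P) := hU.preimage continuous_subtype_val
  have : Nonempty { s : Set P // IsClopen s ∧ ⟨a, ha⟩ ∈ s } := ⟨⟨Set.univ, isClopen_univ, trivial⟩⟩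
  obtain ⟨⟨s, hs, has⟩, hsU⟩ := exists_subset_nhds_of_isCompact'
    (V := fun s : { s : Set P // IsClopen s ∧ ⟨a, ha⟩ ∈ s } => (s : Set P))
    (by
      rintro ⟨s, hs, hs'⟩ ⟨t, ht, ht'⟩
      exact ⟨⟨s ∩ t, hs.inter ht, hs', ht'⟩, Set.inter_subset_left, Set.inter_subset_right⟩)
    (fun s => s.2.1.isClosed.isCompact) (fun s => s.2.1.isClosed) (U := ((↑) ⁻¹' U : Set P))
    (fun x hx => hU'.mem_nhds (hsub ⟨x, hx, rfl⟩))
  have hsU : s ⊆ ((↑) ⁻¹' U : Set P) := hsU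
  obtain ⟨G, hG, hGs⟩ := isOpen_induced_iff.1 hs.isOpen
  let V : Set X := (↑) '' s
  have hVc : IsClosed V := hP.isClosedEmbedding_subtypeVal.isClosedMap _ hs.isClosed
  have hVe : ∀ x, x ∈ V ↔ ∃ h : x ∈ P, x ∈ G := by
    intro x
    constructor
    · rintro ⟨y, hy, rfl⟩
      rw [← hGs] at hy
      exact ⟨y.2, hy⟩
    · rintro ⟨h, h'⟩
      refine ⟨⟨x, h⟩, ?_, rfl⟩
      rw [← hGs]; exact h'
  have hVU : V ⊆ U := by
    rintro _ ⟨y, hy, rfl⟩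
    exact hsU hy
  obtain ⟨w, hwQ, hwU⟩ := Set.not_subset.1 hQU
  have haV : a ∈ V := ⟨⟨a, ha⟩, has, rfl⟩
  obtain ⟨x, hxQ, ⟨hxG, hxU⟩, hxV⟩ := hQ (G ∩ U) Vᶜ (hG.inter hU) hVc.isOpen_compl
    (by
      intro x hx
      by_cases h : x ∈ V
      · exact Or.inl ⟨((hVe x).1 h).2, hVU h⟩
      · exact Or.inr h)
    ⟨a, hPQ ha, ((hVe a).1 haV).2, hVU haV⟩ ⟨w, hwQ, fun h => hwU (hVU h)⟩
  exact hxV ((hVe x).2 ⟨hUP ⟨hxQ, hxU⟩, hxG⟩)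

/-- recurrence -/
def RecX {X : Type*} [PseudoMetricSpace X] (g : X → X) (n : ℕ → ℕ) : Prop :=
  Tendsto n atTop atTop ∧ ∀ ε > 0, ∀ᶠ j in atTop, ∀ x, dist (g^[n j] x) x < ε

theorem RecX.tendsto {X : Type*} [PseudoMetricSpace X] {g : X → X} {n : ℕ → ℕ} (h : RecX g n) (x : X) :
    Tendsto (fun j => g^[n j] x) atTop (𝓝 x) := by
  rw [Metric.tendsto_nhds]
  intro ε hε
  filter_upwards [h.2 ε hε] with j hj using hj x

theorem RecX.inv {X : Type*} [PseudoMetricSpace X] {g : X → X} {n : ℕ → ℕ} (h : RecX g n) {A : Set X}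
    (hA : IsClosed A) (hg : Set.MapsTo g A A) (x : X) : g x ∈ A ↔ x ∈ A := by
  refine ⟨fun hx => ?_, fun hx => hg hx⟩
  refine hA.mem_of_tendsto (h.tendsto x) ?_
  filter_upwards [h.1.eventually_gt_atTop 0] with j hj
  obtain ⟨k, hk⟩ : ∃ k, n j = k + 1 := ⟨n j - 1, by omega⟩
  rw [hk, Function.iterate_succ_apply]
  exact hg.iterate k hx

theorem grow {X : Type*} [MetricSpace X] [CompactSpace X] {g : X → X} (hgc : Continuous g)
    {n : ℕ → ℕ} (hr : RecX g n)
    {Q A O : Set X} (hQ : IsClosed Q) (hQp : IsPreconnected Q) (hQg : Set.MapsTo g Q Q)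
    (hAQ : A ⊆ Q) (hAp : IsPreconnected A) (hAg : Set.MapsTo g A A) (hAn : A.Nonempty)
    (hO : IsOpen O) (hAO : A ⊆ O) (hQO : ¬ Q ⊆ O) :
    ∃ A', IsClosed A' ∧ IsPreconnected A' ∧ Set.MapsTo g A' A' ∧ A ⊆ A' ∧ A' ⊆ Q ∧
      A' ⊆ closure O ∧ ¬ A' ⊆ O := by
  obtain ⟨a, ha⟩ := hAn
  let N := Q ∩ closure O
  have hN : IsClosed N := hQ.inter isClosed_closure
  have haN : a ∈ N := ⟨hAQ ha, subset_closure (hAO ha)⟩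
  have hAN : A ⊆ N := fun x hx => ⟨hAQ hx, subset_closure (hAO hx)⟩
  have hit : ∀ i, Continuous (g^[i]) := fun i => hgc.iterate i
  let K : ℕ → Set X := fun m => {x | x ∈ Q ∧ ∀ j ≤ m, infDist (g^[j] x) N ≤ 1 / ((m:ℝ) + 1)}
  have hK : ∀ m, IsClosed (K m) := by
    intro m
    have : K m = Q ∩ ⋂ j, ⋂ (_ : j ≤ m), {x | infDist (g^[j] x) N ≤ 1 / ((m:ℝ) + 1)} := by
      ext x; simp [K]
    rw [this]
    refine hQ.inter (isClosed_iInter fun j => isClosed_iInter fun _ => isClosed_le ?_ continuous_const)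
    exact (continuous_infDist_pt N).comp (hit j)
  have hAK : ∀ m, A ⊆ K m := by
    intro m x hx
    refine ⟨hAQ hx, fun j _ => ?_⟩
    rw [infDist_zero_of_mem (hAN (hAg.iterate j hx))]
    positivity
  have hKa : ∀ m k, m ≤ k → K k ⊆ K m := by
    rintro m k hmk x ⟨h1, h2⟩
    refine ⟨h1, fun j hj => (h2 j (hj.trans hmk)).trans ?_⟩
    have : (m:ℝ) ≤ k := by exact_mod_cast hmk
    apply one_div_le_one_div_of_le <;> linarith [(Nat.cast_nonneg m : (0:ℝ) ≤ m)]
  -- key step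
  have key : ∀ m, ∃ y ∈ connectedComponentIn (K m) a, y ∉ O := by
    intro m
    obtain ⟨k, hk, hkm⟩ := ((hr.2 (1 / ((m:ℝ) + 1)) (by positivity)).and
      (hr.1.eventually_gt_atTop m)).exists
    set M := n k
    let P : Set X := {x | ∀ i < M, g^[i] x ∈ N}
    let U : Set X := {x | ∀ i < M, g^[i] x ∈ O}
    have hP : IsClosed P := by
      have : P = ⋂ i, ⋂ (_ : i < M), (g^[i]) ⁻¹' N := by ext x; simp [P]
      rw [this]
      exact isClosed_iInter fun i => isClosed_iInter fun _ => hN.preimage (hit i)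
    have hU : IsOpen U := by
      have : U = ⋂ i ∈ Set.Iio M, (g^[i]) ⁻¹' O := by ext x; simp [U]
      rw [this]
      exact (Set.finite_Iio M).isOpen_biInter fun i _ => hO.preimage (hit i)
    have h0M : 0 < M := by omega
    have hPQ : P ⊆ Q := fun x hx => (hx 0 h0M).1
    have hAP : A ⊆ P := fun x hx i _ => hAN (hAg.iterate i hx)
    have hb := bump hQp hP hPQ hU (fun x hx i hi => ⟨hQg.iterate i hx.1, subset_closure (hx.2 i hi)⟩)
      (fun h => hQO fun x hx => h hx 0 h0M) (hAP ha)
    obtain ⟨y, hy, hyU⟩ := Set.not_subset.1 hb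
    simp only [U, Set.mem_ofPred_eq, not_forall] at hyU
    obtain ⟨i, hi, hyi⟩ := hyU
    refine ⟨g^[i] y, ?_, hyi⟩
    have hY : g^[i] '' connectedComponentIn P a ⊆ K m := by
      rintro _ ⟨z, hz, rfl⟩
      have hzP := connectedComponentIn_subset _ _ hz
      refine ⟨hQg.iterate i (hPQ hzP), fun j hj => ?_⟩
      rw [← Function.iterate_add_apply]
      by_cases hlt : j + i < M
      · rw [infDist_zero_of_mem (hzP _ hlt)]
        positivity
      · have : j + i = M + (j + i - M) := by omega
        rw [this, Function.iterate_add_apply]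
        exact (infDist_le_dist_of_mem (hzP (j + i - M) (by omega))).trans (hk _).le
    have hYc : IsPreconnected (g^[i] '' connectedComponentIn P a) :=
      isPreconnected_connectedComponentIn.image _ (hit i).continuousOn
    have hAC : A ⊆ connectedComponentIn P a := hAp.subset_connectedComponentIn ha hAP
    have h1 : (g^[i] '' connectedComponentIn P a) ∪ A ⊆ connectedComponentIn (K m) a := by
      refine IsPreconnected.subset_connectedComponentIn ?_ (Or.inr ha) (Set.union_subset hY (hAK m))
      refine IsPreconnected.union (g^[i] a) ⟨a, hAC ha, rfl⟩ (hAg.iterate i ha) hYc hAp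
    exact h1 (Or.inl ⟨y, hy, rfl⟩)
  -- the limit
  let C : ℕ → Set X := fun m => connectedComponentIn (K m) a
  have hCc : ∀ m, IsClosed (C m) := fun m => closed_ccIn (hK m) (hAK m ha)
  have hCa : ∀ m k, m ≤ k → C k ⊆ C m := fun m k h => connectedComponentIn_mono a (hKa m k h)
  have hCp : IsPreconnected (⋂ m, C m) :=
    conn_dir (fun i j => ⟨max i j, hCa _ _ (le_max_left _ _), hCa _ _ (le_max_right _ _)⟩) hCc
      fun m => isPreconnected_connectedComponentIn
  have haC : a ∈ ⋂ m, C m := Set.mem_iInter.2 fun m => mem_connectedComponentIn (hAK m ha)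
  have hCn : (⋂ m, (C m ∩ Oᶜ)).Nonempty := by
    refine IsCompact.nonempty_iInter_of_sequence_nonempty_isCompact_isClosed _ ?_ ?_ ?_ ?_
    · exact fun m => Set.inter_subset_inter_left _ (hCa m (m+1) (by omega))
    · exact fun m => by obtain ⟨y, h1, h2⟩ := key m; exact ⟨y, h1, h2⟩
    · exact ((hCc 0).inter hO.isClosed_compl).isCompact
    · exact fun m => (hCc m).inter hO.isClosed_compl
  let P : Set X := {x | ∀ j, g^[j] x ∈ N}
  have hP : IsClosed P := by
    have : P = ⋂ i, (g^[i]) ⁻¹' N := by ext x; simp [P]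
    rw [this]
    exact isClosed_iInter fun i => hN.preimage (hit i)
  have hAP : A ⊆ P := fun x hx i => hAN (hAg.iterate i hx)
  have hCP : (⋂ m, C m) ⊆ P := by
    intro x hx j
    have hx' : ∀ m, x ∈ K m := fun m => connectedComponentIn_subset _ _ (Set.mem_iInter.1 hx m)
    rw [← hN.closure_eq, mem_closure_iff_infDist_zero ⟨a, haN⟩]
    refine le_antisymm ?_ infDist_nonneg
    refine ge_of_tendsto (tendsto_one_div_add_atTop_nhds_zero_nat (𝕜 := ℝ)) ?_
    filter_upwards [eventually_ge_atTop j] with m hm using (hx' m).2 j hm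
  refine ⟨connectedComponentIn P a, closed_ccIn hP (hAP ha), isPreconnected_connectedComponentIn,
    ?_, hAp.subset_connectedComponentIn ha hAP, ?_, ?_, ?_⟩
  · have h1 : g '' connectedComponentIn P a ∪ A ⊆ connectedComponentIn P a := by
      refine IsPreconnected.subset_connectedComponentIn ?_ (Or.inr ha) (Set.union_subset ?_ hAP)
      · exact IsPreconnected.union (g a) ⟨a, mem_connectedComponentIn (hAP ha), rfl⟩ (hAg ha)
          (isPreconnected_connectedComponentIn.image _ hgc.continuousOn) hAp
      · rintro _ ⟨x, hx, rfl⟩ j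
        have := connectedComponentIn_subset _ _ hx (j + 1)
        rwa [Function.iterate_succ_apply] at this
    intro x hx
    exact h1 (Or.inl ⟨x, hx, rfl⟩)
  · exact fun x hx => (connectedComponentIn_subset _ _ hx 0).1
  · exact fun x hx => (connectedComponentIn_subset _ _ hx 0).2
  · obtain ⟨y, hy⟩ := hCn
    intro h
    have hy' : y ∈ ⋂ m, C m := Set.mem_iInter.2 fun m => (Set.mem_iInter.1 hy m).1
    exact (Set.mem_iInter.1 hy 0).2 (h (hCp.subset_connectedComponentIn haC hCP hy'))

section

section chart
variable {X : Type*} [TopologicalSpace X] {e : X} (τ : {x : X // x ≠ e} ≃ₜ ℂ)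

/-- the parametrization of the punctured sphere -/
noncomputable def sp (z : ℂ) : X := (τ.symm z : X)

open Classical in
/-- the chart extended by zero -/
noncomputable def tot (x : X) : ℂ := if h : x ≠ e then τ ⟨x, h⟩ else 0

theorem sp_cont : Continuous (sp τ) := continuous_subtype_val.comp τ.symm.continuous
theorem sp_ne (z : ℂ) : sp τ z ≠ e := (τ.symm z).2
theorem tot_sp (z : ℂ) : tot τ (sp τ z) = z := by
  unfold tot; rw [dif_pos (sp_ne τ z)]; simp [sp]
theorem sp_tot {x : X} (hx : x ≠ e) : sp τ (tot τ x) = x := by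
  unfold tot; rw [dif_pos hx]; simp [sp]
theorem sp_inj : Function.Injective (sp τ) := fun a b h => by
  rw [← tot_sp τ a, h, tot_sp]
theorem tot_cont [T1Space X] {x : X} (hx : x ≠ e) : ContinuousAt (tot τ) x := by
  have h1 : ContinuousOn (tot τ) {x | x ≠ e} := by
    rw [continuousOn_iff_continuous_domRestrict]
    refine τ.continuous.congr ?_
    intro y
    have := y.2; simp only [tot, Set.domRestrict_apply]; rw [dif_pos this]
  exact h1.continuousAt (isOpen_ne.mem_nhds hx)

/-- the homeomorphism of the plane induced by a homeomorphism fixing infinity. -/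
noncomputable def chartMap (G : X ≃ₜ X) (he : G e = e) : ℂ ≃ₜ ℂ :=
  τ.symm.trans ((G.subtype (p := fun x => x ≠ e) (q := fun x => x ≠ e)
    (fun x => by rw [not_iff_not]; exact ⟨fun h => h ▸ he, fun h => G.injective (h.trans he.symm)⟩)).trans τ)

theorem sp_chartMap (G : X ≃ₜ X) (he : G e = e) (z : ℂ) :
    sp τ (chartMap τ G he z) = G (sp τ z) := by
  simp [sp, chartMap]

theorem sp_chartMap_iter (G : X ≃ₜ X) (he : G e = e) (m : ℕ) (z : ℂ) :
    sp τ ((chartMap τ G he)^[m] z) = G^[m] (sp τ z) := by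
  induction m with
  | zero => rfl
  | succ m ih => rw [Function.iterate_succ_apply', sp_chartMap, ih, Function.iterate_succ_apply']

theorem chartMap_fix (G : X ≃ₜ X) (he : G e = e) (z : ℂ) :
    chartMap τ G he z = z ↔ G (sp τ z) = sp τ z := by
  rw [← sp_chartMap τ G he, (sp_inj τ).eq_iff]

end chart

theorem recC_of_recX {X : Type*} [MetricSpace X] {e : X} (τ : {x : X // x ≠ e} ≃ₜ ℂ)
    (G : X ≃ₜ X) (he : G e = e) {n : ℕ → ℕ} (hr : RecX G n) : RecC (chartMap τ G he) n := by
  refine ⟨hr.1, fun K hK ε hε => ?_⟩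
  have hK' : IsCompact (sp τ '' K) := hK.image (sp_cont τ)
  have := hK'.uniformContinuousAt_of_continuousAt (tot τ) (r := {p : ℂ × ℂ | dist p.1 p.2 < ε})
    (fun x hx => by
      obtain ⟨z, -, rfl⟩ := hx
      exact tot_cont τ (sp_ne τ z)) (dist_mem_uniformity hε)
  obtain ⟨δ, hδ, h⟩ := Metric.mem_uniformity_dist.1 this
  filter_upwards [hr.2 δ hδ] with j hj z hz
  have h1 := h (a := sp τ z) (b := G^[n j] (sp τ z)) (by rw [dist_comm]; exact hj _) ⟨z, hz, rfl⟩
  have h1 : dist (tot τ (sp τ z)) (tot τ (G^[n j] (sp τ z))) < ε := h1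
  rw [← sp_chartMap_iter τ G he, tot_sp, tot_sp, dist_comm, dist_eq_norm] at h1
  exact h1

theorem exists_angle_chart {X : Type*} [TopologicalSpace X] {e : X} (τ : {x : X // x ≠ e} ≃ₜ ℂ)
    (K G : X ≃ₜ X) (hK : K e = e) (he : G e = e) (hG : ∀ x, G x = K (K x)) :
    ∃ W, IsAngle (chartMap τ G he) W := by
  obtain ⟨W, hW⟩ := exists_angle (chartMap τ K hK)
  have : (chartMap τ G he : ℂ → ℂ) = fun z => chartMap τ K hK (chartMap τ K hK z) := by
    funext z
    apply sp_inj τ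
    rw [sp_chartMap, sp_chartMap, sp_chartMap, hG]
  rw [this]
  exact ⟨W, hW⟩

theorem seg_gap {A1 A2 : Set ℂ} (h1 : IsClosed A1) (h2 : IsClosed A2) (hd : Disjoint A1 A2)
    {p0 q0 : ℂ} (hp : p0 ∈ A1) (hq : q0 ∈ A2) : ∃ p ∈ A1, ∃ q ∈ A2, p ∈ segment ℝ p0 q0 ∧
      q ∈ segment ℝ p0 q0 ∧ openSegment ℝ p q ⊆ (A1 ∪ A2)ᶜ := by
  let l : ℝ → ℂ := fun t => AffineMap.lineMap p0 q0 t
  have hl : Continuous l := AffineMap.lineMap_continuous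
  have hT2 : IsCompact (Set.Icc (0:ℝ) 1 ∩ l ⁻¹' A2) := isCompact_Icc.inter_right (h2.preimage hl)
  obtain ⟨t2, ⟨ht2, ht2A⟩, ht2m⟩ := hT2.exists_isLeast ⟨1, by simp, by simpa [l] using hq⟩
  have hT1 : IsCompact (Set.Icc (0:ℝ) t2 ∩ l ⁻¹' A1) := isCompact_Icc.inter_right (h1.preimage hl)
  obtain ⟨t1, ⟨ht1, ht1A⟩, ht1m⟩ := hT1.exists_isGreatest ⟨0, by simp [ht2.1], by simpa [l] using hp⟩
  have hne : t1 ≠ t2 := by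
    rintro rfl
    exact Set.disjoint_left.1 hd ht1A ht2A
  have hlt : t1 < t2 := lt_of_le_of_ne ht1.2 hne
  have hseg : ∀ t ∈ Set.Icc (0:ℝ) 1, l t ∈ segment ℝ p0 q0 := by
    intro t ht
    rw [segment_eq_image_lineMap]
    exact ⟨t, ht, rfl⟩
  refine ⟨l t1, ht1A, l t2, ht2A, hseg _ ⟨ht1.1, ht1.2.trans ht2.2⟩, hseg _ ht2, ?_⟩
  rintro z ⟨a, b, ha, hb, hab, rfl⟩
  have hz : a • l t1 + b • l t2 = l (a * t1 + b * t2) := by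
    simp only [l, AffineMap.lineMap_apply_module]
    have : a = 1 - b := by linarith
    subst this
    module
  rw [hz]
  have e1 : t1 < a * t1 + b * t2 := by
    have : a * t1 + b * t2 = t1 + b * (t2 - t1) := by rw [← eq_sub_iff_add_eq] at hab; rw [hab]; ring
    rw [this]; nlinarith
  have e2 : a * t1 + b * t2 < t2 := by
    have : a * t1 + b * t2 = t2 - a * (t2 - t1) := by rw [← eq_sub_iff_add_eq'] at hab; rw [hab]; ring
    rw [this]; nlinarith
  rintro (h | h)
  · have := ht1m ⟨⟨by linarith [ht1.1], e2.le⟩, h⟩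
    linarith
  · have := ht2m ⟨⟨by linarith [ht1.1], by linarith [ht2.2]⟩, h⟩
    linarith

end


theorem cross_ball {X : Type*} [MetricSpace X] [CompactSpace X] {e : X}
    (τ : {x : X // x ≠ e} ≃ₜ ℂ) (G : X ≃ₜ X) (he : G e = e) {n : ℕ → ℕ} (hr : RecX G n)
    {W : ℂ × ℂ → ℂ} (hW : IsAngle (chartMap τ G he) W)
    {B : Set X} (hB : IsClosed B) (hBp : IsPreconnected B) (hBg : Set.MapsTo G B B) (heB : e ∉ B)
    {b c : X} (hb : b ∈ B) (hbf : G b = b) (hcf : G c = c) (hbc : b ≠ c) (hce : c ≠ e)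
    {w : X} (hwB : w ∈ B) (hwf : G w ≠ w) :
    ∀ᶠ y in 𝓝 w, ∀ A : Set X, IsClosed A → IsPreconnected A → Set.MapsTo G A A → e ∈ A →
      Disjoint A B → y ∉ A := by
  have hne : ∀ x ∈ B, x ≠ e := fun x hx h => heB (h ▸ hx)
  set g := chartMap τ G he with hg
  set w' := tot τ w with hw'
  have hsw : sp τ w' = w := sp_tot τ (hne w hwB)
  have hgw : g w' ≠ w' := by
    rw [Ne, chartMap_fix, hsw]; exact hwf
  -- a free ball
  obtain ⟨δ, hδ, hfree⟩ : ∃ δ > 0, ∀ z ∈ ball w' δ, g z ∉ ball w' δ := by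
    have hd : 0 < dist (g w') w' := dist_pos.2 hgw
    have h1 : ∀ᶠ z in 𝓝 w', dist (g z) (g w') < dist (g w') w' / 2 :=
      Metric.tendsto_nhds.1 (g.continuous.tendsto w') _ (by positivity)
    obtain ⟨δ, hδ, h⟩ := Metric.eventually_nhds_iff.1 h1
    refine ⟨min δ (dist (g w') w' / 2), by positivity, ?_⟩
    intro z hz hz'
    rw [mem_ball] at hz hz'
    have a1 := h (hz.trans_le (min_le_left _ _))
    have a2 := hz'.trans_le (min_le_right _ _)
    have a3 := dist_triangle_left (g w') w' (g z)
    linarith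
  have h1 : ∀ᶠ y in 𝓝 w, tot τ y ∈ ball w' δ :=
    (tot_cont τ (hne w hwB)).eventually (ball_mem_nhds _ hδ)
  have h2 : ∀ᶠ y in 𝓝 w, y ≠ e := isOpen_ne.mem_nhds (hne w hwB)
  filter_upwards [h1, h2] with y hy hye A hA hAp hAg heA hd hyA
  let A1 : Set ℂ := sp τ ⁻¹' A
  let A2 : Set ℂ := sp τ ⁻¹' B
  have hA1 : IsClosed A1 := hA.preimage (sp_cont τ)
  have hA2e : A2 = tot τ '' B := by
    ext z
    constructor
    · intro h
      exact ⟨sp τ z, h, tot_sp τ z⟩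
    · rintro ⟨x, hx, rfl⟩
      change sp τ (tot τ x) ∈ B
      rwa [sp_tot τ (hne x hx)]
  have hco : ContinuousOn (tot τ) B := fun x hx => (tot_cont τ (hne x hx)).continuousWithinAt
  have hA2 : IsCompact A2 := by rw [hA2e]; exact hB.isCompact.image_of_continuousOn hco
  have hA2c : IsPreconnected A2 := by rw [hA2e]; exact hBp.image _ hco
  have hdd : Disjoint A1 A2 := by
    rw [Set.disjoint_left]
    intro z h1 h2
    exact Set.disjoint_left.1 hd h1 h2
  have hyA1 : tot τ y ∈ A1 := by
    change sp τ (tot τ y) ∈ A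
    rwa [sp_tot τ hye]
  have hwA2 : w' ∈ A2 := by
    change sp τ w' ∈ B
    rwa [hsw]
  obtain ⟨p, hp, q, hq, hps, hqs, hpq⟩ := seg_gap hA1 hA2.isClosed hdd hyA1 hwA2
  have hseg : openSegment ℝ p q ⊆ ball w' δ := by
    have h3 : segment ℝ (tot τ y) w' ⊆ ball w' δ :=
      (convex_ball w' δ).segment_subset hy (mem_ball_self hδ)
    refine (openSegment_subset_segment ℝ p q).trans ?_
    exact (convex_ball w' δ).segment_subset (h3 hps) (h3 hqs)
  refine star_cont τ hW (recC_of_recX τ G he hr) hAp heA hA1 (fun z => Iff.rfl) hA2 hA2c hdd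
    (fun z => ?_) (fun z => ?_) (b := tot τ b) (c := tot τ c) ?_ ?_ ?_ ?_ hp hq hpq
    (fun z hz h => hfree z (hseg hz) (hseg h))
  · change sp τ (chartMap τ G he z) ∈ A ↔ sp τ z ∈ A
    rw [sp_chartMap]; exact hr.inv hA hAg _
  · change sp τ (chartMap τ G he z) ∈ B ↔ sp τ z ∈ B
    rw [sp_chartMap]; exact hr.inv hB hBg _
  · change sp τ (tot τ b) ∈ B
    rwa [sp_tot τ (hne b hb)]
  · rw [hg, chartMap_fix, sp_tot τ (hne b hb), hbf]
  · rw [hg, chartMap_fix, sp_tot τ hce, hcf]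
  · intro h
    apply hbc
    rw [← sp_tot τ (hne b hb), h, sp_tot τ hce]

theorem fix_conn_aux {X : Type*} [MetricSpace X] [CompactSpace X] [PreconnectedSpace X] {e : X}
    (τ : {x : X // x ≠ e} ≃ₜ ℂ) (G : X ≃ₜ X) (he : G e = e) {n : ℕ → ℕ} (hr : RecX G n)
    {W : ℂ × ℂ → ℂ} (hW : IsAngle (chartMap τ G he) W)
    {x1 x2 : X} (h1 : G x1 = x1) (h2 : G x2 = x2) (h1e : x1 ≠ e) (h2e : x2 ≠ e) (h12 : x1 ≠ x2)
    {F1 F2 : Set X} (hF1 : IsClosed F1) (hF2 : IsClosed F2) (hd : Disjoint F1 F2)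
    (hF : ∀ x, G x = x ↔ x ∈ F1 ∪ F2) (heF : e ∈ F1) (hF2n : F2.Nonempty) : False := by
  -- minimal Q
  let 𝒬 : Set (Set X) := {Q | IsClosed Q ∧ IsPreconnected Q ∧ Set.MapsTo G Q Q ∧ e ∈ Q ∧
    (Q ∩ F2).Nonempty}
  obtain ⟨Q, -, hQmin⟩ := zorn_superset_nonempty 𝒬 (by
    intro c hc hch hcn
    have : Nonempty c := hcn.to_subtype
    have hdir : Directed (fun s t => t ⊆ s) (fun s : c => (s : Set X)) := by
      rintro ⟨s, hs⟩ ⟨t, ht⟩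
      rcases hch.total hs ht with h | h
      · exact ⟨⟨s, hs⟩, subset_rfl, h⟩
      · exact ⟨⟨t, ht⟩, h, subset_rfl⟩
    refine ⟨⋂ s : c, (s : Set X), ⟨isClosed_iInter fun s => (hc s.2).1,
      conn_dir hdir (fun s => (hc s.2).1) fun s => (hc s.2).2.1, ?_, ?_, ?_⟩, ?_⟩
    · intro x hx
      exact Set.mem_iInter.2 fun s => (hc s.2).2.2.1 (Set.mem_iInter.1 hx s)
    · exact Set.mem_iInter.2 fun s => (hc s.2).2.2.2.1
    · rw [Set.iInter_inter]
      refine IsCompact.nonempty_iInter_of_directed_nonempty_isCompact_isClosed _ ?_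
        (fun s => (hc s.2).2.2.2.2) (fun s => ((hc s.2).1.inter hF2).isCompact)
        (fun s => (hc s.2).1.inter hF2)
      intro s t
      obtain ⟨r, h1, h2⟩ := hdir s t
      exact ⟨r, Set.inter_subset_inter_left _ h1, Set.inter_subset_inter_left _ h2⟩
    · intro s hs
      exact Set.iInter_subset (fun s : c => (s : Set X)) ⟨s, hs⟩) Set.univ
    ⟨isClosed_univ, isPreconnected_univ, fun _ _ => trivial, trivial, by simpa using hF2n⟩
  obtain ⟨hQ, hQp, hQg, heQ, b, hbQ, hbF2⟩ := hQmin.prop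
  have hbf : G b = b := (hF b).2 (Or.inr hbF2)
  have hbe : b ≠ e := by
    rintro rfl
    exact Set.disjoint_left.1 hd heF hbF2
  -- B
  obtain ⟨O, hO, hF2O, hOF1⟩ := normal_exists_closure_subset hF2 hF1.isOpen_compl
    (fun x hx h => Set.disjoint_left.1 hd h hx)
  have heO : e ∉ O := fun h => hOF1 (subset_closure h) heF
  obtain ⟨B, hB, hBp, hBg, hbB, hBQ, hBO, hBnO⟩ := grow G.continuous hr hQ hQp hQg
    (A := {b}) (by simpa using hbQ) isPreconnected_singleton (by simp [Set.MapsTo, hbf])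
    (Set.singleton_nonempty b) hO (by simpa using hF2O hbF2) (fun h => heO (h heQ))
  have hbB : b ∈ B := hbB rfl
  have hBF1 : ∀ x ∈ B, x ∉ F1 := fun x hx => hOF1 (hBO hx)
  have heB : e ∉ B := fun h => hBF1 e h heF
  obtain ⟨w0, hw0B, hw0O⟩ := Set.not_subset.1 hBnO
  have hw0 : G w0 ≠ w0 := by
    rw [Ne, hF]
    rintro (h | h)
    exacts [hBF1 _ hw0B h, hw0O (hF2O h)]
  obtain ⟨c0, hc0, hbc, hce⟩ : ∃ c, G c = c ∧ b ≠ c ∧ c ≠ e := by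
    by_cases h : b = x1
    · exact ⟨x2, h2, h ▸ h12, h2e⟩
    · exact ⟨x1, h1, h, h1e⟩
  let 𝒜 : Set (Set X) := {A | IsClosed A ∧ IsPreconnected A ∧ Set.MapsTo G A A ∧ e ∈ A ∧ A ⊆ Q ∧
    Disjoint A B}
  obtain ⟨A, -, hAmax⟩ := zorn_subset_nonempty 𝒜 (by
    intro c hc hch hcn
    have hp : IsPreconnected (closure (⋃₀ c)) :=
      (_root_.isPreconnected_sUnion e c (fun s hs => (hc hs).2.2.2.1) fun s hs => (hc hs).2.1).closure
    have hg : Set.MapsTo G (closure (⋃₀ c)) (closure (⋃₀ c)) := by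
      refine Set.MapsTo.closure ?_ G.continuous
      rintro x ⟨s, hs, hx⟩
      exact ⟨s, hs, (hc hs).2.2.1 hx⟩
    have he' : e ∈ closure (⋃₀ c) := by
      obtain ⟨s, hs⟩ := hcn
      exact subset_closure ⟨s, hs, (hc hs).2.2.2.1⟩
    have hsQ : closure (⋃₀ c) ⊆ Q := closure_minimal (Set.sUnion_subset fun s hs => (hc hs).2.2.2.2.1) hQ
    have hallfix : ∀ w ∈ closure (⋃₀ c), w ∈ B → G w = w := by
      intro w hw hwB
      by_contra hwf
      have hev := cross_ball τ G he hr hW hB hBp hBg heB hbB hbf hc0 hbc hce hwB hwf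
      obtain ⟨y, ⟨s, hs, hys⟩, hy⟩ := ((mem_closure_iff_frequently.1 hw).and_eventually hev).exists
      obtain ⟨a1, a2, a3, a4, -, a6⟩ := hc hs
      exact hy s a1 a2 a3 a4 a6 hys
    refine ⟨closure (⋃₀ c), ⟨isClosed_closure, hp, hg, he', hsQ, ?_⟩, ?_⟩
    · rw [Set.disjoint_left]
      intro w hw hwB
      have hwF2 : w ∈ F2 := ((hF w).1 (hallfix w hw hwB)).resolve_left (hBF1 w hwB)
      have hQs : Q ⊆ closure (⋃₀ c) := hQmin.2 (y := closure (⋃₀ c)) ⟨isClosed_closure, hp, hg, he',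
        ⟨w, hw, hwF2⟩⟩ hsQ
      exact hw0 (hallfix w0 (hQs (hBQ hw0B)) hw0B)
    · intro s hs x hx
      exact subset_closure ⟨s, hs, hx⟩) {e}
    ⟨isClosed_singleton, isPreconnected_singleton, by simp [Set.MapsTo, he], rfl, by simpa using heQ,
      by simpa using heB⟩
  obtain ⟨hA, hAp, hAg, heA, hAQ, hAB⟩ := hAmax.prop
  obtain ⟨O', hO', hAO', hO'B⟩ := normal_exists_closure_subset hA hB.isOpen_compl
    (fun x hx h => Set.disjoint_left.1 hAB hx h)
  obtain ⟨A', hA', hA'p, hA'g, hAA', hA'Q, hA'O, hA'nO⟩ := grow G.continuous hr hQ hQp hQg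
    hAQ hAp hAg ⟨e, heA⟩ hO' hAO' (fun h => hO'B (subset_closure (h hbQ)) hbB)
  apply hA'nO
  have := hAmax.2 (y := A') ⟨hA', hA'p, hA'g, hAA' heA, hA'Q,
    Set.disjoint_left.2 fun x hx h => hO'B (hA'O hx) h⟩ hAA'
  exact Set.Subset.trans this hAO'

theorem fix_conn {X : Type*} [MetricSpace X] [CompactSpace X] [PreconnectedSpace X] {e : X}
    (τ : {x : X // x ≠ e} ≃ₜ ℂ) (G : X ≃ₜ X) (he : G e = e) {n : ℕ → ℕ} (hr : RecX G n)
    {W : ℂ × ℂ → ℂ} (hW : IsAngle (chartMap τ G he) W)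
    {x1 x2 : X} (h1 : G x1 = x1) (h2 : G x2 = x2) (h1e : x1 ≠ e) (h2e : x2 ≠ e) (h12 : x1 ≠ x2) :
    IsPreconnected {x | G x = x} := by
  have hc : IsClosed {x | G x = x} := isClosed_eq G.continuous continuous_id
  rw [isPreconnected_iff_subset_of_fully_disjoint_closed hc]
  by_contra hcon
  push Not at hcon
  obtain ⟨u, v, hu, hv, huv, hd, h3, h4⟩ := hcon
  obtain ⟨a, ha, hau⟩ := Set.not_subset.1 h3
  obtain ⟨b, hb, hbv⟩ := Set.not_subset.1 h4
  have hav : a ∈ v := (huv ha).resolve_left hau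
  have hbu : b ∈ u := (huv hb).resolve_right hbv
  have hd' : Disjoint ({x | G x = x} ∩ u) ({x | G x = x} ∩ v) :=
    hd.mono Set.inter_subset_right Set.inter_subset_right
  rcases huv he with h | h
  · refine fix_conn_aux τ G he hr hW h1 h2 h1e h2e h12 (hc.inter hu) (hc.inter hv) hd' ?_ ⟨he, h⟩
      ⟨a, ha, hav⟩
    intro x
    rw [← Set.inter_union_distrib_left]
    exact ⟨fun h => ⟨h, huv h⟩, fun h => h.1⟩
  · refine fix_conn_aux τ G he hr hW h1 h2 h1e h2e h12 (hc.inter hv) (hc.inter hu) hd'.symm ?_ ⟨he, h⟩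
      ⟨b, hb, hbu⟩
    intro x
    rw [← Set.inter_union_distrib_left]
    exact ⟨fun h => ⟨h, (huv h).symm⟩, fun h => h.1⟩


theorem starConvex_union_convex {E : Type*} [AddCommGroup E] [Module ℝ E] {S T : Set E} {x : E}
    (hS : Convex ℝ S) (hT : Convex ℝ T) (h1 : x ∈ S) (h2 : x ∈ T) : StarConvex ℝ x (S ∪ T) :=
  StarConvex.union (hS.starConvex h1) (hT.starConvex h2)

theorem starConvex_preconn {E : Type*} [AddCommGroup E] [Module ℝ E] [TopologicalSpace E]
    [IsTopologicalAddGroup E] [ContinuousSMul ℝ E] {S : Set E} {x : E}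
    (hS : StarConvex ℝ x S) (hx : x ∈ S) : IsPreconnected S :=
  (hS.isPathConnected hx).isConnected.isPreconnected

/-- The Brown-Reeken type winding contradiction. -/
theorem br_core {g : ℂ → ℂ} {W : ℂ × ℂ → ℂ} (hW : IsAngle g W) {c : ℝ → ℂ} (hc : Continuous c)
    (hg : ∀ t, c (t + 1) = g (c t)) {a b : ℝ} (hab : a + 1 < b)
    (hlag : ∀ t s, t < s → s ≤ t + 1 → c t ≠ c s)
    (hinj : ∀ t s, a ≤ t → t < s → s ≤ b → s - t < b - a → c t ≠ c s)
    (hslit : ∀ s, a < s → s < b → (c s - c b) / (c s - c a) ∈ Complex.slitPlane)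
    (h1 : ‖Complex.log ((c (a+1) - c b) / (c (a+1) - c a))‖ < 1)
    (h2 : ‖Complex.log ((c (b-1) - c b) / (c (b-1) - c a))‖ < 1)
    (h3 : ‖dlog (fun t => g (c t) - c t) a b‖ < 1)
    (h4 : ‖W (c a, c (b-1)) - W (c (b-1), c b)‖ < 1) : False := by
  let T1 : Set (ℝ × ℝ) := {p | a ≤ p.1 ∧ p.1 < p.2 ∧ p.2 ≤ b ∧ p.2 - p.1 < b - a}
  let T2 : Set (ℝ × ℝ) := {p | a ≤ p.1 ∧ p.1 < p.2 ∧ p.2 ≤ p.1 + 1 ∧ p.1 ≤ b}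
  let T3 : Set (ℝ × ℝ) := {p | a ≤ p.1 ∧ p.1 < p.2 ∧ p.2 ≤ b - 1}
  let T4 : Set (ℝ × ℝ) := {p | a ≤ p.1 ∧ p.1 < p.2 ∧ p.2 ≤ p.1 + 1 ∧ p.1 ≤ b - 1}
  have cv : ∀ (x y u v : ℝ), 0 ≤ u → 0 ≤ v → u + v = 1 → ∀ m, x ≤ m → y ≤ m → u * x + v * y ≤ m := by
    intro x y u v hu hv huv m hx hy
    have e1 := mul_le_mul_of_nonneg_left hx hu
    have e2 := mul_le_mul_of_nonneg_left hy hv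
    have e3 : u * m + v * m = m := by rw [← add_mul, huv, one_mul]
    linarith
  have cv' : ∀ (x y u v : ℝ), 0 ≤ u → 0 ≤ v → u + v = 1 → ∀ m, x < m → y < m → u * x + v * y < m := by
    intro x y u v hu hv huv m hx hy
    have := cv x y u v hu hv huv (max x y) (le_max_left _ _) (le_max_right _ _)
    exact lt_of_le_of_lt this (max_lt hx hy)
  have cT1 : Convex ℝ T1 := by
    rintro ⟨t, s⟩ ⟨h1, h2, h3, h4⟩ ⟨t', s'⟩ ⟨h1', h2', h3', h4'⟩ u v hu hv huv
    have e1 := cv (-t) (-t') u v hu hv huv (-a) (by linarith) (by linarith)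
    have e2 := cv' (t-s) (t'-s') u v hu hv huv 0 (by linarith) (by linarith)
    have e3 := cv (s) (s') u v hu hv huv b (by linarith) (by linarith)
    have e4 := cv' (s-t) (s'-t') u v hu hv huv (b-a) (by linarith) (by linarith)
    refine ⟨?_, ?_, ?_, ?_⟩ <;> simp <;> linarith
  have cT2 : Convex ℝ T2 := by
    rintro ⟨t, s⟩ ⟨h1, h2, h3, h4⟩ ⟨t', s'⟩ ⟨h1', h2', h3', h4'⟩ u v hu hv huv
    have e1 := cv (-t) (-t') u v hu hv huv (-a) (by linarith) (by linarith)
    have e2 := cv' (t-s) (t'-s') u v hu hv huv 0 (by linarith) (by linarith)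
    have e3 := cv (s-t) (s'-t') u v hu hv huv 1 (by linarith) (by linarith)
    have e4 := cv t t' u v hu hv huv b (by linarith) (by linarith)
    refine ⟨?_, ?_, ?_, ?_⟩ <;> simp <;> linarith
  have cT3 : Convex ℝ T3 := by
    rintro ⟨t, s⟩ ⟨h1, h2, h3⟩ ⟨t', s'⟩ ⟨h1', h2', h3'⟩ u v hu hv huv
    have e1 := cv (-t) (-t') u v hu hv huv (-a) (by linarith) (by linarith)
    have e2 := cv' (t-s) (t'-s') u v hu hv huv 0 (by linarith) (by linarith)
    have e3 := cv (s) (s') u v hu hv huv (b-1) (by linarith) (by linarith)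
    refine ⟨?_, ?_, ?_⟩ <;> simp <;> linarith
  have cT4 : Convex ℝ T4 := by
    rintro ⟨t, s⟩ ⟨h1, h2, h3, h4⟩ ⟨t', s'⟩ ⟨h1', h2', h3', h4'⟩ u v hu hv huv
    have e1 := cv (-t) (-t') u v hu hv huv (-a) (by linarith) (by linarith)
    have e2 := cv' (t-s) (t'-s') u v hu hv huv 0 (by linarith) (by linarith)
    have e3 := cv (s-t) (s'-t') u v hu hv huv 1 (by linarith) (by linarith)
    have e4 := cv t t' u v hu hv huv (b-1) (by linarith) (by linarith)
    refine ⟨?_, ?_, ?_, ?_⟩ <;> simp <;> linarith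
  have hst : StarConvex ℝ ((a, a+1) : ℝ × ℝ) (T1 ∪ T2) :=
    starConvex_union_convex cT1 cT2 ⟨by simp, by simp, by simp; linarith, by simp; linarith⟩
      ⟨by simp, by simp, by simp, by simp; linarith⟩
  have hne : ∀ p ∈ T1 ∪ T2, c p.2 - c p.1 ≠ 0 := by
    rintro ⟨t, s⟩ (⟨h1, h2, h3, h4⟩ | ⟨h1, h2, h3, h4⟩)
    · exact sub_ne_zero.2 (hinj t s h1 h2 h3 h4).symm
    · exact sub_ne_zero.2 (hlag t s h2 h3).symm
  obtain ⟨A, hA, hAe⟩ := star_log hst (f := fun p => c p.2 - c p.1) (by fun_prop) hne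
  have hδ : ∃ δ : ℝ, 0 < δ ∧ δ ≤ 1 ∧ a + δ ≤ b - 1 :=
    ⟨min 1 (b-1-a), lt_min one_pos (by linarith), min_le_left _ _, by
      linarith [min_le_right 1 (b-1-a)]⟩
  obtain ⟨δ, hδ0, hδ1, hδ2⟩ := hδ
  have hx0 : ((a, a+δ) : ℝ × ℝ) ∈ T3 := ⟨by simp, by simpa using hδ0, by simpa using hδ2⟩
  have hx0' : ((a, a+δ) : ℝ × ℝ) ∈ T4 := ⟨by simp, by simpa using hδ0, by simpa using hδ1, by simp; linarith⟩
  have hst' := starConvex_preconn (starConvex_union_convex cT3 cT4 hx0 hx0') (Or.inl hx0)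
  have hsub : ∀ p ∈ T3 ∪ T4, p ∈ T1 ∪ T2 := by
    rintro ⟨t, s⟩ (⟨h1, h2, h3⟩ | ⟨h1, h2, h3, h4⟩)
    · have h1 : a ≤ t := h1
      have h2 : t < s := h2
      have h3 : s ≤ b - 1 := h3
      exact Or.inl ⟨h1, h2, by simp; linarith, by simp; linarith⟩
    · exact Or.inr ⟨h1, h2, h3, by linarith⟩
  have hsub1 : ∀ p ∈ T3 ∪ T4, ((p.1 + 1, p.2 + 1) : ℝ × ℝ) ∈ T1 ∪ T2 := by
    rintro ⟨t, s⟩ (⟨h1, h2, h3⟩ | ⟨h1, h2, h3, h4⟩)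
    · have h1 : a ≤ t := h1
      have h2 : t < s := h2
      have h3 : s ≤ b - 1 := h3
      exact Or.inl ⟨by simp; linarith, by simp; linarith, by simp; linarith, by simp; linarith⟩
    · have h1 : a ≤ t := h1
      have h2 : t < s := h2
      have h3 : s ≤ t + 1 := h3
      have h4 : t ≤ b - 1 := h4
      exact Or.inr ⟨by simp; linarith, by simp; linarith, by simp; linarith, by simp; linarith⟩
  have hWc : ContinuousOn (fun p : ℝ × ℝ => W (c p.1, c p.2)) (T3 ∪ T4) :=
    hW.cont.comp (by fun_prop) fun p hp => (sub_ne_zero.1 (hne p (hsub p hp))).symm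
  have hA1 : ContinuousOn (fun p : ℝ × ℝ => A (p.1 + 1, p.2 + 1)) (T3 ∪ T4) :=
    hA.comp (f := fun p : ℝ × ℝ => (p.1+1, p.2+1)) (by fun_prop) hsub1
  have key := fun {x y : ℝ × ℝ} => log_unique hst' (hA1.sub (hA.mono hsub)) hWc (x := x) (y := y) (by
    intro p hp
    have hn := hne p (hsub p hp)
    rw [Pi.sub_apply, Complex.exp_sub, hAe _ (hsub1 p hp), hAe _ (hsub p hp), hW.exp_eq _ _ (sub_ne_zero.1 hn).symm]
    simp only [hg])
  have m1 : ((a, b-1) : ℝ × ℝ) ∈ T3 := ⟨by simp, by simp; linarith, by simp⟩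
  have m2 : ((b-1, b) : ℝ × ℝ) ∈ T4 := ⟨by simp; linarith, by simp, by simp, by simp⟩
  have k1 := key (Or.inl m1) (Or.inr m2)
  -- θ
  have hθ : ContinuousOn (fun t : ℝ => A (t, t+1)) (Set.Icc a b) :=
    hA.comp (f := fun t : ℝ => (t, t+1)) (by fun_prop) fun t ht =>
      Or.inr ⟨ht.1, by simp, by simp, ht.2⟩
  have hd := dlog_eq (f := fun t => g (c t) - c t) (by linarith) hθ (fun t ht => by
    rw [hAe _ (Or.inr ⟨ht.1, by simp, by simp, ht.2⟩)]; simp [hg])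
  -- D
  have mD1 : ∀ s ∈ Set.Ioo a b, ((s, b) : ℝ × ℝ) ∈ T1 := fun s hs =>
    ⟨hs.1.le, hs.2, le_rfl, by simpa using hs.1⟩
  have mD2 : ∀ s ∈ Set.Ioo a b, ((a, s) : ℝ × ℝ) ∈ T1 := fun s hs =>
    ⟨le_rfl, hs.1, hs.2.le, by simpa using hs.2⟩
  have cD1 : ContinuousOn (fun s : ℝ => A (s, b)) (Set.Ioo a b) :=
    hA.comp (f := fun s : ℝ => (s, b)) (by fun_prop) fun s hs => Or.inl (mD1 s hs)
  have cD2 : ContinuousOn (fun s : ℝ => A (a, s)) (Set.Ioo a b) :=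
    hA.comp (f := fun s : ℝ => (a, s)) (by fun_prop) fun s hs => Or.inl (mD2 s hs)
  have nD : ∀ s ∈ Set.Ioo a b, c s - c a ≠ 0 := fun s hs => hne _ (Or.inl (mD2 s hs))
  have nD1 : ∀ s ∈ Set.Ioo a b, c b - c s ≠ 0 := fun s hs => hne _ (Or.inl (mD1 s hs))
  have cL : ContinuousOn (fun s : ℝ => Complex.log ((c s - c b) / (c s - c a)) + Real.pi * Complex.I)
      (Set.Ioo a b) := by
    refine ContinuousOn.add (ContinuousOn.clog (ContinuousOn.div (by fun_prop) (by fun_prop) nD) ?_) continuousOn_const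
    exact fun s hs => hslit s hs.1 hs.2
  have hexp : ∀ s ∈ Set.Ioo a b, Complex.exp (A (s, b) - A (a, s)) =
      Complex.exp (Complex.log ((c s - c b) / (c s - c a)) + Real.pi * Complex.I) := by
    intro s hs
    have n1 : (c s - c b) / (c s - c a) ≠ 0 :=
      div_ne_zero (by rw [← neg_sub]; exact neg_ne_zero.2 (nD1 s hs)) (nD s hs)
    rw [Complex.exp_sub, hAe _ (Or.inl (mD1 s hs)), hAe _ (Or.inl (mD2 s hs)), Complex.exp_add,
      Complex.exp_log n1, Complex.exp_pi_mul_I]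
    field_simp
    ring
  have ma : a + 1 ∈ Set.Ioo a b := ⟨by linarith, hab⟩
  have mb : b - 1 ∈ Set.Ioo a b := ⟨by linarith, by linarith⟩
  have k2 := log_unique isPreconnected_Ioo (cD1.sub cD2) cL hexp ma mb
  obtain ⟨k, hk⟩ := Complex.exp_eq_exp_iff_exists_int.1 (hexp _ ma)
  rw [hd] at h3
  simp only [Pi.sub_apply] at k1 k2 h3
  have hb1 : (b - 1 + 1 : ℝ) = b := by ring
  simp only [hb1] at k1
  set P := Complex.log ((c (a+1) - c b) / (c (a+1) - c a))
  set Q := Complex.log ((c (b-1) - c b) / (c (b-1) - c a))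
  have hfin : ((2 * k + 1 : ℤ) : ℂ) * τi = (A (b, b+1) - A (a, a+1)) +
      (W (c a, c (b-1)) - W (c (b-1), c b)) - P - Q := by
    push_cast
    linear_combination (-2) * hk + k2 + k1
  have := int_small hfin.symm (by
    calc _ ≤ ‖A (b, b+1) - A (a, a+1)‖ + ‖W (c a, c (b-1)) - W (c (b-1), c b)‖ + ‖P‖ + ‖Q‖ := by
          refine (norm_sub_le _ _).trans (add_le_add_left ((norm_sub_le _ _).trans (add_le_add_left (norm_add_le _ _) _)) _)
      _ < 6 := by linarith)
  omega

theorem log_norm_lt {z : ℂ} (h : ‖z - 1‖ ≤ 1/2) : ‖Complex.log z‖ < 1 := by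
  have := Complex.norm_log_one_add_half_le_self (z := z - 1) h
  rw [add_sub_cancel] at this
  linarith

/-- small total rotation of the displacement along an almost closed curve -/
theorem rot_small {g : ℂ → ℂ} (hgc : Continuous g) {c : ℝ → ℂ} (hc : Continuous c)
    (hnull : ∀ (γ : ℝ → ℂ) (a b : ℝ), a ≤ b → ContinuousOn γ (Set.Icc a b) → γ a = γ b →
      (∀ t ∈ Set.Icc a b, g (γ t) ≠ γ t) → ∀ u, g u = u → wn γ a b u = 0)
    (hfix : ∀ t, g (c t) ≠ c t) {a b : ℝ} (hab : a ≤ b)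
    (hnear : ∀ t ∈ Set.Icc (0:ℝ) 1, ‖(g (c b + t * (c a - c b)) - (c b + t * (c a - c b))) / (g (c a) - c a) - 1‖ ≤ 1/2) :
    ‖dlog (fun t => g (c t) - c t) a b‖ < 1 := by
  have h0 : g (c a) - c a ≠ 0 := sub_ne_zero.2 (hfix a)
  let γ : ℝ → ℂ := fun t => c (min t b) + ((max 0 (t - b) : ℝ) : ℂ) * (c a - c b)
  have hγ : Continuous γ := by fun_prop
  have γ1 : ∀ t, t ≤ b → γ t = c t := by
    intro t ht
    simp [γ, ht]
  have γ2 : ∀ t, b ≤ t → γ t = c b + ((t - b : ℝ) : ℂ) * (c a - c b) := by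
    intro t ht
    simp only [γ, min_eq_right ht, max_eq_right (sub_nonneg.2 ht)]
  have hn : ∀ t ∈ Set.Icc b (b+1), (g (γ t) - γ t) / (g (c a) - c a) ∈ Complex.slitPlane := by
    intro t ht
    rw [γ2 t ht.1]
    refine mem_slit_of_near (lt_of_le_of_lt (hnear (t - b) ⟨by linarith [ht.1], by linarith [ht.2]⟩) (by norm_num))
  have hγf : ∀ t ∈ Set.Icc a (b+1), g (γ t) ≠ γ t := by
    intro t ht
    rcases le_total t b with h | h
    · rw [γ1 t h]; exact hfix t
    · intro he
      have := hn t ⟨h, ht.2⟩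
      rw [he, sub_self, zero_div] at this
      simp at this
  have hl : γ a = γ (b+1) := by rw [γ1 a hab, γ2 _ (by linarith)]; simp
  have hidx := winding_idx (v := fun z => g z - z) (hgc.sub continuous_id) (by linarith : a ≤ b + 1) hγ.continuousOn
    hl (fun t ht => sub_ne_zero.2 (hγf t ht)) (fun u hu =>
      hnull γ a (b+1) (by linarith) hγ.continuousOn hl hγf u (sub_eq_zero.1 hu))
  obtain ⟨l, hl1, hl2⟩ := hasLog_Icc (f := fun t => g (γ t) - γ t) (a := a) (b := b+1)
    (((hgc.comp hγ).sub hγ).continuousOn) (fun t ht => sub_ne_zero.2 (hγf t ht))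
  rw [dlog_eq (by linarith) hl1 hl2] at hidx
  have hd : dlog (fun t => g (c t) - c t) a b = l b - l a := by
    refine dlog_eq hab (hl1.mono (Set.Icc_subset_Icc le_rfl (by linarith))) fun t ht => ?_
    rw [hl2 t ⟨ht.1, by linarith [ht.2]⟩]
    simp only [γ1 t ht.2]
  have hL : ContinuousOn (fun t => Complex.log ((g (γ t) - γ t) / (g (c a) - c a)) + Complex.log (g (c a) - c a))
      (Set.Icc b (b+1)) := by
    refine ContinuousOn.add (ContinuousOn.clog (ContinuousOn.div_const (((hgc.comp hγ).sub hγ).continuousOn) _) ?_) continuousOn_const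
    exact hn
  have := log_unique isPreconnected_Icc (hl1.mono (Set.Icc_subset_Icc hab le_rfl)) hL (by
    intro t ht
    rw [hl2 t ⟨by linarith [ht.1], ht.2⟩, Complex.exp_add, Complex.exp_log (Complex.slitPlane_ne_zero (hn t ht)),
      Complex.exp_log h0]
    field_simp) (Set.left_mem_Icc.2 (by linarith : b ≤ b + 1)) (Set.right_mem_Icc.2 (by linarith))
  rw [← hl, γ1 a hab, γ1 b le_rfl, div_self h0, Complex.log_one] at this
  have e : l b - l a = Complex.log ((g (c b) - c b) / (g (c a) - c a)) := by
    linear_combination this + hidx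
  rw [hd, e]
  apply log_norm_lt
  simpa using hnear 0 ⟨le_rfl, zero_le_one⟩


theorem curve_exists (g : ℂ ≃ₜ ℂ) {z0 d : ℂ} (h : g z0 = z0 + d) :
    ∃ c : ℝ → ℂ, Continuous c ∧ (∀ t, c (t + 1) = g (c t)) ∧
      ∀ t ∈ Set.Icc (0:ℝ) 1, c t = z0 + t * d := by
  let c : ℝ → ℂ := fun t => (g ^ ⌊t⌋ : ℂ ≃ₜ ℂ) (z0 + ((Int.fract t : ℝ) : ℂ) * d)
  have hstep : ∀ t, c (t + 1) = g (c t) := by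
    intro t
    simp only [c, Int.floor_add_one, Int.fract_add_one]
    rw [add_comm, zpow_add, zpow_one]
    rfl
  have hI : ∀ (n : ℤ), ∀ t ∈ Set.Icc (n:ℝ) (n+1), c t = (g ^ n : ℂ ≃ₜ ℂ) (z0 + ((t - n : ℝ) : ℂ) * d) := by
    intro n t ht
    rcases ht.2.lt_or_eq with h1 | h1
    · have : ⌊t⌋ = n := Int.floor_eq_iff.2 ⟨ht.1, h1⟩
      simp only [c, Int.fract, this]
    · have e1 : ⌊t⌋ = n + 1 := by rw [h1]; simp
      have e2 : Int.fract t = 0 := by rw [h1]; simp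
      simp only [c, e1, e2]
      rw [h1, zpow_add, zpow_one]
      simp [h]
  refine ⟨c, ?_, hstep, ?_⟩
  · rw [continuous_iff_continuousAt]
    intro t
    have hn : ∀ n : ℤ, ContinuousOn c (Set.Icc (n:ℝ) (n+1)) := by
      intro n
      refine ContinuousOn.congr (f := fun t : ℝ => (g ^ n : ℂ ≃ₜ ℂ) (z0 + ((t - n : ℝ) : ℂ) * d)) ?_ (hI n)
      exact ((g ^ n : ℂ ≃ₜ ℂ).continuous.comp (by fun_prop)).continuousOn
    have h1 := hn ⌊t⌋
    have h2 := hn (⌊t⌋ - 1)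
    have h3 := h2.union_of_isClosed h1 isClosed_Icc isClosed_Icc
    refine h3.continuousAt ?_
    have a1 := Int.floor_le t
    have a2 := Int.lt_floor_add_one t
    filter_upwards [Ioo_mem_nhds (show (⌊t⌋:ℝ) - 1 < t by linarith) a2] with x hx
    rcases le_total x ⌊t⌋ with h | h
    · left; push_cast; exact ⟨hx.1.le, by linarith⟩
    · right; exact ⟨h, hx.2.le⟩
  · intro t ht
    have := hI 0 t (by simpa using ht)
    rw [this]
    simp

theorem trans_contra {g : ℂ ≃ₜ ℂ} {W : ℂ × ℂ → ℂ} (hW : IsAngle g W) {n : ℕ → ℕ} (hr : RecC g n)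
    (hnull : ∀ (γ : ℝ → ℂ) (a b : ℝ), a ≤ b → ContinuousOn γ (Set.Icc a b) → γ a = γ b →
      (∀ t ∈ Set.Icc a b, g (γ t) ≠ γ t) → ∀ u, g u = u → wn γ a b u = 0)
    {z0 d : ℂ} (hd : d ≠ 0) (h : g z0 = z0 + d)
    (hfree : ∀ x ∈ Set.Icc (0:ℝ) 1, ∀ y ∈ Set.Icc (0:ℝ) 1, z0 + x * d = g (z0 + y * d) →
      (x = 1 ∧ y = 0) ∨ (x = 0 ∧ y = 1))
    (hfix : ∀ x ∈ Set.Icc (0:ℝ) 1, g (z0 + x * d) ≠ z0 + x * d) : False := by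
  obtain ⟨c, hc, hstep, hI⟩ := curve_exists g h
  have hdn : 0 < ‖d‖ := norm_pos_iff.2 hd
  -- iterate
  have hit : ∀ (k : ℕ) t, c (t + k) = g^[k] (c t) := by
    intro k
    induction k with
    | zero => simp
    | succ k ih =>
      intro t
      rw [Function.iterate_succ_apply', ← ih, ← hstep]
      push_cast
      ring_nf
  have hstepz : ∀ (k : ℤ) (P : ℂ → ℂ → Prop), (∀ z w, P z w ↔ P (g z) (g w)) → ∀ t s,
      (P (c t) (c s) ↔ P (c (t + k)) (c (s + k))) := by
    intro k P hP t s
    induction k using Int.induction_on generalizing t s with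
    | zero => simp
    | succ k ih =>
      rw [hP, ← hstep, ← hstep, ih (t+1) (s+1)]
      push_cast
      ring_nf
    | pred k ih =>
      have := hP (c (t - 1)) (c (s - 1))
      rw [← hstep, ← hstep] at this
      simp only [sub_add_cancel] at this
      rw [← this, ih (t-1) (s-1)]
      push_cast
      ring_nf
  have hfixc : ∀ t, g (c t) ≠ c t := by
    intro t
    have := hstepz (-⌊t⌋) (fun z _ => g z ≠ z) (by intro z w; simp) t t
    rw [this]
    have e : t + ((-⌊t⌋ : ℤ) : ℝ) = Int.fract t := by simp [Int.fract, sub_eq_add_neg]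
    rw [e, hI _ ⟨Int.fract_nonneg t, (Int.fract_lt_one t).le⟩]
    exact hfix _ ⟨Int.fract_nonneg t, (Int.fract_lt_one t).le⟩
  have hlag : ∀ t s, t < s → s ≤ t + 1 → c t ≠ c s := by
    intro t s hts hst
    have := hstepz (-⌊t⌋) (fun z w => z ≠ w) (by intro z w; simp) t s
    rw [this]
    have e : t + ((-⌊t⌋ : ℤ) : ℝ) = Int.fract t := by simp [Int.fract, sub_eq_add_neg]
    rw [e]
    have h0 := Int.fract_nonneg t
    have h1 := Int.fract_lt_one t
    set t' := Int.fract t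
    set s' := s + ((-⌊t⌋ : ℤ) : ℝ)
    have hs1 : t' < s' := by rw [← e]; simp only [s']; linarith
    have hs2 : s' ≤ t' + 1 := by rw [← e]; simp only [s']; linarith
    intro heq
    rcases le_total s' 1 with h2 | h2
    · rw [hI _ ⟨h0, h1.le⟩, hI s' ⟨by linarith, h2⟩] at heq
      have := mul_right_cancel₀ hd (add_left_cancel heq)
      have : t' = s' := by exact_mod_cast this
      linarith
    · have e2 : c s' = g (c (s' - 1)) := by rw [← hstep]; simp
      rw [e2, hI _ ⟨h0, h1.le⟩, hI (s' - 1) ⟨by linarith, by linarith⟩] at heq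
      rcases hfree t' ⟨h0, h1.le⟩ (s' - 1) ⟨by linarith, by linarith⟩ heq with h | h
      · linarith [h.1]
      · linarith [h.1, h.2]
  set y := c (1/2) with hy
  have hgy : g y - y ≠ 0 := sub_ne_zero.2 (hfixc _)
  have hgy' : g.symm y ≠ y := by
    intro e
    apply hfixc (1/2)
    rw [← hy]; nth_rw 1 [← e]; simp
  -- nearness
  have E1 : ∀ᶠ z in 𝓝 y, ‖(g y - z) / (g y - y) - 1‖ < 1/2 := by
    have : ContinuousAt (fun z => ‖(g y - z) / (g y - y) - 1‖) y := by fun_prop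
    exact this.eventually_lt_const (by simp [div_self hgy])
  have E2 : ∀ᶠ z in 𝓝 y, ‖(g.symm z - z) / (g.symm z - y) - 1‖ < 1/2 := by
    have h0 := sub_ne_zero.2 hgy'
    have : ContinuousAt (fun z => ‖(g.symm z - z) / (g.symm z - y) - 1‖) y := by
      have := g.symm.continuous.continuousAt (x := y)
      refine ContinuousAt.norm (ContinuousAt.sub (ContinuousAt.div (by fun_prop) (by fun_prop) h0) continuousAt_const)
    exact this.eventually_lt_const (by simp [div_self h0])
  have E3 : ∀ᶠ z in 𝓝 y, ‖W (y, g.symm z) - W (g.symm z, z)‖ < 1 := by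
    have ho : IsOpen {p : ℂ × ℂ | p.1 ≠ p.2} := isOpen_ne_fun continuous_fst continuous_snd
    have hs := g.symm.continuous
    have w1 : ContinuousAt (fun z => W (y, g.symm z)) y :=
      ContinuousAt.comp (f := fun z => (y, g.symm z)) (g := W) (hW.cont.continuousAt (ho.mem_nhds hgy'.symm)) (by fun_prop)
    have w2 : ContinuousAt (fun z => W (g.symm z, z)) y :=
      ContinuousAt.comp (f := fun z => (g.symm z, z)) (g := W) (hW.cont.continuousAt (ho.mem_nhds hgy')) (by fun_prop)
    exact (w1.sub w2).norm.eventually_lt_const (by simp [hW.symm hgy'])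
  have E4 : ∀ᶠ z in 𝓝 y, ‖(g z - z) / (g y - y) - 1‖ < 1/2 := by
    have := g.continuous
    have : ContinuousAt (fun z => ‖(g z - z) / (g y - y) - 1‖) y := by fun_prop
    exact this.eventually_lt_const (by simp [div_self hgy])
  have E5 : ∀ᶠ z in 𝓝 y, z ∉ c '' Set.Icc 1 (3/2) := by
    refine (isCompact_Icc.image hc).isClosed.isOpen_compl.mem_nhds ?_
    rintro ⟨s, hs, hse⟩
    exact hlag (1/2) s (by linarith [hs.1]) (by linarith [hs.2]) hse.symm
  obtain ⟨δ, hδ, hball⟩ := Metric.eventually_nhds_iff.1 (E1.and (E2.and (E3.and (E4.and E5))))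
  obtain ⟨r, hr0, hr1, hrδ⟩ : ∃ r : ℝ, 0 < r ∧ r ≤ 1/2 ∧ r * ‖d‖ < δ := by
    refine ⟨min (1/2) (δ / (2 * ‖d‖)), by positivity, min_le_left _ _, ?_⟩
    have := mul_le_mul_of_nonneg_right (min_le_right (1/2) (δ / (2 * ‖d‖))) hdn.le
    have e : δ / (2 * ‖d‖) * ‖d‖ = δ / 2 := by field_simp
    linarith
  let Pi0 : Set ℂ := {z | ((z - y) / d).re = 0 ∧ |((z - y) / d).im| ≤ r}
  have hPi0c : IsClosed Pi0 := by
    have h1 : IsClosed {z : ℂ | ((z - y) / d).re = 0} :=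
      isClosed_eq (Complex.continuous_re.comp (by fun_prop)) continuous_const
    have h2 : IsClosed {z : ℂ | |((z - y) / d).im| ≤ r} :=
      isClosed_le (Complex.continuous_im.comp (by fun_prop)).abs continuous_const
    exact h1.inter h2
  have hPi0b : ∀ z ∈ Pi0, dist z y < δ := by
    rintro z ⟨h1, h2⟩
    have h3 : ‖(z - y) / d‖ ≤ r := by
      refine (Complex.norm_le_abs_re_add_abs_im _).trans ?_
      rw [h1]; simpa using h2
    rw [norm_div, div_le_iff₀ hdn] at h3
    rw [dist_eq_norm]; linarith
  have hPi0s : ∀ z ∈ Pi0, ∀ u ∈ Set.Icc (0:ℝ) 1, y + u * (z - y) ∈ Pi0 := by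
    rintro z ⟨h1, h2⟩ u hu
    have e : (y + u * (z - y) - y) / d = u * ((z - y) / d) := by ring
    refine ⟨?_, ?_⟩
    · rw [e, Complex.re_ofReal_mul, h1, mul_zero]
    · rw [e, Complex.im_ofReal_mul, abs_mul, abs_of_nonneg hu.1]
      exact (mul_le_of_le_one_left (abs_nonneg _) hu.2).trans h2
  have hyI : y = z0 + ((1/2 : ℝ) : ℂ) * d := hI (1/2) ⟨by norm_num, by norm_num⟩
  have hcI : ∀ s ∈ Set.Icc (0:ℝ) 1, (c s - y) / d = ((s - 1/2 : ℝ) : ℂ) := by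
    intro s hs
    rw [hI s hs, hyI]
    push_cast
    field_simp
    ring
  -- existence of a return
  have hret : ∃ S, 3/2 ≤ S ∧ c S ∈ Pi0 := by
    have h1 := hr.2 _ (isCompact_Icc (a := (0:ℝ)) (b := 1) |>.image hc) (r * ‖d‖) (by positivity)
    obtain ⟨j, hj, hj2⟩ := (h1.and (hr.1.eventually_ge_atTop 2)).exists
    set N := n j
    have hcl : ∀ s ∈ Set.Icc (0:ℝ) 1, ‖(c (s + N) - c s) / d‖ < r := by
      intro s hs
      rw [norm_div, div_lt_iff₀ hdn, hit]
      exact hj _ ⟨s, hs, rfl⟩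
    have hdec : ∀ s ∈ Set.Icc (0:ℝ) 1, (c (s + N) - y) / d = (c (s + N) - c s) / d + ((s - 1/2 : ℝ) : ℂ) := by
      intro s hs
      rw [← hcI s hs]; ring
    let φ : ℝ → ℝ := fun s => ((c (s + N) - y) / d).re
    have hφ : Continuous φ := Complex.continuous_re.comp (by fun_prop)
    have hφ1 : φ (1/2 - r) ≤ 0 := by
      have hm : 1/2 - r ∈ Set.Icc (0:ℝ) 1 := ⟨by linarith, by linarith⟩
      have h2 := (Complex.abs_re_le_norm _).trans_lt (hcl _ hm)
      simp only [φ]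
      rw [hdec _ hm, Complex.add_re, Complex.ofReal_re]
      linarith [(abs_lt.1 h2).2]
    have hφ2 : 0 ≤ φ (1/2 + r) := by
      have hm : 1/2 + r ∈ Set.Icc (0:ℝ) 1 := ⟨by linarith, by linarith⟩
      have h2 := (Complex.abs_re_le_norm _).trans_lt (hcl _ hm)
      simp only [φ]
      rw [hdec _ hm, Complex.add_re, Complex.ofReal_re]
      linarith [(abs_lt.1 h2).1]
    obtain ⟨s, hs, hs0⟩ := intermediate_value_Icc (by linarith : 1/2 - r ≤ 1/2 + r) hφ.continuousOn ⟨hφ1, hφ2⟩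
    have hm : s ∈ Set.Icc (0:ℝ) 1 := ⟨by linarith [hs.1], by linarith [hs.2]⟩
    refine ⟨s + N, ?_, hs0, ?_⟩
    · have : (2:ℝ) ≤ N := by exact_mod_cast hj2
      linarith [hm.1]
    · rw [hdec s hm, Complex.add_im, Complex.ofReal_im, add_zero]
      exact ((Complex.abs_im_le_norm _).trans_lt (hcl _ hm)).le
  obtain ⟨S, hS, hSPi0⟩ := hret
  let P : Set (ℝ × ℝ) := {p | 1/2 ≤ p.1 ∧ p.1 + 1 ≤ p.2 ∧ p.2 ≤ S ∧ (c p.1 = c p.2 ∨ (p.1 = 1/2 ∧ c p.2 ∈ Pi0))}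
  have hPc : IsClosed P := by
    have h1 : IsClosed {p : ℝ × ℝ | 1/2 ≤ p.1} := isClosed_le (by fun_prop) (by fun_prop)
    have h2 : IsClosed {p : ℝ × ℝ | p.1 + 1 ≤ p.2} := isClosed_le (by fun_prop) (by fun_prop)
    have h3 : IsClosed {p : ℝ × ℝ | p.2 ≤ S} := isClosed_le (by fun_prop) (by fun_prop)
    have h4 : IsClosed {p : ℝ × ℝ | c p.1 = c p.2} := isClosed_eq (by fun_prop) (by fun_prop)
    have h5 : IsClosed {p : ℝ × ℝ | p.1 = 1/2} := isClosed_eq (by fun_prop) (by fun_prop)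
    have h6 : IsClosed {p : ℝ × ℝ | c p.2 ∈ Pi0} := hPi0c.preimage (by fun_prop)
    exact h1.inter (h2.inter (h3.inter (h4.union (h5.inter h6))))
  have hPk : IsCompact P := by
    refine (isCompact_Icc (a := ((1/2, 1/2) : ℝ × ℝ)) (b := (S, S))).of_isClosed_subset hPc ?_
    rintro ⟨t, s⟩ ⟨h1, h2, h3, -⟩
    have h1 : 1/2 ≤ t := h1
    have h2 : t + 1 ≤ s := h2
    have h3 : s ≤ S := h3
    exact ⟨⟨h1, by simp; linarith⟩, ⟨by simp; linarith, h3⟩⟩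
  obtain ⟨⟨t1, b⟩, ⟨ht1, htb, hbS, hor⟩, hmin⟩ := hPk.exists_isMinOn
    ⟨(1/2, S), ⟨le_rfl, by simp; linarith, le_rfl, Or.inr ⟨rfl, hSPi0⟩⟩⟩ continuous_snd.continuousOn
  have ht1 : 1/2 ≤ t1 := ht1
  have htb : t1 + 1 ≤ b := htb
  have hbS : b ≤ S := hbS
  have hor : c t1 = c b ∨ (t1 = 1/2 ∧ c b ∈ Pi0) := hor
  have hmin1 : ∀ t s, 1/2 ≤ t → t + 1 ≤ s → s < b → c t ≠ c s := by
    intro t s h1 h2 h3 h4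
    have := hmin (show (t, s) ∈ P from ⟨h1, h2, by simp; linarith, Or.inl h4⟩)
    have : b ≤ s := this
    linarith
  have hmin2 : ∀ s, 3/2 ≤ s → s < b → c s ∉ Pi0 := by
    intro s h2 h3 h4
    have := hmin (show (1/2, s) ∈ P from ⟨le_rfl, by simp; linarith, by simp; linarith, Or.inr ⟨rfl, h4⟩⟩)
    have : b ≤ s := this
    linarith
  have hbm : ∀ b, c b = g (c (b - 1)) := fun b => by rw [← hstep, sub_add_cancel]
  by_cases hex : ∃ t, 1/2 ≤ t ∧ t + 1 ≤ b ∧ c t = c b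
  · -- exact return
    obtain ⟨a, ha, hab, hcab⟩ := hex
    have hab' : a + 1 < b := by
      refine lt_of_le_of_ne hab fun e => ?_
      exact hlag a b (by linarith) (by linarith) hcab
    have hinj : ∀ t s, a ≤ t → t < s → s ≤ b → s - t < b - a → c t ≠ c s := by
      intro t s h1 h2 h3 h4
      rcases le_or_gt s (t+1) with h5 | h5
      · exact hlag t s h2 h5
      rcases h3.lt_or_eq with h6 | h6
      · exact hmin1 t s (by linarith) h5.le h6
      · subst h6
        rw [← hcab]
        have : a < t := by linarith
        rcases le_or_gt t (a+1) with h7 | h7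
        · exact (hlag a t this h7).symm
        · exact (hmin1 a t ha h7.le h2).symm
    have ne1 : ∀ s, a < s → s < b → c s - c a ≠ 0 := fun s h1 h2 =>
      sub_ne_zero.2 (hinj a s le_rfl h1 h2.le (by linarith)).symm
    refine br_core hW hc hstep hab' hlag hinj ?_ ?_ ?_ ?_ ?_
    · intro s h1 h2
      rw [← hcab, div_self (ne1 s h1 h2)]; simp
    · rw [← hcab, div_self (ne1 _ (by linarith) (by linarith))]; simp
    · rw [← hcab, div_self (ne1 _ (by linarith) (by linarith))]; simp
    · refine rot_small g.continuous hc hnull hfixc (by linarith) ?_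
      intro t ht
      rw [hcab]
      have : g (c b) - c b ≠ 0 := sub_ne_zero.2 (hfixc b)
      simp [div_self this]
    · rw [hW.symm (sub_ne_zero.1 (ne1 (b-1) (by linarith) (by linarith))).symm, ← hcab]; simp
  · push Not at hex
    obtain ⟨rfl, hbPi0⟩ := hor.resolve_left fun h => hex t1 ht1 htb h
    have hbb := hball (hPi0b _ hbPi0)
    have hsy : ∀ s, 1/2 < s → s < b → c s ∉ Pi0 := by
      intro s h1 h2 h3
      rcases le_total s 1 with h4 | h4
      · have := h3.1
        rw [hcI s ⟨by linarith, h4⟩, Complex.ofReal_re] at this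
        linarith
      rcases le_total s (3/2) with h5 | h5
      · exact (hball (hPi0b _ h3)).2.2.2.2 ⟨s, ⟨h4, h5⟩, rfl⟩
      · exact hmin2 s h5 h2 h3
    have hab' : (1/2:ℝ) + 1 < b := by
      refine lt_of_le_of_ne htb fun e => ?_
      exact hbb.2.2.2.2 ⟨b, ⟨by linarith, by linarith⟩, rfl⟩
    have hinj : ∀ t s, 1/2 ≤ t → t < s → s ≤ b → s - t < b - 1/2 → c t ≠ c s := by
      intro t s h1 h2 h3 h4
      rcases le_or_gt s (t+1) with h5 | h5
      · exact hlag t s h2 h5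
      rcases h3.lt_or_eq with h6 | h6
      · exact hmin1 t s (by linarith) h5.le h6
      · subst h6
        exact hex t h1 h5.le
    have ne1 : ∀ s, 1/2 < s → s < b → c s - y ≠ 0 := fun s h1 h2 =>
      sub_ne_zero.2 (hinj (1/2) s le_rfl h1 h2.le (by linarith)).symm
    have hbg : c (b - 1) = g.symm (c b) := by rw [hbm b]; simp
    refine br_core hW hc hstep hab' hlag hinj ?_ ?_ ?_ ?_ ?_
    · intro s h1 h2
      by_contra hns
      rw [← hy] at hns
      rw [Complex.mem_slitPlane_iff, not_or, not_lt, not_not] at hns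
      set x := ((c s - c b) / (c s - y)).re
      have hx : (c s - c b) / (c s - y) = (x : ℂ) := by
        apply Complex.ext <;> simp [x, hns.2]
      have hx0 : x ≤ 0 := hns.1
      rw [div_eq_iff (ne1 s h1 h2)] at hx
      have hx1 : (1 - x : ℂ) ≠ 0 := by
        have : (1 - x : ℝ) ≠ 0 := by linarith
        exact_mod_cast this
      have : c s = y + ((1 / (1 - x) : ℝ) : ℂ) * (c b - y) := by
        push_cast
        field_simp
        linear_combination hx
      refine hsy s h1 h2 ?_
      rw [this]
      refine hPi0s _ hbPi0 _ ⟨div_nonneg zero_le_one (by linarith), ?_⟩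
      rw [div_le_one (by linarith)]; linarith
    · rw [hstep, ← hy]; exact log_norm_lt hbb.1.le
    · rw [hbg, ← hy]; exact log_norm_lt hbb.2.1.le
    · refine rot_small g.continuous hc hnull hfixc (by linarith) ?_
      intro t ht
      rw [← hy]
      have e : c b + t * (y - c b) = y + ((1 - t : ℝ) : ℂ) * (c b - y) := by push_cast; ring
      rw [e]
      exact (hball (hPi0b _ (hPi0s _ hbPi0 (1 - t) ⟨by linarith [ht.2], by linarith [ht.1]⟩))).2.2.2.1.le
    · rw [hbg, ← hy]; exact hbb.2.2.1


theorem seg_contra {g : ℂ ≃ₜ ℂ} {W : ℂ × ℂ → ℂ} (hW : IsAngle g W) {n : ℕ → ℕ} (hr : RecC g n)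
    (hnull : ∀ (γ : ℝ → ℂ) (a b : ℝ), a ≤ b → ContinuousOn γ (Set.Icc a b) → γ a = γ b →
      (∀ t ∈ Set.Icc a b, g (γ t) ≠ γ t) → ∀ u, g u = u → wn γ a b u = 0)
    {p q : ℂ} (hpq : p ≠ q) (hp : g p = p) (hq : g q = q)
    (hfix : ∀ z ∈ openSegment ℝ p q, g z ≠ z) : False := by
  refine star_fixed hW hr hpq hp hq ?_
  intro s hs hgs
  set e := g s - s with he
  have hα : ∀ x ∈ Set.Icc (0:ℝ) 1, s + x * e ∈ openSegment ℝ p q := by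
    intro x hx
    have := convex_openSegment (𝕜 := ℝ) p q hs hgs (sub_nonneg.2 hx.2) hx.1 (by ring)
    convert this using 1
    simp [he]
    ring
  let P : Set (ℝ × ℝ) := {z | s + z.1 * e = g (s + z.2 * e)}
  have hPc : IsClosed P := by
    have := g.continuous
    exact isClosed_eq (by fun_prop) (by fun_prop)
  have hPk : IsCompact (Set.Icc ((0,0) : ℝ × ℝ) (1,1) ∩ P) := isCompact_Icc.inter_right hPc
  obtain ⟨⟨a, b⟩, ⟨hI, hab⟩, hmin⟩ := hPk.exists_isMinOn (f := fun z : ℝ × ℝ => |z.1 - z.2|)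
    ⟨(1, 0), ⟨⟨⟨zero_le_one, le_rfl⟩, ⟨le_rfl, zero_le_one⟩⟩, by
      show s + ((1:ℝ):ℂ) * e = g (s + ((0:ℝ):ℂ) * e)
      simp [he]⟩⟩ (by fun_prop)
  have ha : a ∈ Set.Icc (0:ℝ) 1 := ⟨hI.1.1, hI.2.1⟩
  have hb : b ∈ Set.Icc (0:ℝ) 1 := ⟨hI.1.2, hI.2.2⟩
  have hab : s + a * e = g (s + b * e) := hab
  have hne : a - b ≠ 0 := by
    intro h
    have : a = b := by linarith
    subst this
    exact hfix _ (hα a ha) hab.symm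
  have he0 : e ≠ 0 := sub_ne_zero.2 (hfix s hs)
  have hm : ∀ x ∈ Set.Icc (0:ℝ) 1, b + x * (a - b) ∈ Set.Icc (0:ℝ) 1 := by
    intro x hx
    have := convex_Icc (0:ℝ) 1 hb ha (sub_nonneg.2 hx.2) hx.1 (by ring)
    convert this using 1
    simp; ring
  have hform : ∀ x : ℝ, (s + b * e) + x * (((a - b : ℝ) : ℂ) * e) = s + ((b + x * (a - b) : ℝ) : ℂ) * e := by
    intro x; push_cast; ring
  refine trans_contra hW hr hnull (z0 := s + b * e) (d := ((a - b : ℝ) : ℂ) * e)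
    (mul_ne_zero (by exact_mod_cast hne) he0) ?_ ?_ ?_
  · rw [← hab]; push_cast; ring
  · intro x hx y hy hxy
    rw [hform, hform] at hxy
    have := hmin (show (b + x * (a - b), b + y * (a - b)) ∈ Set.Icc ((0,0) : ℝ × ℝ) (1,1) ∩ P from
      ⟨⟨⟨(hm x hx).1, (hm y hy).1⟩, ⟨(hm x hx).2, (hm y hy).2⟩⟩, hxy⟩)
    have h2 : |a - b| ≤ |(b + x * (a - b)) - (b + y * (a - b))| := this
    have e2 : (b + x * (a - b)) - (b + y * (a - b)) = (x - y) * (a - b) := by ring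
    rw [e2, abs_mul] at h2
    have h3 : 1 ≤ |x - y| := by
      have := abs_pos.2 hne
      by_contra h; push Not at h
      nlinarith
    rcases le_abs'.1 h3 with h | h
    · right; exact ⟨by linarith [hx.1, hy.2], by linarith [hx.1, hy.2]⟩
    · left; exact ⟨by linarith [hx.2, hy.1], by linarith [hx.2, hy.1]⟩
  · intro x hx
    rw [hform]
    exact hfix _ (hα _ (hm x hx))

/-- A homeomorphism opening the angle with vertex `x` and sides `u`, `w` to a straight line. -/
theorem straighten (x u w : ℂ) (hD : u.im * w.re - u.re * w.im ≠ 0) : ∃ H : ℂ ≃ₜ ℂ,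
    ∀ z, H.symm z = x + ((z.im + max (-z.re) 0 : ℝ) : ℂ) * u + ((z.im + max z.re 0 : ℝ) : ℂ) * w := by
  let D := u.im * w.re - u.re * w.im
  have hD : D ≠ 0 := hD
  let A : ℂ → ℝ := fun z => ((z - x).im * w.re - (z - x).re * w.im) / D
  let B : ℂ → ℝ := fun z => (u.im * (z - x).re - u.re * (z - x).im) / D
  have hA : Continuous A := by
    have := Complex.continuous_re; have := Complex.continuous_im
    simp only [A]; fun_prop
  have hB : Continuous B := by
    have := Complex.continuous_re; have := Complex.continuous_im
    simp only [B]; fun_prop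
  have hAB : ∀ z, x + (A z : ℂ) * u + (B z : ℂ) * w = z := by
    intro z
    apply Complex.ext <;> simp [A, B] <;> field_simp <;> simp only [D] <;> ring
  have hA' : ∀ a b : ℝ, A (x + a * u + b * w) = a := by
    intro a b
    simp [A]; field_simp; simp only [D]; ring
  have hB' : ∀ a b : ℝ, B (x + a * u + b * w) = b := by
    intro a b
    simp [B]; field_simp; simp only [D]; ring
  let inv : ℂ → ℂ := fun z => x + ((z.im + max (-z.re) 0 : ℝ) : ℂ) * u + ((z.im + max z.re 0 : ℝ) : ℂ) * w
  have hinv : Continuous inv := by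
    have := Complex.continuous_re; have := Complex.continuous_im
    simp only [inv]; fun_prop
  let tf : ℂ → ℂ := fun z => ((B z - A z : ℝ) : ℂ) + ((min (A z) (B z) : ℝ) : ℂ) * Complex.I
  have hto : Continuous tf := by simp only [tf]; fun_prop
  refine ⟨⟨⟨tf, inv, ?_, ?_⟩, hto, hinv⟩, fun z => rfl⟩
  · intro z
    have e1 : (tf z).re = B z - A z := by simp [tf]
    have e2 : (tf z).im = min (A z) (B z) := by simp [tf]
    simp only [inv, e1, e2]
    have f1 : min (A z) (B z) + max (-(B z - A z)) 0 = A z := by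
      rcases le_total (A z) (B z) with h | h
      · rw [min_eq_left h, max_eq_right (by linarith)]; ring
      · rw [min_eq_right h, max_eq_left (by linarith)]; ring
    have f2 : min (A z) (B z) + max (B z - A z) 0 = B z := by
      rcases le_total (A z) (B z) with h | h
      · rw [min_eq_left h, max_eq_left (by linarith)]; ring
      · rw [min_eq_right h, max_eq_right (by linarith)]; ring
    rw [f1, f2, hAB]
  · intro z
    simp only [tf, inv]
    rw [hA', hB']
    rcases le_total 0 z.re with h | h
    · rw [max_eq_right (by linarith : -z.re ≤ 0), max_eq_left h]
      apply Complex.ext <;> simp [h]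
    · rw [max_eq_left (by linarith : 0 ≤ -z.re), max_eq_right h]
      apply Complex.ext <;> simp [h]

theorem first_hit {F : Set ℂ} (hF : IsClosed F) {x p0 : ℂ} (hx : x ∉ F) (hp : p0 ∈ F) :
    ∃ t : ℝ, 0 < t ∧ x + t * (p0 - x) ∈ F ∧ ∀ s ∈ Set.Ico (0:ℝ) t, x + s * (p0 - x) ∉ F := by
  have hk : IsCompact (Set.Icc (0:ℝ) 1 ∩ (fun s : ℝ => x + s * (p0 - x)) ⁻¹' F) :=
    isCompact_Icc.inter_right (hF.preimage (by fun_prop))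
  obtain ⟨t, ⟨ht, htF⟩, hm⟩ := hk.exists_isLeast ⟨1, by simp, by simpa using hp⟩
  have ht0 : 0 < t := by
    refine lt_of_le_of_ne ht.1 fun h => ?_
    subst h
    apply hx; simpa using htF
  refine ⟨t, ht0, htF, fun s hs hsF => ?_⟩
  have := hm ⟨⟨hs.1, by linarith [hs.2, ht.2]⟩, hsF⟩
  linarith [hs.2]

theorem sphere_thm {X : Type*} [MetricSpace X] [CompactSpace X] [PreconnectedSpace X] {e : X}
    (τ : {x : X // x ≠ e} ≃ₜ ℂ) (K G : X ≃ₜ X) (hK : K e = e) (hG : ∀ x, G x = K (K x))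
    {n : ℕ → ℕ} (hr : RecX G n)
    {x1 x2 : X} (h1 : G x1 = x1) (h2 : G x2 = x2) (h1e : x1 ≠ e) (h2e : x2 ≠ e) (h12 : x1 ≠ x2) :
    ∀ x, G x = x := by
  have he : G e = e := by rw [hG, hK, hK]
  by_contra hcon
  push Not at hcon
  obtain ⟨x0, hx0⟩ := hcon
  have hx0e : x0 ≠ e := by rintro rfl; exact hx0 he
  obtain ⟨W, hW⟩ := exists_angle_chart τ K G hK he hG
  have hconn := fix_conn τ G he hr hW h1 h2 h1e h2e h12
  have main : ∀ (σ : {x : X // x ≠ e} ≃ₜ ℂ) (p q : ℂ), p ≠ q → G (sp σ p) = sp σ p → G (sp σ q) = sp σ q →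
      (∀ z ∈ openSegment ℝ p q, G (sp σ z) ≠ sp σ z) → False := by
    intro σ p q hpq hp hq hz
    obtain ⟨W', hW'⟩ := exists_angle_chart σ K G hK he hG
    refine seg_contra hW' (recC_of_recX σ G he hr) ?_ hpq ((chartMap_fix σ G he p).2 hp)
      ((chartMap_fix σ G he q).2 hq) (fun z h h' => hz z h ((chartMap_fix σ G he z).1 h'))
    intro γ a b hab hγ hl hf u hu
    refine wn_conn_inf σ hab hγ hl hconn he ?_ ((chartMap_fix σ G he u).1 hu)
    intro t ht h
    exact hf t ht ((chartMap_fix σ G he _).2 h)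
  let F : Set ℂ := {z | G (sp τ z) = sp τ z}
  have hFc : IsClosed F := by
    have := sp_cont τ; have := G.continuous
    exact isClosed_eq (by fun_prop) (by fun_prop)
  set p0 := tot τ x1
  set q0 := tot τ x2
  have hp0 : p0 ∈ F := by show G (sp τ p0) = sp τ p0; rw [sp_tot τ h1e, h1]
  have hq0 : q0 ∈ F := by show G (sp τ q0) = sp τ q0; rw [sp_tot τ h2e, h2]
  have hpq0 : p0 ≠ q0 := by
    intro h
    apply h12
    rw [← sp_tot τ h1e, ← sp_tot τ h2e]
    exact congrArg _ h
  have hz0 : tot τ x0 ∉ F := by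
    intro h
    have h : G (sp τ (tot τ x0)) = sp τ (tot τ x0) := h
    rw [sp_tot τ hx0e] at h; exact hx0 h
  -- perturb the point off the line
  obtain ⟨x, hxF, hxD⟩ : ∃ x, x ∉ F ∧ (p0 - x).im * (q0 - x).re - (p0 - x).re * (q0 - x).im ≠ 0 := by
    by_cases h0 : (p0 - tot τ x0).im * (q0 - tot τ x0).re - (p0 - tot τ x0).re * (q0 - tot τ x0).im = 0
    · have hev : ∀ᶠ η : ℝ in 𝓝 0, tot τ x0 + η * (Complex.I * (q0 - p0)) ∉ F := by
        have : ContinuousAt (fun η : ℝ => tot τ x0 + η * (Complex.I * (q0 - p0))) 0 := by fun_prop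
        exact this.eventually_mem (hFc.isOpen_compl.mem_nhds (by simpa using hz0))
      have hev' : ∀ᶠ η : ℝ in 𝓝[≠] 0, tot τ x0 + η * (Complex.I * (q0 - p0)) ∉ F ∧ η ≠ 0 :=
        (hev.filter_mono nhdsWithin_le_nhds).and self_mem_nhdsWithin
      obtain ⟨η, hη, hη0⟩ := hev'.exists
      refine ⟨_, hη, ?_⟩
      set z := tot τ x0
      have hn : 0 < Complex.normSq (q0 - p0) := Complex.normSq_pos.2 (sub_ne_zero.2 hpq0.symm)
      have : (p0 - (z + η * (Complex.I * (q0 - p0)))).im * (q0 - (z + η * (Complex.I * (q0 - p0)))).re -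
          (p0 - (z + η * (Complex.I * (q0 - p0)))).re * (q0 - (z + η * (Complex.I * (q0 - p0)))).im
          = -η * Complex.normSq (q0 - p0) := by
        rw [Complex.normSq_apply]
        simp at h0 ⊢
        linear_combination h0
      rw [this]
      exact mul_ne_zero (neg_ne_zero.2 hη0) hn.ne'
    · exact ⟨_, hz0, h0⟩
  obtain ⟨t, ht, htF, htm⟩ := first_hit hFc hxF hp0
  obtain ⟨s, hs, hsF, hsm⟩ := first_hit hFc hxF hq0
  obtain ⟨H, hH⟩ := straighten x (t * (p0 - x)) (s * (q0 - x)) (by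
    have : (t * (p0 - x)).im * (s * (q0 - x)).re - (t * (p0 - x)).re * (s * (q0 - x)).im =
      t * s * ((p0 - x).im * (q0 - x).re - (p0 - x).re * (q0 - x).im) := by
      simp only [Complex.re_ofReal_mul, Complex.im_ofReal_mul]; ring
    rw [this]
    exact mul_ne_zero (mul_ne_zero ht.ne' hs.ne') hxD)
  have hsp : ∀ z, sp (τ.trans H) z = sp τ (H.symm z) := fun z => rfl
  refine main (τ.trans H) (-1) 1 (by norm_num) ?_ ?_ ?_
  · rw [hsp, hH]
    have h3 : G (sp τ _) = sp τ _ := htF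
    simpa using h3
  · rw [hsp, hH]
    have h3 : G (sp τ _) = sp τ _ := hsF
    simpa using h3
  · intro z hz
    rw [hsp, hH]
    obtain ⟨a, b, ha, hb, hab, rfl⟩ := hz
    have e1 : (a • (-1:ℂ) + b • (1:ℂ)).re = b - a := by simp; ring
    have e2 : (a • (-1:ℂ) + b • (1:ℂ)).im = 0 := by simp
    rw [e1, e2]
    rcases le_total a b with h | h
    · rw [max_eq_right (by linarith), max_eq_left (by linarith)]
      have e3 : x + ((0 + 0 : ℝ) : ℂ) * (t * (p0 - x)) + ((0 + (b - a) : ℝ) : ℂ) * (s * (q0 - x)) =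
          x + (((b - a) * s : ℝ) : ℂ) * (q0 - x) := by push_cast; ring
      have := hsm ((b - a) * s) ⟨mul_nonneg (by linarith) hs.le, by nlinarith⟩
      intro h'
      apply this
      rw [e3] at h'
      exact h'
    · rw [max_eq_left (by linarith), max_eq_right (by linarith)]
      have e3 : x + ((0 + -(b - a) : ℝ) : ℂ) * (t * (p0 - x)) + ((0 + 0 : ℝ) : ℂ) * (s * (q0 - x)) =
          x + (((a - b) * t : ℝ) : ℂ) * (p0 - x) := by push_cast; ring
      have := htm ((a - b) * t) ⟨mul_nonneg (by linarith) ht.le, by nlinarith⟩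
      intro h'
      apply this
      rw [e3] at h'
      exact h'



theorem ext_conn {R : ℝ} (hR : 0 < R) : IsPreconnected {z : ℂ | R < ‖z‖} := by
  have h1 : IsPreconnected {w : ℂ | Real.log R < w.re} :=
    (convex_halfSpace_re_gt (Real.log R)).isPreconnected
  have h2 := h1.image Complex.exp Complex.continuous_exp.continuousOn
  convert h2 using 1
  ext z
  constructor
  · intro hz
    have hz : R < ‖z‖ := hz
    have hz0 : z ≠ 0 := by rintro rfl; simp at hz; linarith
    refine ⟨Complex.log z, ?_, Complex.exp_log hz0⟩
    show Real.log R < (Complex.log z).re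
    rw [Complex.log_re]
    exact Real.log_lt_log hR hz
  · rintro ⟨w, hw, rfl⟩
    have hw : Real.log R < w.re := hw
    show R < ‖Complex.exp w‖
    rw [Complex.norm_exp]
    exact (Real.log_lt_iff_lt_exp hR).1 hw

theorem exists_chart (e : Sphere2) : Nonempty ({x : Sphere2 // x ≠ e} ≃ₜ ℂ) := by
  have : Fact (Module.finrank ℝ (EuclideanSpace ℝ (Fin 3)) = 2 + 1) := ⟨by simp⟩
  let st := stereographic' 2 e
  have hs : ∀ x, x ≠ e ↔ x ∈ st.source := by intro x; simp [st]
  let h1 : {x : Sphere2 // x ≠ e} ≃ₜ st.source := Homeomorph.setCongr (s := {x : Sphere2 | x ≠ e})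
    (by ext x; exact hs x)
  let h2 := st.toHomeomorphSourceTarget
  let h3 : st.target ≃ₜ EuclideanSpace ℝ (Fin 2) :=
    (Homeomorph.setCongr (stereographic'_target e)).trans (Homeomorph.Set.univ _)
  exact ⟨h1.trans (h2.trans (h3.trans Complex.orthonormalBasisOneI.repr.symm.toHomeomorph))⟩

theorem sphere_preconn : PreconnectedSpace Sphere2 := by
  refine Subtype.preconnectedSpace (isPreconnected_sphere ?_ _ _)
  rw [← Module.finrank_eq_rank]
  simp

theorem dist_neg_sph (x y : Sphere2) : 2 ≤ dist x y + dist x (-y) := by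
  have h1 : dist y (-y) = 2 := by
    rw [Subtype.dist_eq, dist_eq_norm]
    have : ((y : EuclideanSpace ℝ (Fin 3)) - ((-y : Sphere2) : EuclideanSpace ℝ (Fin 3))) = (2:ℝ) • (y : EuclideanSpace ℝ (Fin 3)) := by
      simp [two_smul]
    rw [this, norm_smul, norm_eq_of_mem_sphere]; simp
  have := dist_triangle y x (-y)
  rw [dist_comm y x] at this
  linarith

theorem ne_neg_sph (x : Sphere2) : x ≠ -x := by
  intro h
  have := dist_neg_sph x x
  rw [← h] at this
  simp at this
  linarith

theorem dist_neg_neg_sph (x y : Sphere2) : dist (-x) (-y) = dist x y := by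
  simp [Subtype.dist_eq]

/-- abstract antipodal quotient -/
structure AntiQ {Y : Type*} [TopologicalSpace Y] (pr : Sphere2 → Y) : Prop where
  cont : Continuous pr
  opn : IsOpenMap pr
  surj : Function.Surjective pr
  fib : ∀ x y, pr x = pr y ↔ y = x ∨ y = -x

theorem AntiQ.cov {Y : Type*} [TopologicalSpace Y] [T2Space Y] {pr : Sphere2 → Y} (h : AntiQ pr) :
    IsCoveringMap pr := by
  rw [← isLocalHomeomorph_iff_isCoveringMap]
  refine IsLocalHomeomorph.mk _ fun x => ?_
  have hinj : Set.InjOn pr (ball x 1) := by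
    intro a ha b hb hab
    rcases (h.fib a b).1 hab with h1 | h1
    · exact h1.symm
    · have h2 := dist_neg_sph x a
      rw [← h1] at h2
      rw [mem_ball, dist_comm] at ha hb
      linarith
  have : Nonempty Sphere2 := ⟨x⟩
  refine ⟨OpenPartialHomeomorph.ofContinuousOpen (hinj.toPartialEquiv pr (ball x 1)) h.cont.continuousOn h.opn isOpen_ball, ?_, ?_⟩
  · exact mem_ball_self one_pos
  · intro y _; rfl

theorem AntiQ.lift {Y : Type*} [TopologicalSpace Y] [T2Space Y] {pr : Sphere2 → Y} (h : AntiQ pr)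
    {φ : Sphere2 → Y} (hφ : Continuous φ) : ∃ F : Sphere2 → Sphere2, Continuous F ∧ ∀ x, pr (F x) = φ x := by
  classical
  obtain ⟨e⟩ : Nonempty Sphere2 := ⟨⟨EuclideanSpace.single 0 1, by simp⟩⟩
  obtain ⟨τ⟩ := exists_chart e
  obtain ⟨e0, he0⟩ := h.surj (φ (sp τ 0))
  obtain ⟨L0, hL0, -⟩ := star_lift h.cov (S := (Set.univ : Set ℂ)) (x0 := 0) (starConvex_univ 0) (Set.mem_univ _)
    ⟨fun z => φ (sp τ z), (hφ.comp (sp_cont τ)).comp continuous_subtype_val⟩ e0 he0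
  let L : ℂ → Sphere2 := fun z => L0 ⟨z, Set.mem_univ z⟩
  have hLc : Continuous L := L0.continuous.comp (by fun_prop)
  have hL : ∀ z, pr (L z) = φ (sp τ z) := fun z => hL0 _
  obtain ⟨y0, hy0⟩ := h.surj (φ e)
  -- outside a large ball
  have hopen : IsOpen (φ ⁻¹' (pr '' ball y0 1)) := (h.opn _ isOpen_ball).preimage hφ
  have hem : e ∈ φ ⁻¹' (pr '' ball y0 1) := ⟨y0, mem_ball_self one_pos, hy0⟩
  obtain ⟨R, hR0, hR⟩ : ∃ R : ℝ, 0 < R ∧ ∀ z : ℂ, R < ‖z‖ → φ (sp τ z) ∈ pr '' ball y0 1 := by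
    have hk : IsCompact (φ ⁻¹' (pr '' ball y0 1))ᶜ := hopen.isClosed_compl.isCompact
    have hk2 : IsCompact (tot τ '' (φ ⁻¹' (pr '' ball y0 1))ᶜ) := by
      refine hk.image_of_continuousOn fun x hx => ?_
      refine (tot_cont τ ?_).continuousWithinAt
      rintro rfl; exact hx hem
    obtain ⟨R, hR⟩ := hk2.isBounded.exists_norm_le
    refine ⟨max R 1, by positivity, fun z hz => ?_⟩
    by_contra hcon
    have := hR _ ⟨sp τ z, hcon, rfl⟩
    rw [tot_sp] at this
    linarith [le_max_left R 1]
  have hcov : ∀ z, R < ‖z‖ → L z ∈ ball y0 1 ∨ L z ∈ ball (-y0) 1 := by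
    intro z hz
    obtain ⟨w, hw, hw2⟩ := hR z hz
    rw [← hL] at hw2
    rcases (h.fib _ _).1 hw2 with h1 | h1
    · left; rw [h1]; exact hw
    · right; rw [h1, mem_ball, dist_neg_neg_sph]; exact hw
  obtain ⟨y, hy, hyL⟩ : ∃ y, pr y = φ e ∧ ∀ z, R < ‖z‖ → L z ∈ ball y 1 := by
    have hd : Disjoint (ball y0 1) (ball (-y0) 1) := by
      rw [Set.disjoint_left]
      intro x h1 h2
      have := dist_neg_sph x y0
      rw [mem_ball] at h1 h2
      linarith
    have hpre := (ext_conn hR0).image L hLc.continuousOn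
    have := hpre.subset_or_subset isOpen_ball isOpen_ball hd (by
      rintro _ ⟨z, hz, rfl⟩; exact hcov z hz)
    rcases this with h1 | h1
    · exact ⟨y0, hy0, fun z hz => h1 ⟨z, hz, rfl⟩⟩
    · exact ⟨-y0, by rw [← hy0]; exact ((h.fib _ _).2 (Or.inr rfl)).symm, fun z hz => h1 ⟨z, hz, rfl⟩⟩
  let F : Sphere2 → Sphere2 := fun x => if x = e then y else L (tot τ x)
  have hFe : F e = y := by simp [F]
  have hFn : ∀ x, x ≠ e → F x = L (tot τ x) := fun x hx => by simp [F, hx]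
  refine ⟨F, ?_, ?_⟩
  · rw [continuous_iff_continuousAt]
    intro x
    by_cases hx : x = e
    · subst hx
      rw [ContinuousAt, hFe, Metric.tendsto_nhds]
      intro ε hε
      have ho : IsOpen (φ ⁻¹' (pr '' (ball y ε ∩ ball y 1))) :=
        (h.opn _ (isOpen_ball.inter isOpen_ball)).preimage hφ
      have hm : x ∈ φ ⁻¹' (pr '' (ball y ε ∩ ball y 1)) :=
        ⟨y, ⟨mem_ball_self hε, mem_ball_self one_pos⟩, hy⟩
      filter_upwards [ho.mem_nhds hm, chart_far τ R] with x' h1 h2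
      by_cases hx' : x' = x
      · rw [hx', hFe, dist_self]; exact hε
      · have h3 := h2 hx'
        have h4 : R < ‖tot τ x'‖ := by simpa [tot, hx'] using h3
        have h5 := hyL _ h4
        rw [hFn x' hx']
        obtain ⟨w, hw, hw2⟩ := h1
        rw [← sp_tot τ hx', ← hL] at hw2
        rcases (h.fib _ _).1 hw2 with h6 | h6
        · rw [h6]; exact hw.1
        · rw [h6, mem_ball] at h5
          have h7 := hw.2
          rw [mem_ball] at h7
          have := dist_neg_sph y w
          rw [dist_comm y, dist_comm y] at this
          linarith
    · have h1 : ContinuousAt (fun x => L (tot τ x)) x := hLc.continuousAt.comp (tot_cont τ hx)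
      refine h1.congr ?_
      filter_upwards [isOpen_ne.mem_nhds hx] with x' hx'
      exact (hFn x' hx').symm
  · intro x
    by_cases hx : x = e
    · rw [hx, hFe, hy]
    · rw [hFn x hx, hL, sp_tot τ hx]

theorem AntiQ.uniq {Y : Type*} [TopologicalSpace Y] {pr : Sphere2 → Y} (h : AntiQ pr)
    {F F' : Sphere2 → Sphere2} (hF : Continuous F) (hF' : Continuous F') (he : ∀ x, pr (F x) = pr (F' x)) :
    (∀ x, F' x = F x) ∨ ∀ x, F' x = - F x := by
  have := sphere_preconn
  have h1 : IsClosed {x | F' x = F x} := isClosed_eq hF' hF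
  have h2 : IsClosed {x | F' x = -F x} := isClosed_eq hF' hF.neg
  have hd : Disjoint {x | F' x = F x} {x | F' x = -F x} := by
    rw [Set.disjoint_left]
    intro x h1 h2
    have h1 : F' x = F x := h1
    have h2 : F' x = -F x := h2
    exact ne_neg_sph _ (h1.symm.trans h2)
  have hc : (Set.univ : Set Sphere2) ⊆ {x | F' x = F x} ∪ {x | F' x = -F x} := fun x _ =>
    (h.fib _ _).1 (he x)
  rcases (isPreconnected_iff_subset_of_disjoint_closed.1 isPreconnected_univ) _ _ h1 h2 hc (by
    rw [Set.disjoint_iff_inter_eq_empty.1 hd, Set.inter_empty]) with h3 | h3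
  · exact Or.inl fun x => h3 (Set.mem_univ x)
  · exact Or.inr fun x => h3 (Set.mem_univ x)

theorem AntiQ.homeo {Y : Type*} [TopologicalSpace Y] [T2Space Y] {pr : Sphere2 → Y} (h : AntiQ pr)
    (f : Y ≃ₜ Y) : ∃ F : Sphere2 ≃ₜ Sphere2, (∀ x, pr (F x) = f (pr x)) ∧ ∀ x, F (-x) = -F x := by
  obtain ⟨F, hF, hFp⟩ := h.lift (f.continuous.comp h.cont)
  obtain ⟨F', hF', hFp'⟩ := h.lift (f.symm.continuous.comp h.cont)
  simp only [Function.comp] at hFp hFp'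
  have h1 := h.uniq continuous_id (hF'.comp hF) (fun x => by simp [hFp, hFp'])
  have h2 := h.uniq continuous_id (hF.comp hF') (fun x => by simp [hFp, hFp'])
  have hinj : Function.Injective F := by
    intro a b hab
    rcases h1 with h1 | h1
    · rw [← id_eq a, ← id_eq b, ← h1 a, ← h1 b]; simp [hab]
    · have := (h1 a).symm.trans ((congrArg F' hab).trans (h1 b))
      simpa using this
  have hsurj : Function.Surjective F := by
    intro a
    rcases h2 with h2 | h2
    · exact ⟨F' a, h2 a⟩
    · exact ⟨F' (-a), by have := h2 (-a); simpa using this⟩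
  let E := Continuous.homeoOfEquivCompactToT2 (f := Equiv.ofBijective F ⟨hinj, hsurj⟩) hF
  have hE : ∀ x, E x = F x := fun x => rfl
  refine ⟨E, fun x => by rw [hE, hFp], ?_⟩
  simp only [hE]
  have h3 := h.uniq (F := F) (F' := fun x => F (-x)) hF (hF.comp continuous_neg) (fun x => by
    rw [hFp, hFp, (h.fib x (-x)).2 (Or.inr rfl)])
  rcases h3 with h3 | h3
  · intro x
    exact absurd (hinj (h3 x)).symm (ne_neg_sph x)
  · exact h3


theorem sph_sq (x : Sphere2) : (x : EuclideanSpace ℝ (Fin 3)) 0 ^ 2 + (x : EuclideanSpace ℝ (Fin 3)) 1 ^ 2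
    + (x : EuclideanSpace ℝ (Fin 3)) 2 ^ 2 = 1 := by
  have h := x.2
  rw [mem_sphere_zero_iff_norm] at h
  have h1 := EuclideanSpace.norm_sq_eq (x : EuclideanSpace ℝ (Fin 3))
  rw [h, Fin.sum_univ_three] at h1
  simp only [Real.norm_eq_abs, sq_abs] at h1
  linarith

theorem sph_dist_sq (x y : Sphere2) : dist x y ^ 2 = ((x : EuclideanSpace ℝ (Fin 3)) 0 - (y : EuclideanSpace ℝ (Fin 3)) 0) ^ 2
    + ((x : EuclideanSpace ℝ (Fin 3)) 1 - (y : EuclideanSpace ℝ (Fin 3)) 1) ^ 2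
    + ((x : EuclideanSpace ℝ (Fin 3)) 2 - (y : EuclideanSpace ℝ (Fin 3)) 2) ^ 2 := by
  rw [Subtype.dist_eq, dist_eq_norm, EuclideanSpace.norm_sq_eq, Fin.sum_univ_three]
  simp only [Real.norm_eq_abs, sq_abs, PiLp.sub_apply]

theorem sph_mk_mem {a b c : ℝ} (h : a ^ 2 + b ^ 2 + c ^ 2 = 1) :
    (!₂[a, b, c] : EuclideanSpace ℝ (Fin 3)) ∈ Sphere2 := by
  rw [mem_sphere_zero_iff_norm]
  have h1 := EuclideanSpace.norm_sq_eq (!₂[a, b, c] : EuclideanSpace ℝ (Fin 3))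
  rw [Fin.sum_univ_three] at h1
  simp at h1
  rw [h] at h1
  have h2 := norm_nonneg (!₂[a, b, c] : EuclideanSpace ℝ (Fin 3))
  nlinarith

theorem sig_alg (x y : ℝ) : (2 * x / (1 + (x ^ 2 + y ^ 2))) ^ 2 + (2 * y / (1 + (x ^ 2 + y ^ 2))) ^ 2
    + ((x ^ 2 + y ^ 2 - 1) / (1 + (x ^ 2 + y ^ 2))) ^ 2 = 1 := by
  have : 1 + (x ^ 2 + y ^ 2) ≠ 0 := by positivity
  field_simp
  ring

noncomputable def sig (z : ℂ) : Sphere2 :=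
  ⟨_, sph_mk_mem (sig_alg z.re z.im)⟩

theorem sig_cont : Continuous sig := by
  unfold sig
  refine Continuous.subtype_mk ?_ _
  refine (PiLp.continuous_toLp 2 _).comp (continuous_pi fun i => ?_)
  have h : ∀ z : ℂ, 1 + (z.re ^ 2 + z.im ^ 2) ≠ 0 := fun z => by positivity
  fin_cases i
  · exact (Complex.continuous_re.const_mul 2 |>.div (by fun_prop) h)
  · exact (Complex.continuous_im.const_mul 2 |>.div (by fun_prop) h)
  · exact Continuous.div (by fun_prop) (by fun_prop) h

theorem hairy_alg {a b t x y : ℝ} (h : a ^ 2 + b ^ 2 + t ^ 2 = 1)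
    (h1 : a + 2 * t * x - (a * (x ^ 2 - y ^ 2) + 2 * b * x * y) = 0)
    (h2 : b + 2 * t * y - (2 * a * x * y - b * (x ^ 2 - y ^ 2)) = 0) :
    (2 * a * x + 2 * b * y + t * (x ^ 2 + y ^ 2 - 1)) ^ 2 = (1 + (x ^ 2 + y ^ 2)) ^ 2 := by
  have : (a + 2 * t * x - (a * (x ^ 2 - y ^ 2) + 2 * b * x * y)) ^ 2
    + (b + 2 * t * y - (2 * a * x * y - b * (x ^ 2 - y ^ 2))) ^ 2
    + (2 * a * x + 2 * b * y + t * (x ^ 2 + y ^ 2 - 1)) ^ 2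
      = (1 + (x ^ 2 + y ^ 2)) ^ 2 * (a ^ 2 + b ^ 2 + t ^ 2) := by ring
  rw [h1, h2, h] at this
  linarith

set_option maxHeartbeats 1600000 in
theorem hairy (F : Sphere2 → Sphere2) (hF : Continuous F) : ∃ x, F x = x ∨ F x = -x := by
  by_contra hcon
  push Not at hcon
  let N : Sphere2 := ⟨_, sph_mk_mem (a := 0) (b := 0) (c := 1) (by norm_num)⟩
  have hN0 : (N : EuclideanSpace ℝ (Fin 3)) 0 = 0 := rfl
  have hN1 : (N : EuclideanSpace ℝ (Fin 3)) 1 = 0 := rfl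
  have hN2 : (N : EuclideanSpace ℝ (Fin 3)) 2 = 1 := rfl
  let f : Sphere2 → ℂ := fun x => ⟨(F x : EuclideanSpace ℝ (Fin 3)) 0, (F x : EuclideanSpace ℝ (Fin 3)) 1⟩
  let t : Sphere2 → ℝ := fun x => (F x : EuclideanSpace ℝ (Fin 3)) 2
  have hci : ∀ i, Continuous fun x => (F x : EuclideanSpace ℝ (Fin 3)) i := fun i =>
    (PiLp.continuous_apply 2 _ i).comp (continuous_subtype_val.comp hF)
  have hfc : Continuous f := by
    have : f = fun x => ((((F x : EuclideanSpace ℝ (Fin 3)) 0 : ℝ) : ℂ) + (((F x : EuclideanSpace ℝ (Fin 3)) 1 : ℝ) : ℂ) * Complex.I) := by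
      funext x
      apply Complex.ext <;> simp [f]
    rw [this]
    exact (Complex.continuous_ofReal.comp (hci 0)).add ((Complex.continuous_ofReal.comp (hci 1)).mul continuous_const)
  have htc : Continuous t := hci 2
  have hsq : ∀ x, (f x).re ^ 2 + (f x).im ^ 2 + t x ^ 2 = 1 := fun x => sph_sq (F x)
  have hfn : ∀ x, ‖f x‖ ≤ 1 := by
    intro x
    have h1 := Complex.sq_norm (f x)
    rw [Complex.normSq_apply] at h1
    nlinarith [hsq x, norm_nonneg (f x), sq_nonneg (t x)]
  have htn : ∀ x, |t x| ≤ 1 := by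
    intro x
    rw [abs_le_one_iff_mul_self_le_one]
    nlinarith [hsq x, sq_nonneg (f x).re, sq_nonneg (f x).im]
  have hdot : ∀ x : Sphere2, ((F x : EuclideanSpace ℝ (Fin 3)) 0 * (x : EuclideanSpace ℝ (Fin 3)) 0
     + (F x : EuclideanSpace ℝ (Fin 3)) 1 * (x : EuclideanSpace ℝ (Fin 3)) 1 + (F x : EuclideanSpace ℝ (Fin 3)) 2 * (x : EuclideanSpace ℝ (Fin 3)) 2) ^ 2 ≠ 1 := by
    intro x hx
    have h1 := sph_sq x
    have h2 := sph_sq (F x)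
    rcases mul_self_eq_one_iff.1 ((sq _).symm.trans hx) with h | h
    · apply (hcon x).1
      apply dist_eq_zero.1
      have := sph_dist_sq (F x) x
      apply pow_eq_zero_iff (two_ne_zero) |>.1
      nlinarith
    · apply (hcon x).2
      apply dist_eq_zero.1
      have := sph_dist_sq (F x) (-x)
      apply pow_eq_zero_iff (two_ne_zero) |>.1
      simp at this
      nlinarith
  let U : ℂ → ℂ := fun z => f (sig z) + 2 * (t (sig z) : ℂ) * z - (starRingEnd ℂ) (f (sig z)) * z ^ 2
  have hfs : Continuous fun z => f (sig z) := hfc.comp sig_cont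
  have hts : Continuous fun z => (t (sig z) : ℂ) := Complex.continuous_ofReal.comp (htc.comp sig_cont)
  have hUc : Continuous U := by
    have := Complex.continuous_conj.comp hfs
    exact (hfs.add ((continuous_const.mul hts).mul continuous_id)).sub (this.mul (continuous_id.pow 2))
  have hU0 : ∀ z, U z ≠ 0 := by
    intro z hz
    apply hdot (sig z)
    have hre := congrArg Complex.re hz
    have him := congrArg Complex.im hz
    simp [U, pow_two] at hre him
    have := hairy_alg (hsq (sig z)) (x := z.re) (y := z.im) (by linarith) (by linarith)
    have h0 : (sig z : EuclideanSpace ℝ (Fin 3)) 0 = 2 * z.re / (1 + (z.re ^ 2 + z.im ^ 2)) := rfl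
    have h1 : (sig z : EuclideanSpace ℝ (Fin 3)) 1 = 2 * z.im / (1 + (z.re ^ 2 + z.im ^ 2)) := rfl
    have h2 : (sig z : EuclideanSpace ℝ (Fin 3)) 2 = (z.re ^ 2 + z.im ^ 2 - 1) / (1 + (z.re ^ 2 + z.im ^ 2)) := rfl
    rw [h0, h1, h2]
    have hp : 1 + (z.re ^ 2 + z.im ^ 2) ≠ 0 := by positivity
    change (2 * (F (sig z) : EuclideanSpace ℝ (Fin 3)) 0 * z.re + 2 * (F (sig z) : EuclideanSpace ℝ (Fin 3)) 1 * z.im + (F (sig z) : EuclideanSpace ℝ (Fin 3)) 2 * (z.re ^ 2 + z.im ^ 2 - 1)) ^ 2 = _ at this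
    field_simp
    linarith
  obtain ⟨l, hl, hl'⟩ := log_univ hUc hU0
  have hfN : f N ≠ 0 := by
    intro h
    apply hdot N
    rw [hN0, hN1, hN2]
    have := hsq N
    rw [h] at this
    simp at this
    simpa [t] using this
  set a := ‖f N‖ with ha
  have ha0 : 0 < a := norm_pos_iff.2 hfN
  obtain ⟨δ, hδ, hδ'⟩ := Metric.continuous_iff.1 hfc N (a / 2) (by positivity)
  let R : ℝ := 1 + 6 / a + 2 / δ
  have h6 : 0 < 6 / a := by positivity
  have h2 : 0 < 2 / δ := by positivity
  have hR : 0 < R := by positivity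
  have hR6 : 6 < a * R := by
    have : a * R = a + 6 + a * (2 / δ) := by simp only [R]; field_simp
    rw [this]
    have : 0 < a * (2 / δ) := by positivity
    linarith
  have hR2 : 2 < δ * R := by
    have : δ * R = δ + δ * (6 / a) + 2 := by simp only [R]; field_simp
    rw [this]
    have : 0 < δ * (6 / a) := by positivity
    linarith
  have hR1 : 1 < R := by simp only [R]; linarith
  apply circle_no_log 0 hR (k := 2) two_ne_zero
  have hc0 : -(starRingEnd ℂ) (f N) ≠ 0 := by simpa using hfN
  have hnorm : ∀ z ∈ sphere (0:ℂ) R, ‖U z / (-(starRingEnd ℂ) (f N) * z ^ 2) - 1‖ < 1 := by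
    intro z hz
    have hz : ‖z‖ = R := by simpa using hz
    have hz0 : z ≠ 0 := norm_pos_iff.1 (by rw [hz]; exact hR)
    have hs : dist (sig z) N < δ := by
      have h1 := sph_dist_sq (sig z) N
      have h0 : (sig z : EuclideanSpace ℝ (Fin 3)) 0 = 2 * z.re / (1 + (z.re ^ 2 + z.im ^ 2)) := rfl
      have h1' : (sig z : EuclideanSpace ℝ (Fin 3)) 1 = 2 * z.im / (1 + (z.re ^ 2 + z.im ^ 2)) := rfl
      have h2 : (sig z : EuclideanSpace ℝ (Fin 3)) 2 = (z.re ^ 2 + z.im ^ 2 - 1) / (1 + (z.re ^ 2 + z.im ^ 2)) := rfl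
      have hp : 1 + (z.re ^ 2 + z.im ^ 2) ≠ 0 := by positivity
      have h3 : dist (sig z) N ^ 2 = 4 / (1 + (z.re ^ 2 + z.im ^ 2)) := by
        rw [h1, h0, h1', h2, hN0, hN1, hN2]
        field_simp
        ring
      have h4 := Complex.sq_norm z
      rw [Complex.normSq_apply, hz] at h4
      have h5 : z.re ^ 2 + z.im ^ 2 = R ^ 2 := by linarith
      rw [h5] at h3
      apply lt_of_pow_lt_pow_left₀ 2 hδ.le
      rw [h3, div_lt_iff₀ (by positivity)]
      nlinarith
    have hd := hδ' _ hs
    rw [dist_eq_norm] at hd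
    have hne : -(starRingEnd ℂ) (f N) * z ^ 2 ≠ 0 := mul_ne_zero hc0 (pow_ne_zero _ hz0)
    rw [div_sub_one hne, norm_div, div_lt_one (norm_pos_iff.2 hne), norm_mul, norm_neg, RCLike.norm_conj, norm_pow, hz]
    have : U z - -(starRingEnd ℂ) (f N) * z ^ 2 = f (sig z) + 2 * (t (sig z) : ℂ) * z
       - (starRingEnd ℂ) (f (sig z) - f N) * z ^ 2 := by
      simp only [U, map_sub]; ring
    rw [this]
    have e1 := norm_sub_le (f (sig z) + 2 * (t (sig z) : ℂ) * z) ((starRingEnd ℂ) (f (sig z) - f N) * z ^ 2)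
    have e2 := norm_add_le (f (sig z)) (2 * (t (sig z) : ℂ) * z)
    rw [norm_mul, RCLike.norm_conj, norm_pow, hz] at e1
    rw [norm_mul, norm_mul, hz, Complex.norm_real, Real.norm_eq_abs] at e2
    have e3 : ‖(2:ℂ)‖ = 2 := by simp
    rw [e3] at e2
    have e4 := hfn (sig z)
    have e5 := htn (sig z)
    have e6 : ‖f (sig z) - f N‖ * R ^ 2 ≤ a / 2 * R ^ 2 := by gcongr
    have e7 : 2 * |t (sig z)| * R ≤ 2 * R := by nlinarith
    have e8 : 6 * R < a * R ^ 2 := by nlinarith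
    linarith
  have hlogq : HasLog (fun z => U z / (-(starRingEnd ℂ) (f N) * z ^ 2)) (sphere (0:ℂ) R) := by
    refine ⟨fun z => Complex.log (U z / (-(starRingEnd ℂ) (f N) * z ^ 2)), ?_, ?_⟩
    · refine ContinuousOn.clog ?_ (fun z hz => mem_slit_of_near (hnorm z hz))
      refine ContinuousOn.div hUc.continuousOn (by fun_prop) ?_
      intro z hz
      have hz : ‖z‖ = R := by simpa using hz
      have hz0 : z ≠ 0 := norm_pos_iff.1 (by rw [hz]; exact hR)
      exact mul_ne_zero hc0 (pow_ne_zero _ hz0)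
    · intro z hz
      exact Complex.exp_log (Complex.slitPlane_ne_zero (mem_slit_of_near (hnorm z hz)))
  have hUl : HasLog U (sphere (0:ℂ) R) := ⟨l, hl.continuousOn, fun z _ => hl' z⟩
  refine ((hUl.div hlogq).div (HasLog.const hc0)).congr ?_
  intro z hz
  have hz : ‖z‖ = R := by simpa using hz
  have hz0 : z ≠ 0 := norm_pos_iff.1 (by rw [hz]; exact hR)
  have := hU0 z
  have h9 : (starRingEnd ℂ) (f N) ≠ 0 := by simpa using hfN
  simp only [sub_zero]
  field_simp


theorem rec_lift {Y : Type*} [MetricSpace Y] {pr : Sphere2 → Y} (h : AntiQ pr) (f : Y → Y)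
    {n : ℕ → ℕ} (hn : Tendsto n atTop atTop) (hr : ∀ ε > 0, ∀ᶠ k in atTop, ∀ y, dist (f^[n k] y) y < ε)
    (F : Sphere2 → Sphere2) (hF : Continuous F) (hp : ∀ x, pr (F x) = f (pr x)) {x0 : Sphere2} (h0 : F x0 = x0) :
    RecX F n := by
  have := sphere_preconn
  refine ⟨hn, fun ε0 hε0 => ?_⟩
  obtain ⟨ε, hε, hε0', hε1⟩ : ∃ ε : ℝ, 0 < ε ∧ ε ≤ ε0 ∧ ε < 1 :=
    ⟨min ε0 (1/2), by positivity, min_le_left _ _, lt_of_le_of_lt (min_le_right _ _) (by norm_num)⟩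
  have key : ∃ δ > 0, ∀ x y, dist (pr x) (pr y) < δ → dist x y < ε ∨ dist (-x) y < ε := by
    let C : Set (Sphere2 × Sphere2) := {p | ε ≤ dist p.1 p.2 ∧ ε ≤ dist (-p.1) p.2}
    have hC : IsClosed C := by
      have h1 : IsClosed {p : Sphere2 × Sphere2 | ε ≤ dist p.1 p.2} := isClosed_le continuous_const (by fun_prop)
      have h2 : IsClosed {p : Sphere2 × Sphere2 | ε ≤ dist (-p.1) p.2} :=
        isClosed_le continuous_const (continuous_fst.neg.dist continuous_snd)
      exact h1.inter h2
    have hcon : Continuous fun p : Sphere2 × Sphere2 => dist (pr p.1) (pr p.2) :=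
      (h.cont.comp continuous_fst).dist (h.cont.comp continuous_snd)
    rcases C.eq_empty_or_nonempty with hE | hE
    · refine ⟨1, one_pos, fun x y _ => ?_⟩
      by_contra hx
      push Not at hx
      have : (x, y) ∈ C := hx
      rw [hE] at this
      exact this
    · obtain ⟨p, hpC, hpm⟩ := hC.isCompact.exists_isMinOn hE hcon.continuousOn
      refine ⟨dist (pr p.1) (pr p.2), ?_, ?_⟩
      · rw [gt_iff_lt, dist_pos]
        intro he
        have hpC : ε ≤ dist p.1 p.2 ∧ ε ≤ dist (-p.1) p.2 := hpC
        rcases (h.fib _ _).1 he with h1 | h1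
        · have := hpC.1
          rw [h1, dist_self] at this
          linarith
        · have := hpC.2
          rw [h1, dist_self] at this
          linarith
      · intro x y hxy
        by_contra hx
        push Not at hx
        have h3 : (x, y) ∈ C := hx
        have h4 : dist (pr p.1) (pr p.2) ≤ dist (pr x) (pr y) := hpm h3
        linarith
  obtain ⟨δ, hδ, hδ'⟩ := key
  filter_upwards [hr δ hδ] with k hk
  have hit : ∀ m x, pr (F^[m] x) = f^[m] (pr x) := by
    intro m
    induction m with
    | zero => intro x; rfl
    | succ m ih => intro x; rw [Function.iterate_succ_apply, Function.iterate_succ_apply, ih, hp]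
  set H := F^[n k] with hH
  have hHc : Continuous H := hF.iterate _
  have hH0 : H x0 = x0 := Function.iterate_fixed h0 _
  have hA : IsOpen {x | dist (H x) x < ε} := isOpen_lt (hHc.dist continuous_id) continuous_const
  have hB : IsOpen {x | dist (-H x) x < ε} := isOpen_lt (hHc.neg.dist continuous_id) continuous_const
  have hc : (Set.univ : Set Sphere2) ⊆ {x | dist (H x) x < ε} ∪ {x | dist (-H x) x < ε} := fun x _ =>
    hδ' _ _ (by rw [hit]; exact hk _)
  have hd : {x | dist (H x) x < ε} ∩ {x | dist (-H x) x < ε} = ∅ := by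
    ext x
    simp only [Set.mem_inter_iff, Set.mem_setOf_eq, Set.mem_empty_iff_false, iff_false]
    rintro ⟨h1, h2⟩
    have := dist_neg_sph x (H x)
    rw [dist_comm x, dist_comm x] at this
    linarith
  rcases (isPreconnected_iff_subset_of_disjoint.1 isPreconnected_univ) _ _ hA hB hc (by
    rw [hd, Set.inter_empty]) with h3 | h3
  · intro x
    have : dist (H x) x < ε := h3 (Set.mem_univ x)
    linarith
  · exfalso
    have h4 : dist (-H x0) x0 < ε := h3 (Set.mem_univ x0)
    have h5 := dist_neg_sph x0 (H x0)
    rw [hH0, dist_self] at h5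
    rw [hH0, dist_comm] at h4
    linarith

theorem abs_thm {Y : Type*} [MetricSpace Y] {pr : Sphere2 → Y} (h : AntiQ pr) (f : Y ≃ₜ Y)
    {n : ℕ → ℕ} (hn : Tendsto n atTop atTop) (hr : ∀ ε > 0, ∀ᶠ k in atTop, ∀ y, dist (f^[n k] y) y < ε) :
    (∃! x, f x = x) ∨ ∀ x, f (f x) = x := by
  have := sphere_preconn
  obtain ⟨F1, hF1, hodd1⟩ := h.homeo f
  obtain ⟨x0, hx0⟩ := hairy F1 F1.continuous
  obtain ⟨F, hF, hodd, hx0⟩ : ∃ F : Sphere2 ≃ₜ Sphere2, (∀ x, pr (F x) = f (pr x)) ∧ (∀ x, F (-x) = -F x) ∧ F x0 = x0 := by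
    rcases hx0 with hx0 | hx0
    · exact ⟨F1, hF1, hodd1, hx0⟩
    · refine ⟨F1.trans (Homeomorph.neg Sphere2), fun x => ?_, fun x => ?_, ?_⟩
      · change pr (-F1 x) = _
        rw [← hF1, eq_comm, h.fib]
        exact Or.inr rfl
      · change -F1 (-x) = - -F1 x
        rw [hodd1]
      · change -F1 x0 = x0
        rw [hx0, neg_neg]
  have hfix : f (pr x0) = pr x0 := by rw [← hF, hx0]
  by_cases hu : ∀ y, f y = y → y = pr x0
  · exact Or.inl ⟨pr x0, hfix, hu⟩
  right
  push Not at hu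
  obtain ⟨y, hy, hyne⟩ := hu
  obtain ⟨x1, rfl⟩ := h.surj y
  have hx1 : F x1 = x1 ∨ F x1 = -x1 := by
    rw [← h.fib, hF, hy]
  have hrec := rec_lift h f hn hr F F.continuous hF hx0
  have hG : ∀ x, (F.trans F) x = F (F x) := fun x => rfl
  have hit : ∀ m x, (F.trans F)^[m] x = F^[m] (F^[m] x) := by
    intro m x
    rw [← Function.iterate_add_apply, ← two_mul, Function.iterate_mul]
    rfl
  have hrG : RecX (F.trans F) n := by
    refine ⟨hn, fun ε hε => ?_⟩
    filter_upwards [hrec.2 (ε / 2) (by positivity)] with k hk x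
    rw [hit]
    have := dist_triangle (F^[n k] (F^[n k] x)) (F^[n k] x) x
    linarith [hk x, hk (F^[n k] x)]
  obtain ⟨τ⟩ := exists_chart x0
  have hid := sphere_thm τ F (F.trans F) hx0 hG hrG (x1 := -x0) (x2 := x1)
    (by rw [hG, hodd, hx0, hodd, hx0])
    (by
      rw [hG]
      rcases hx1 with h1 | h1
      · rw [h1, h1]
      · rw [h1, hodd, h1, neg_neg])
    (ne_neg_sph x0).symm (fun he => hyne (by rw [he]))
    (fun he => hyne (by rw [← he]; exact ((h.fib _ _).2 (Or.inr rfl)).symm))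
  intro y
  obtain ⟨x, rfl⟩ := h.surj y
  rw [← hF, ← hF, ← hG, hid]


theorem antiQ_proj : AntiQ (Quot.mk _ : Sphere2 → ProjPlane) := by
  have hfib : ∀ x y : Sphere2, (Quot.mk _ x : ProjPlane) = Quot.mk _ y ↔ y = x ∨ y = -x := by
    intro x y
    constructor
    · intro he
      let s : ProjPlane → Set Sphere2 := Quot.lift (fun x => {x, -x}) (by
        intro a b hab
        have : b = -a := Subtype.ext hab
        rw [this, neg_neg]
        exact Set.pair_comm _ _)
      have h1 : ({x, -x} : Set Sphere2) = {y, -y} := congrArg s he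
      have h2 : y ∈ ({x, -x} : Set Sphere2) := by rw [h1]; simp
      simpa using h2
    · rintro (rfl | rfl)
      · rfl
      · exact Quot.sound rfl
  refine ⟨continuous_quot_mk, ?_, Quot.mk_surjective, hfib⟩
  intro U hU
  rw [← isQuotientMap_quot_mk.isOpen_preimage]
  have : (Quot.mk _ : Sphere2 → ProjPlane) ⁻¹' ((Quot.mk _ : Sphere2 → ProjPlane) '' U) = U ∪ (fun x => -x) ⁻¹' U := by
    ext x
    constructor
    · rintro ⟨u, hu, he⟩
      rcases (hfib _ _).1 he with rfl | rfl
      · exact Or.inl hu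
      · right
        change - -u ∈ U
        rwa [neg_neg]
    · rintro (hu | hu)
      · exact ⟨x, hu, rfl⟩
      · exact ⟨-x, hu, ((hfib _ _).2 (Or.inr rfl)).symm⟩
  rw [this]
  exact hU.union (hU.preimage continuous_neg)


/-- A non-trivial recurrent homeomorphism of the real projective plane either
has a unique fixed point or is an involution.  (Recurrence is stated with
respect to any metric compatible with the quotient topology; the notion does
not depend on this choice.) -/
theorem projective_plane_recurrent (f : ProjPlane ≃ₜ ProjPlane)
    (hne : ∃ x, f x ≠ x)
    (hrec : ∃ m : MetricSpace ProjPlane,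
      m.toUniformSpace.toTopologicalSpace = (inferInstance : TopologicalSpace ProjPlane) ∧
      RecurrentWith m (f : ProjPlane → ProjPlane)) :
    (∃! x : ProjPlane, f x = x) ∨ ∀ x, f (f x) = x := by
  obtain ⟨m, hm, n, hn, hr⟩ := hrec
  exact @abs_thm ProjPlane (m.replaceTopology hm.symm) _ antiQ_proj f n hn hr
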